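/- For every real ν ≥ 0, every real ε with 0 < ε ≤ 1, and every integer s ≥ 1, the positive zeros of the derivatives Y′_ν and Y′_{ν+ε} interlace: y′_{ν,s} < y′_{ν+ε,s} < y′_{ν,s+1}. -/

import Mathlib

open Real Filter

/-- Bessel function of the first kind of real order `ν`:
`J_ν(x) = Σ_{k=0}^∞ ((−1)^k / (k! · Γ(ν+k+1))) · (x/2)^{ν+2k}`. -/
noncomputable def besselJ (ν : ℝ) (x : ℝ) : ℝ :=
  ∑' k : ℕ, ((-1 : ℝ) ^ k / ((k.factorial : ℝ) * Real.Gamma (ν + k + 1))) *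
    (x / 2) ^ (ν + 2 * (k : ℝ))

/-- Bessel function of the second kind of real order `ν`, defined as the limit
`Y_ν(x) = lim_{μ→ν, μ ∉ ℤ} (J_μ(x)·cos(μπ) − J_{−μ}(x)) / sin(μπ)`. -/
noncomputable def besselY (ν : ℝ) (x : ℝ) : ℝ :=
  limUnder (nhdsWithin ν {μ : ℝ | ∀ n : ℤ, μ ≠ (n : ℝ)})
    fun μ => (besselJ μ x * Real.cos (μ * π) - besselJ (-μ) x) / Real.sin (μ * π)

/-- `z s`, for integers `s ≥ 1`, enumerates all the positive real zeros of `f`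
in strictly increasing order. -/
structure IsPosZeroSeq (f : ℝ → ℝ) (z : ℕ → ℝ) : Prop where
  pos : ∀ s, 1 ≤ s → 0 < z s
  mono : ∀ s t, 1 ≤ s → s < t → z s < z t
  isZero : ∀ s, 1 ≤ s → f (z s) = 0
  complete : ∀ x, 0 < x → f x = 0 → ∃ s, 1 ≤ s ∧ z s = x

/-- `z s`, for integers `s ≥ 1`, enumerates the zeros `j'_{ν,s}` of `J'_ν`
(increasingly), with the convention that `x = 0` is counted as the first zero
`j'_{0,1}` of `J'_0`. -/
def IsBesselJDerivZeroSeq (ν : ℝ) (z : ℕ → ℝ) : Prop :=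
  (ν = 0 → z 1 = 0 ∧ IsPosZeroSeq (deriv (besselJ 0)) fun s => z (s + 1)) ∧
  (ν ≠ 0 → IsPosZeroSeq (deriv (besselJ ν)) z)


theorem integral_Ioi_deriv_eq_zero_of_tendsto {F F' : ℝ → ℝ}
    (hd : ∀ x, 0 < x → HasDerivAt F (F' x) x)
    (h_int : MeasureTheory.IntegrableOn F' (Set.Ioi 0))
    (h0 : Tendsto F (nhdsWithin 0 (Set.Ioi 0)) (nhds 0)) (htop : Tendsto F atTop (nhds 0)) :
    ∫ x in Set.Ioi (0 : ℝ), F' x = 0 := by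
  have h1 : ContinuousWithinAt (Function.update F 0 0) (Set.Ici 0) 0 := by
    rw [continuousWithinAt_update_same]
    convert h0 using 2
    ext x
    simp [lt_iff_le_and_ne, eq_comm]
  have h2 : ∀ x ∈ Set.Ioi (0 : ℝ), HasDerivAt (Function.update F 0 0) (F' x) x := by
    intro x hx
    refine (hd x hx).congr_of_eventuallyEq ?_
    filter_upwards [Ioi_mem_nhds hx] with y hy
    exact Function.update_of_ne (ne_of_gt hy) _ _
  have h3 : Tendsto (Function.update F 0 0) atTop (nhds 0) := by
    refine htop.congr' ?_
    filter_upwards [Ioi_mem_atTop 0] with y hy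
    exact (Function.update_of_ne (ne_of_gt hy) _ _).symm
  rw [MeasureTheory.integral_Ioi_of_hasDerivAt_of_tendsto h1 h2 h_int h3]
  simp

/-- The kernel `r⁻ⁿ exp (-r - y² / (4 r))`. -/
noncomputable def expKernel (n : ℕ) (y r : ℝ) : ℝ :=
  (r ^ n)⁻¹ * exp (-r - y ^ 2 / (4 * r))

/-- `∫₀^∞ r⁻ⁿ exp (-r - y² / (4 r)) dr`. -/
noncomputable def expKernelIntegral (n : ℕ) (y : ℝ) : ℝ :=
  ∫ r in Set.Ioi (0 : ℝ), expKernel n y r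

theorem expKernel_continuousOn (n : ℕ) (y : ℝ) : ContinuousOn (expKernel n y) (Set.Ioi 0) := by
  unfold expKernel
  have h : ∀ r ∈ Set.Ioi (0 : ℝ), r ≠ 0 := fun r hr => ne_of_gt hr
  have h4 : ∀ r ∈ Set.Ioi (0 : ℝ), 4 * r ≠ 0 := fun r hr => by
    have := h r hr
    positivity
  refine ContinuousOn.mul (ContinuousOn.inv₀ (by fun_prop) fun r hr => pow_ne_zero n (h r hr)) ?_
  refine Real.continuous_exp.comp_continuousOn (ContinuousOn.sub (by fun_prop) ?_)
  exact ContinuousOn.div (by fun_prop) (by fun_prop) h4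

theorem expKernel_pos (n : ℕ) (y : ℝ) {r : ℝ} (hr : 0 < r) : 0 < expKernel n y r := by
  unfold expKernel; positivity

theorem expKernel_le (n : ℕ) {a y r : ℝ} (ha : 0 < a) (hy : a ≤ y) (hr : 0 < r) :
    expKernel n y r ≤ n.factorial * (4 / a ^ 2) ^ n * exp (-r) := by
  unfold expKernel
  have h1 : exp (-r - y ^ 2 / (4 * r)) ≤ exp (-r) * exp (-(a ^ 2 / (4 * r))) := by
    rw [← Real.exp_add]
    apply Real.exp_le_exp.2
    have : a ^ 2 / (4 * r) ≤ y ^ 2 / (4 * r) := by gcongr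
    linarith
  have h2 : exp (-(a ^ 2 / (4 * r))) ≤ n.factorial * (4 * r / a ^ 2) ^ n := by
    have := Real.pow_div_factorial_le_exp (a ^ 2 / (4 * r)) (by positivity) n
    rw [Real.exp_neg, inv_le_comm₀ (by positivity) (by positivity)]
    refine le_trans (le_of_eq ?_) this
    have hf : (n.factorial : ℝ) ≠ 0 := by positivity
    field_simp
    rw [← mul_pow, show (4 * r / a ^ 2) * (a ^ 2 / (4 * r)) = 1 by field_simp, one_pow]
  calc (r ^ n)⁻¹ * exp (-r - y ^ 2 / (4 * r))
      ≤ (r ^ n)⁻¹ * (exp (-r) * (n.factorial * (4 * r / a ^ 2) ^ n)) := by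
        gcongr
        exact h1.trans (by gcongr)
    _ = n.factorial * (4 / a ^ 2) ^ n * exp (-r) := by
        rw [show 4 * r / a ^ 2 = r * (4 / a ^ 2) by ring, mul_pow]
        field_simp

theorem integrableOn_expKernel (n : ℕ) {y : ℝ} (hy : 0 < y) :
    MeasureTheory.IntegrableOn (expKernel n y) (Set.Ioi 0) := by
  refine MeasureTheory.Integrable.mono'
    ((integrableOn_exp_neg_Ioi 0).const_mul (n.factorial * (4 / y ^ 2) ^ n))
    ((expKernel_continuousOn n y).aestronglyMeasurable measurableSet_Ioi) ?_
  refine (MeasureTheory.ae_restrict_mem measurableSet_Ioi).mono fun r hr => ?_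
  rw [Real.norm_of_nonneg (expKernel_pos n y hr).le]
  exact expKernel_le n hy le_rfl hr

theorem expKernelIntegral_pos (n : ℕ) {y : ℝ} (hy : 0 < y) : 0 < expKernelIntegral n y := by
  unfold expKernelIntegral
  rw [MeasureTheory.setIntegral_pos_iff_support_of_nonneg_ae]
  · have : Function.support (expKernel n y) ∩ Set.Ioi 0 = Set.Ioi 0 := by
      ext r
      simp only [Set.mem_inter_iff, Function.mem_support, Set.mem_Ioi, and_iff_right_iff_imp]
      exact fun hr => (expKernel_pos n y hr).ne'
    rw [this]; simp
  · exact (MeasureTheory.ae_restrict_mem measurableSet_Ioi).mono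
      fun r hr => (expKernel_pos n y hr).le
  · exact integrableOn_expKernel n hy

theorem hasDerivAt_expKernelIntegral (n : ℕ) {y : ℝ} (hy : 0 < y) :
    HasDerivAt (expKernelIntegral n) (-(y / 2) * expKernelIntegral (n + 1) y) y := by
  have key := hasDerivAt_integral_of_dominated_loc_of_deriv_le
    (μ := MeasureTheory.volume.restrict (Set.Ioi (0 : ℝ))) (F := fun y r => expKernel n y r)
    (F' := fun y r => -(y / 2) * expKernel (n + 1) y r) (x₀ := y) (s := Set.Ioo (y / 2) (2 * y))
    (bound := fun r => y * ((n + 1).factorial * (4 / (y / 2) ^ 2) ^ (n + 1) * exp (-r)))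
    (Ioo_mem_nhds (by linarith) (by linarith)) ?_ (integrableOn_expKernel n hy) ?_ ?_ ?_ ?_
  · have h := key.2
    rw [MeasureTheory.integral_const_mul] at h
    exact h
  · exact Eventually.of_forall fun z =>
      (expKernel_continuousOn n z).aestronglyMeasurable measurableSet_Ioi
  · exact ((expKernel_continuousOn (n + 1) y).aestronglyMeasurable measurableSet_Ioi).const_mul _
  · refine (MeasureTheory.ae_restrict_mem measurableSet_Ioi).mono fun r hr z hz => ?_
    have hz0 : 0 < z := by linarith [hz.1]
    rw [norm_mul, Real.norm_of_nonneg (expKernel_pos _ _ hr).le, norm_neg,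
      Real.norm_of_nonneg (by positivity)]
    have h1 := expKernel_le (n + 1) (half_pos hy) hz.1.le hr
    have h2 : z / 2 ≤ y := by linarith [hz.2]
    exact mul_le_mul h2 h1 (expKernel_pos _ _ hr).le hy.le
  · exact ((integrableOn_exp_neg_Ioi 0).const_mul _).const_mul _
  · refine (MeasureTheory.ae_restrict_mem measurableSet_Ioi).mono fun r hr z hz => ?_
    have hr' : r ≠ 0 := ne_of_gt hr
    unfold expKernel
    have h1 : HasDerivAt (fun z : ℝ => -r - z ^ 2 / (4 * r)) (-(2 * z / (4 * r))) z := by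
      have := ((hasDerivAt_pow 2 z).div_const (4 * r)).const_sub (-r)
      simpa using this
    refine ((h1.exp).const_mul ((r ^ n)⁻¹)).congr_deriv ?_
    rw [pow_succ]
    field_simp
    ring

theorem expKernelIntegral_zero_eq {y : ℝ} (hy : 0 < y) :
    expKernelIntegral 0 y = y ^ 2 / 4 * expKernelIntegral 2 y := by
  have h := integral_Ioi_deriv_eq_zero_of_tendsto (F := expKernel 0 y)
    (F' := fun r => y ^ 2 / 4 * expKernel 2 y r - expKernel 0 y r) ?_ ?_ ?_ ?_
  · rw [MeasureTheory.integral_sub ((integrableOn_expKernel 2 hy).const_mul _)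
      (integrableOn_expKernel 0 hy), MeasureTheory.integral_const_mul] at h
    unfold expKernelIntegral
    linarith
  · intro r hr
    have h1 : HasDerivAt (fun r : ℝ => -r - y ^ 2 / (4 * r)) (-1 + y ^ 2 / (4 * r ^ 2)) r := by
      have h2 := (hasDerivAt_id r).const_mul (4 : ℝ)
      have h3 := ((hasDerivAt_const r (y ^ 2)).div h2 (by simp; positivity))
      refine ((hasDerivAt_neg r).sub h3).congr_deriv ?_
      simp only [id]
      field_simp
      ring
    have h2 : expKernel 0 y = fun r => exp (-r - y ^ 2 / (4 * r)) := by
      ext z; simp [expKernel]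
    rw [h2]
    refine h1.exp.congr_deriv ?_
    simp only [expKernel]
    field_simp
    ring
  · exact ((integrableOn_expKernel 2 hy).const_mul _).sub (integrableOn_expKernel 0 hy)
  · have h1 : Tendsto (fun r : ℝ => 4 / y ^ 2 * r) (nhdsWithin 0 (Set.Ioi 0)) (nhds 0) := by
      have : Tendsto (fun r : ℝ => 4 / y ^ 2 * r) (nhds 0) (nhds (4 / y ^ 2 * 0)) :=
        (continuous_const.mul continuous_id).tendsto 0
      rw [mul_zero] at this
      exact this.mono_left nhdsWithin_le_nhds
    refine squeeze_zero' (eventually_nhdsWithin_of_forall fun r hr => (expKernel_pos 0 y hr).le)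
      (eventually_nhdsWithin_of_forall fun r hr => ?_) h1
    have h2 := expKernel_le 1 hy le_rfl hr
    have hr0 : 0 < r := hr
    have h3 : expKernel 0 y r = r * expKernel 1 y r := by
      unfold expKernel; field_simp
    rw [h3, mul_comm]
    refine mul_le_mul_of_nonneg_right (h2.trans ?_) hr0.le
    simp only [Nat.factorial_one, Nat.cast_one, pow_one, one_mul]
    exact mul_le_of_le_one_right (by positivity) (Real.exp_le_one_iff.2 (by linarith))
  · refine squeeze_zero' ((eventually_gt_atTop 0).mono fun r hr => (expKernel_pos 0 y hr).le)
      ((eventually_gt_atTop 0).mono fun r hr => ?_) Real.tendsto_exp_neg_atTop_nhds_zero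
    simpa using expKernel_le 0 hy le_rfl hr

/-- The Macdonald function `K₀`. -/
noncomputable def besselK0 (y : ℝ) : ℝ := expKernelIntegral 1 y / 2

/-- `ϑ K₀`, where `ϑ = y d/dy`. -/
noncomputable def besselK0Theta (y : ℝ) : ℝ := -expKernelIntegral 0 y

theorem besselK0_pos {y : ℝ} (hy : 0 < y) : 0 < besselK0 y :=
  half_pos (expKernelIntegral_pos 1 hy)

theorem besselK0Theta_neg {y : ℝ} (hy : 0 < y) : besselK0Theta y < 0 :=
  neg_neg_of_pos (expKernelIntegral_pos 0 hy)

theorem hasDerivAt_besselK0 {y : ℝ} (hy : 0 < y) :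
    HasDerivAt besselK0 (besselK0Theta y / y) y := by
  refine ((hasDerivAt_expKernelIntegral 1 hy).div_const 2).congr_deriv ?_
  rw [besselK0Theta, expKernelIntegral_zero_eq hy]
  field_simp
  ring

theorem hasDerivAt_besselK0Theta {y : ℝ} (hy : 0 < y) :
    HasDerivAt besselK0Theta (y * besselK0 y) y := by
  refine (hasDerivAt_expKernelIntegral 0 hy).neg.congr_deriv ?_
  rw [besselK0]
  ring

theorem besselK0Theta_le {y : ℝ} (hy : 0 < y) :
    |besselK0Theta y| ≤ 2 * exp (-(y / 2)) := by
  rw [besselK0Theta, abs_neg, abs_of_pos (expKernelIntegral_pos 0 hy), expKernelIntegral]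
  have hi : MeasureTheory.IntegrableOn (fun r : ℝ => exp (-(y / 2)) * exp (-(1 / 2) * r))
      (Set.Ioi 0) := (exp_neg_integrableOn_Ioi 0 (by norm_num)).const_mul _
  calc ∫ r in Set.Ioi (0 : ℝ), expKernel 0 y r
      ≤ ∫ r in Set.Ioi (0 : ℝ), exp (-(y / 2)) * exp (-(1 / 2) * r) := by
        refine MeasureTheory.setIntegral_mono_on (integrableOn_expKernel 0 hy) hi
          measurableSet_Ioi fun r hr => ?_
        have hr0 : 0 < r := hr
        unfold expKernel
        rw [pow_zero, inv_one, one_mul, ← Real.exp_add]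
        apply Real.exp_le_exp.2
        have : 0 ≤ (r - y) ^ 2 / (4 * r) := by positivity
        have h2 : (r - y) ^ 2 / (4 * r) = r / 4 - y / 2 + y ^ 2 / (4 * r) := by field_simp; ring
        linarith
    _ = 2 * exp (-(y / 2)) := by
        rw [MeasureTheory.integral_const_mul, integral_exp_mul_Ioi (by norm_num)]
        simp
        ring

theorem exists_besselK0_le : ∃ K, 0 < K ∧ ∀ y, 0 < y →
    besselK0 y ≤ K * (y ^ (-(1 / 2) : ℝ) * exp (-(y / 2))) := by
  have hi := integrableOn_rpow_mul_exp_neg_mul_rpow (s := -(3 / 4)) (p := 1) (b := 1 / 2)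
    (by norm_num) (by norm_num) (by norm_num)
  set C := ∫ r in Set.Ioi (0 : ℝ), r ^ (-(3 / 4) : ℝ) * exp (-(1 / 2) * r ^ (1 : ℝ)) with hC
  have hC0 : 0 ≤ C := MeasureTheory.setIntegral_nonneg measurableSet_Ioi fun r hr => by
    have hr0 : 0 < r := hr
    positivity
  refine ⟨2 * C + 1, by positivity, fun y hy => ?_⟩
  have h1 : expKernelIntegral 1 y ≤ (2 * (y ^ (-(1 / 2) : ℝ) * exp (-(y / 2)))) * C := by
    rw [hC, ← MeasureTheory.integral_const_mul, expKernelIntegral]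
    refine MeasureTheory.setIntegral_mono_on (integrableOn_expKernel 1 hy) (hi.const_mul _)
      measurableSet_Ioi fun r hr => ?_
    have hr0 : 0 < r := hr
    have h2 : exp (-r - y ^ 2 / (4 * r)) ≤
        exp (-(y / 2)) * exp (-(1 / 2) * r) * exp (-(y ^ 2 / (8 * r))) := by
      rw [← Real.exp_add, ← Real.exp_add]
      apply Real.exp_le_exp.2
      have : 0 ≤ (2 * r - y) ^ 2 / (8 * r) := by positivity
      have h2 : (2 * r - y) ^ 2 / (8 * r) = r / 2 - y / 2 + y ^ 2 / (8 * r) := by field_simp; ring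
      have h3 : y ^ 2 / (4 * r) = 2 * (y ^ 2 / (8 * r)) := by field_simp; norm_num
      linarith
    have h3 : exp (-(y ^ 2 / (8 * r))) ≤ 2 * (y ^ (-(1 / 2) : ℝ) * r ^ (1 / 4 : ℝ)) := by
      have h4 : (y ^ 2 / (8 * r)) ^ (1 / 4 : ℝ) ≤ exp (y ^ 2 / (8 * r)) := by
        have ha : 0 ≤ y ^ 2 / (8 * r) := by positivity
        rcases le_total (y ^ 2 / (8 * r)) 1 with h | h
        · exact (Real.rpow_le_one ha h (by norm_num)).trans (Real.one_le_exp ha)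
        · refine (Real.rpow_le_rpow_of_exponent_le h (by norm_num : (1 / 4 : ℝ) ≤ 1)).trans ?_
          rw [Real.rpow_one]
          linarith [Real.add_one_le_exp (y ^ 2 / (8 * r))]
      have h5 : (y ^ 2 / (8 * r)) ^ (1 / 4 : ℝ) =
          y ^ (1 / 2 : ℝ) / (8 ^ (1 / 4 : ℝ) * r ^ (1 / 4 : ℝ)) := by
        rw [Real.div_rpow (by positivity) (by positivity), Real.mul_rpow (by norm_num) hr0.le,
          ← Real.rpow_natCast y 2, ← Real.rpow_mul hy.le]
        norm_num
      have h6 : (8 : ℝ) ^ (1 / 4 : ℝ) ≤ 2 := by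
        calc (8 : ℝ) ^ (1 / 4 : ℝ) ≤ 16 ^ (1 / 4 : ℝ) := by gcongr; norm_num
          _ = 2 := by
            rw [show (16 : ℝ) = 2 ^ (4 : ℝ) by norm_num, ← Real.rpow_mul (by norm_num)]
            norm_num
      rw [Real.exp_neg]
      rw [h5] at h4
      have h7 := inv_anti₀ (by positivity) h4
      refine h7.trans ?_
      rw [inv_div, Real.rpow_neg hy.le, div_eq_mul_inv]
      have : 0 ≤ r ^ (1 / 4 : ℝ) * (y ^ (1 / 2 : ℝ))⁻¹ := by positivity
      nlinarith
    unfold expKernel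
    have h8 : r ^ (-(3 / 4) : ℝ) = r⁻¹ * r ^ (1 / 4 : ℝ) := by
      rw [← Real.rpow_neg_one, ← Real.rpow_add hr0]; norm_num
    rw [h8, pow_one, Real.rpow_one]
    calc r⁻¹ * exp (-r - y ^ 2 / (4 * r))
        ≤ r⁻¹ * (exp (-(y / 2)) * exp (-(1 / 2) * r) *
          (2 * (y ^ (-(1 / 2) : ℝ) * r ^ (1 / 4 : ℝ)))) := by
          gcongr
          exact h2.trans (by gcongr)
      _ = _ := by ring
  have h2 : 0 ≤ y ^ (-(1 / 2) : ℝ) * exp (-(y / 2)) := by positivity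
  rw [besselK0]
  nlinarith

theorem besselK0_strictAntiOn : StrictAntiOn besselK0 (Set.Ioi 0) := by
  refine strictAntiOn_of_deriv_neg (convex_Ioi 0)
    (fun y hy => (hasDerivAt_besselK0 hy).continuousAt.continuousWithinAt) fun y hy => ?_
  rw [interior_Ioi] at hy
  rw [(hasDerivAt_besselK0 hy).deriv]
  exact div_neg_of_neg_of_pos (besselK0Theta_neg hy) hy

theorem integral_rpow_mul_expKernel {ν r : ℝ} (hν : 0 < ν) (hr : 0 < r) :
    ∫ y in Set.Ioi (0 : ℝ), y ^ (2 * ν - 1) * expKernel 1 y r =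
      4 ^ ν * Gamma ν / 2 * (r ^ (ν - 1) * exp (-r)) := by
  have h1 := integral_rpow_mul_exp_neg_mul_rpow (p := 2) (q := 2 * ν - 1) (b := 1 / (4 * r))
    (by norm_num) (by linarith) (by positivity)
  have h2 : ∀ y : ℝ, y ^ (2 * ν - 1) * expKernel 1 y r =
      r⁻¹ * exp (-r) * (y ^ (2 * ν - 1) * exp (-(1 / (4 * r)) * y ^ (2 : ℝ))) := by
    intro y
    have : -r - y ^ 2 / (4 * r) = -r + -(1 / (4 * r)) * y ^ (2 : ℝ) := by
      rw [Real.rpow_two]; ring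
    rw [expKernel, this, Real.exp_add, pow_one]
    ring
  simp_rw [h2]
  rw [MeasureTheory.integral_const_mul, h1, Real.rpow_sub hr, Real.rpow_one,
    show -(2 * ν - 1 + 1) / 2 = -ν by ring, show (2 * ν - 1 + 1) / 2 = ν by ring, one_div,
    Real.inv_rpow (by positivity), ← Real.rpow_neg (by positivity), neg_neg,
    Real.mul_rpow (by norm_num) hr.le]
  ring

theorem integral_rpow_mul_besselK0 {ν : ℝ} (hν : 0 < ν) :
    ∫ y in Set.Ioi (0 : ℝ), y ^ (2 * ν - 1) * besselK0 y = 4 ^ (ν - 1) * Gamma ν ^ 2 := by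
  set μ := MeasureTheory.volume.restrict (Set.Ioi (0 : ℝ)) with hμ
  have hG : MeasureTheory.Integrable (fun r : ℝ => 4 ^ ν * Gamma ν / 2 * (r ^ (ν - 1) * exp (-r)))
      μ := by
    refine MeasureTheory.Integrable.const_mul ?_ _
    have := Real.GammaIntegral_convergent hν
    refine this.congr (Eventually.of_forall fun r => ?_)
    simp only
    ring
  have h_int : MeasureTheory.Integrable
      (Function.uncurry fun r y : ℝ => y ^ (2 * ν - 1) * expKernel 1 y r) (μ.prod μ) := by
    have hm : Measurable
        (Function.uncurry fun r y : ℝ => y ^ (2 * ν - 1) * expKernel 1 y r) := by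
      unfold expKernel Function.uncurry
      fun_prop
    rw [MeasureTheory.integrable_prod_iff hm.aestronglyMeasurable]
    constructor
    · refine (MeasureTheory.ae_restrict_mem measurableSet_Ioi).mono fun r hr => ?_
      have hr0 : 0 < r := hr
      by_contra hn
      have h0 := MeasureTheory.integral_undef hn
      have h1 := integral_rpow_mul_expKernel hν hr0
      simp only [Function.uncurry] at h0
      rw [h0] at h1
      have : 0 < Gamma ν := Real.Gamma_pos_of_pos hν
      have : 0 < 4 ^ ν * Gamma ν / 2 * (r ^ (ν - 1) * exp (-r)) := by positivity
      linarith
    · refine hG.congr ?_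
      refine (MeasureTheory.ae_restrict_mem measurableSet_Ioi).mono fun r hr => ?_
      simp only [Function.uncurry]
      rw [← integral_rpow_mul_expKernel hν hr]
      refine MeasureTheory.setIntegral_congr_fun measurableSet_Ioi fun y hy => ?_
      have hy0 : 0 < y := hy
      have := expKernel_pos 1 y hr
      rw [Real.norm_of_nonneg (by positivity)]
  have hswap := MeasureTheory.integral_integral_swap h_int
  have hL : ∫ r, ∫ y, y ^ (2 * ν - 1) * expKernel 1 y r ∂μ ∂μ =
      4 ^ ν * Gamma ν / 2 * Gamma ν := by
    rw [Real.Gamma_eq_integral hν, ← Real.Gamma_eq_integral hν]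
    have : ∀ r ∈ Set.Ioi (0 : ℝ), ∫ y, y ^ (2 * ν - 1) * expKernel 1 y r ∂μ =
        4 ^ ν * Gamma ν / 2 * (exp (-r) * r ^ (ν - 1)) := fun r hr => by
      rw [integral_rpow_mul_expKernel hν hr, mul_comm (exp (-r))]
    rw [hμ, MeasureTheory.setIntegral_congr_fun measurableSet_Ioi this,
      MeasureTheory.integral_const_mul, ← Real.Gamma_eq_integral hν]
  rw [hL] at hswap
  have hR : ∀ y : ℝ, ∫ r, y ^ (2 * ν - 1) * expKernel 1 y r ∂μ =
      2 * (y ^ (2 * ν - 1) * besselK0 y) := by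
    intro y
    rw [MeasureTheory.integral_const_mul, besselK0, expKernelIntegral]
    ring
  simp_rw [hR] at hswap
  rw [MeasureTheory.integral_const_mul] at hswap
  rw [Real.rpow_sub (by norm_num), Real.rpow_one]
  linarith

theorem integral_besselK0 : ∫ y in Set.Ioi (0 : ℝ), besselK0 y = π / 2 := by
  have h := integral_rpow_mul_besselK0 (ν := 1 / 2) (by norm_num)
  rw [Real.Gamma_one_half_eq, Real.sq_sqrt Real.pi_pos.le,
    show (1 / 2 - 1 : ℝ) = -(1 / 2) by norm_num, Real.rpow_neg (by norm_num),
    show (4 : ℝ) = 2 ^ (2 : ℝ) by norm_num, ← Real.rpow_mul (by norm_num)] at h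
  norm_num at h
  rw [h]
  ring

/-- The weight `cosh (2ν arsinh z) / √(1 + z²)`. -/
noncomputable def nicholsonWeight (ν z : ℝ) : ℝ := cosh (2 * ν * arsinh z) / √(1 + z ^ 2)

/-- `∫₀^∞ F (2 * x * z) cosh (2ν arsinh z) / √(1 + z²) dz`. -/
noncomputable def nicholsonIntegral (F : ℝ → ℝ) (ν x : ℝ) : ℝ :=
  ∫ z in Set.Ioi (0 : ℝ), F (2 * x * z) * nicholsonWeight ν z

/-- Continuity on `(0, ∞)` with an integrable singularity at `0` and exponential decay. -/
def NicholsonAdmissible (F : ℝ → ℝ) : Prop :=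
  ContinuousOn F (Set.Ioi 0) ∧
    ∃ K, 0 ≤ K ∧ ∀ y, 0 < y → |F y| ≤ K * (y ^ (-(1 / 2) : ℝ) * exp (-(y / 4)))

theorem one_le_sqrt_one_add_sq (z : ℝ) : 1 ≤ √(1 + z ^ 2) :=
  Real.one_le_sqrt.2 (by nlinarith)

theorem exp_abs_mul_arsinh_le (a : ℝ) {z : ℝ} (hz : 0 ≤ z) :
    exp |a * arsinh z| ≤ (1 + 2 * z) ^ |a| := by
  have h0 : 0 ≤ arsinh z := Real.arsinh_nonneg_iff.2 hz
  rw [abs_mul, abs_of_nonneg h0, mul_comm, Real.exp_mul, Real.exp_arsinh]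
  have : √(1 + z ^ 2) ≤ 1 + z := Real.sqrt_le_iff.2 ⟨by linarith, by nlinarith⟩
  have h1 := one_le_sqrt_one_add_sq z
  exact Real.rpow_le_rpow (by linarith) (by linarith) (abs_nonneg _)

theorem cosh_mul_arsinh_le (a : ℝ) {z : ℝ} (hz : 0 ≤ z) :
    cosh (a * arsinh z) ≤ (1 + 2 * z) ^ |a| := by
  refine le_trans ?_ (exp_abs_mul_arsinh_le a hz)
  rw [← Real.cosh_abs, Real.cosh_eq]
  have : exp (-|a * arsinh z|) ≤ exp |a * arsinh z| :=
    Real.exp_le_exp.2 (by linarith [abs_nonneg (a * arsinh z)])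
  linarith

theorem abs_sinh_mul_arsinh_le (a : ℝ) {z : ℝ} (hz : 0 ≤ z) :
    |sinh (a * arsinh z)| ≤ (1 + 2 * z) ^ |a| := by
  refine le_trans ?_ (cosh_mul_arsinh_le a hz)
  refine Real.abs_le_sqrt (x := sinh (a * arsinh z)) (y := cosh (a * arsinh z) ^ 2) ?_ |>.trans ?_
  · rw [Real.cosh_sq]; linarith
  · rw [Real.sqrt_sq (Real.cosh_pos _).le]

theorem nicholsonWeight_pos (ν z : ℝ) : 0 < nicholsonWeight ν z :=
  div_pos (Real.cosh_pos _) (by positivity)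

theorem nicholsonWeight_le (ν : ℝ) {M z : ℝ} (hM : |ν| ≤ M) (hz : 0 ≤ z) :
    nicholsonWeight ν z ≤ (1 + 2 * z) ^ (2 * M) := by
  refine (div_le_self (Real.cosh_pos _).le (one_le_sqrt_one_add_sq z)).trans ?_
  refine (cosh_mul_arsinh_le _ hz).trans ?_
  refine Real.rpow_le_rpow_of_exponent_le (by linarith) ?_
  rw [abs_mul, abs_two]
  linarith

theorem nicholsonWeight_continuous (ν : ℝ) : Continuous (nicholsonWeight ν) := by
  unfold nicholsonWeight
  refine Continuous.div (Real.continuous_cosh.comp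
    (continuous_const.mul Real.continuous_arsinh)) (by fun_prop) fun z => ?_
  positivity

theorem nicholsonWeight_continuous_left (z : ℝ) : Continuous fun ν => nicholsonWeight ν z := by
  unfold nicholsonWeight
  fun_prop

theorem exists_rpow_le_mul_exp {a : ℝ} (ha : 0 < a) (M : ℝ) :
    ∃ C, 0 ≤ C ∧ ∀ z, 0 ≤ z → (1 + 2 * z) ^ M ≤ C * exp (a * z) := by
  obtain ⟨n, hn⟩ := exists_nat_ge M
  refine ⟨n.factorial * (2 / a) ^ n * exp (a / 2), by positivity, fun z hz => ?_⟩
  have h1 : (1 + 2 * z) ^ M ≤ (1 + 2 * z) ^ n := by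
    rw [← Real.rpow_natCast]
    exact Real.rpow_le_rpow_of_exponent_le (by linarith) hn
  refine h1.trans ?_
  have h2 := Real.pow_div_factorial_le_exp (a / 2 * (1 + 2 * z)) (by positivity) n
  rw [div_le_iff₀ (by positivity), mul_pow] at h2
  have h3 : exp (a / 2 * (1 + 2 * z)) = exp (a / 2) * exp (a * z) := by
    rw [← Real.exp_add]; ring_nf
  rw [h3] at h2
  calc (1 + 2 * z) ^ n = (2 / a) ^ n * ((a / 2) ^ n * (1 + 2 * z) ^ n) := by
        rw [← mul_assoc, ← mul_pow]; field_simp; simp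
    _ ≤ (2 / a) ^ n * (exp (a / 2) * exp (a * z) * n.factorial) := by gcongr
    _ = _ := by ring

theorem integrableOn_rpow_mul_exp_mul_rpow {a : ℝ} (ha : 0 < a) (M : ℝ) :
    MeasureTheory.IntegrableOn
      (fun z : ℝ => z ^ (-(1 / 2) : ℝ) * exp (-(a * z)) * (1 + 2 * z) ^ M) (Set.Ioi 0) := by
  obtain ⟨C, hC, h⟩ := exists_rpow_le_mul_exp (half_pos ha) M
  have hi := integrableOn_rpow_mul_exp_neg_mul_rpow (s := -(1 / 2)) (p := 1) (b := a / 2)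
    (by norm_num) (by norm_num) (half_pos ha)
  refine (hi.const_mul C).mono' ?_ ?_
  · refine Measurable.aestronglyMeasurable ?_
    fun_prop
  · refine (MeasureTheory.ae_restrict_mem measurableSet_Ioi).mono fun z hz => ?_
    have hz0 : 0 < z := hz
    rw [Real.norm_of_nonneg (by positivity), Real.rpow_one]
    calc z ^ (-(1 / 2) : ℝ) * exp (-(a * z)) * (1 + 2 * z) ^ M
        ≤ z ^ (-(1 / 2) : ℝ) * exp (-(a * z)) * (C * exp (a / 2 * z)) := by
          gcongr
          exact h z hz0.le
      _ = C * (z ^ (-(1 / 2) : ℝ) * (exp (-(a * z)) * exp (a / 2 * z))) := by ring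
      _ = C * (z ^ (-(1 / 2) : ℝ) * exp (-(a / 2) * z)) := by
          rw [← Real.exp_add]; ring_nf

namespace NicholsonAdmissible

variable {F : ℝ → ℝ}

theorem exists_bound (hF : NicholsonAdmissible F) {a : ℝ} (ha : 0 < a) (M : ℝ) :
    ∃ D : ℝ → ℝ, MeasureTheory.IntegrableOn D (Set.Ioi 0) ∧
      ∀ ν x z, |ν| ≤ M → a ≤ x → 0 < z → ‖F (2 * x * z) * nicholsonWeight ν z‖ ≤ D z := by
  obtain ⟨K, hK, hb⟩ := hF.2
  refine ⟨_, (integrableOn_rpow_mul_exp_mul_rpow (half_pos ha) (2 * M)).const_mul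
    (K * (2 * a) ^ (-(1 / 2) : ℝ)), fun ν x z hν hx hz => ?_⟩
  have hx0 : 0 < x := ha.trans_le hx
  rw [norm_mul, Real.norm_of_nonneg (nicholsonWeight_pos ν z).le, Real.norm_eq_abs]
  have h1 := hb (2 * x * z) (by positivity)
  have h2 : (2 * x * z) ^ (-(1 / 2) : ℝ) ≤ (2 * a) ^ (-(1 / 2) : ℝ) * z ^ (-(1 / 2) : ℝ) := by
    rw [← Real.mul_rpow (by positivity) hz.le]
    exact Real.rpow_le_rpow_of_nonpos (by positivity) (by gcongr) (by norm_num)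
  have h3 : exp (-(2 * x * z / 4)) ≤ exp (-(a / 2 * z)) := by
    apply Real.exp_le_exp.2
    nlinarith
  calc |F (2 * x * z)| * nicholsonWeight ν z
      ≤ K * ((2 * a) ^ (-(1 / 2) : ℝ) * z ^ (-(1 / 2) : ℝ) * exp (-(a / 2 * z))) *
        (1 + 2 * z) ^ (2 * M) := by
        refine mul_le_mul (h1.trans ?_) (nicholsonWeight_le ν hν hz.le)
          (nicholsonWeight_pos ν z).le (by positivity)
        gcongr
    _ = _ := by ring

theorem aestronglyMeasurable (hF : NicholsonAdmissible F) (ν : ℝ) {x : ℝ} (hx : 0 < x) :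
    MeasureTheory.AEStronglyMeasurable (fun z => F (2 * x * z) * nicholsonWeight ν z)
      (MeasureTheory.volume.restrict (Set.Ioi (0 : ℝ))) := by
  refine ContinuousOn.aestronglyMeasurable ?_ measurableSet_Ioi
  refine ContinuousOn.mul ?_ (nicholsonWeight_continuous ν).continuousOn
  refine hF.1.comp (by fun_prop) fun z hz => ?_
  have hz0 : 0 < z := hz
  exact Set.mem_Ioi.2 (by positivity)

theorem integrableOn (hF : NicholsonAdmissible F) (ν : ℝ) {x : ℝ} (hx : 0 < x) :
    MeasureTheory.IntegrableOn (fun z => F (2 * x * z) * nicholsonWeight ν z) (Set.Ioi 0) := by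
  obtain ⟨D, hD, h⟩ := hF.exists_bound hx |ν|
  exact hD.mono' (hF.aestronglyMeasurable ν hx)
    ((MeasureTheory.ae_restrict_mem measurableSet_Ioi).mono fun z hz => h ν x z le_rfl le_rfl hz)

theorem hasDerivAt (hF : NicholsonAdmissible F) {G : ℝ → ℝ} (hG : NicholsonAdmissible G)
    (hd : ∀ y, 0 < y → HasDerivAt F (G y / y) y) (ν : ℝ) {x : ℝ} (hx : 0 < x) :
    HasDerivAt (nicholsonIntegral F ν) (nicholsonIntegral G ν x / x) x := by
  obtain ⟨D, hD, h⟩ := hG.exists_bound (half_pos hx) |ν|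
  have key := hasDerivAt_integral_of_dominated_loc_of_deriv_le
    (μ := MeasureTheory.volume.restrict (Set.Ioi (0 : ℝ)))
    (F := fun x z => F (2 * x * z) * nicholsonWeight ν z)
    (F' := fun x z => x⁻¹ * (G (2 * x * z) * nicholsonWeight ν z)) (x₀ := x)
    (s := Set.Ioi (x / 2)) (bound := fun z => (x / 2)⁻¹ * D z)
    (Ioi_mem_nhds (by linarith)) ?_ (hF.integrableOn ν hx) ?_ ?_ ?_ ?_
  · refine key.2.congr_deriv ?_
    rw [MeasureTheory.integral_const_mul, nicholsonIntegral]
    ring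
  · filter_upwards [Ioi_mem_nhds hx] with t ht
    exact hF.aestronglyMeasurable ν ht
  · exact (hG.aestronglyMeasurable ν hx).const_mul _
  · refine (MeasureTheory.ae_restrict_mem measurableSet_Ioi).mono fun z hz t ht => ?_
    have ht' : x / 2 < t := ht
    have ht0 : 0 < t := by linarith
    have h1 := h ν t z le_rfl ht'.le hz
    rw [norm_mul, Real.norm_of_nonneg (by positivity)]
    gcongr
  · exact hD.const_mul _
  · refine (MeasureTheory.ae_restrict_mem measurableSet_Ioi).mono fun z hz t ht => ?_
    have ht' : x / 2 < t := ht
    have ht0 : 0 < t := by linarith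
    have hz0 : 0 < z := hz
    have h1 : HasDerivAt (fun t : ℝ => 2 * t * z) (2 * z) t := by
      simpa using ((hasDerivAt_id t).const_mul 2).mul_const z
    refine (((hd (2 * t * z) (by positivity)).comp t h1).mul_const _).congr_deriv ?_
    field_simp

theorem continuous (hF : NicholsonAdmissible F) {x : ℝ} (hx : 0 < x) :
    Continuous fun ν => nicholsonIntegral F ν x := by
  rw [continuous_iff_continuousAt]
  intro ν
  obtain ⟨D, hD, h⟩ := hF.exists_bound hx (|ν| + 1)
  refine MeasureTheory.continuousAt_of_dominated (bound := D) ?_ ?_ hD ?_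
  · exact Eventually.of_forall fun t => hF.aestronglyMeasurable t hx
  · have : ∀ᶠ t in nhds ν, |t| < |ν| + 1 :=
      continuous_abs.continuousAt.eventually_lt continuousAt_const (by linarith)
    filter_upwards [this] with t ht
    exact (MeasureTheory.ae_restrict_mem measurableSet_Ioi).mono fun z hz =>
      h t x z ht.le le_rfl hz
  · refine Eventually.of_forall fun z => ?_
    exact (continuous_const.mul (nicholsonWeight_continuous_left z)).continuousAt

theorem rescale (F : ℝ → ℝ) (ν : ℝ) {x : ℝ} (hx : 0 < x) :
    x * nicholsonIntegral F ν x =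
      ∫ y in Set.Ioi (0 : ℝ), F y * nicholsonWeight ν (y / (2 * x)) / 2 := by
  have h := MeasureTheory.integral_comp_mul_left_Ioi
    (fun y => F y * nicholsonWeight ν (y / (2 * x))) 0 (b := 2 * x) (by positivity)
  have h2 : ∀ z : ℝ, 2 * x * z / (2 * x) = z := fun z => by field_simp
  simp only [h2, mul_zero, smul_eq_mul] at h
  rw [nicholsonIntegral, h, MeasureTheory.integral_div]
  field_simp

theorem integrableOn_mul_rpow (hF : NicholsonAdmissible F) (M : ℝ) :
    MeasureTheory.IntegrableOn (fun y => |F y| * (1 + 2 * y) ^ M) (Set.Ioi 0) := by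
  obtain ⟨K, hK, hb⟩ := hF.2
  refine ((integrableOn_rpow_mul_exp_mul_rpow (a := 1 / 4) (by norm_num) M).const_mul K).mono'
    ?_ ?_
  · refine ContinuousOn.aestronglyMeasurable (hF.1.abs.mul ?_) measurableSet_Ioi
    refine ContinuousOn.rpow_const (by fun_prop) fun y hy => Or.inl ?_
    have hy0 : 0 < y := hy
    positivity
  · refine (MeasureTheory.ae_restrict_mem measurableSet_Ioi).mono fun y hy => ?_
    have hy0 : 0 < y := hy
    rw [Real.norm_of_nonneg (by positivity), ← mul_assoc]
    refine mul_le_mul_of_nonneg_right ((hb y hy0).trans (le_of_eq ?_)) (by positivity)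
    ring_nf

theorem tendsto_atTop (hF : NicholsonAdmissible F) (ν : ℝ) :
    Tendsto (fun x => x * nicholsonIntegral F ν x) atTop
      (nhds ((∫ y in Set.Ioi (0 : ℝ), F y) / 2)) := by
  have key : Tendsto (fun x => ∫ y in Set.Ioi (0 : ℝ), F y * nicholsonWeight ν (y / (2 * x)) / 2)
      atTop (nhds (∫ y in Set.Ioi (0 : ℝ), F y / 2)) := by
    refine MeasureTheory.tendsto_integral_filter_of_dominated_convergence
      (fun y => |F y| * (1 + 2 * y) ^ (2 * |ν|)) ?_ ?_ (hF.integrableOn_mul_rpow _) ?_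
    · refine Eventually.of_forall fun x => ?_
      refine ContinuousOn.aestronglyMeasurable ?_ measurableSet_Ioi
      refine ContinuousOn.div_const (hF.1.mul ?_) _
      exact ((nicholsonWeight_continuous ν).comp (by fun_prop)).continuousOn
    · filter_upwards [eventually_ge_atTop (1 / 2 : ℝ)] with x hx
      refine (MeasureTheory.ae_restrict_mem measurableSet_Ioi).mono fun y hy => ?_
      have hy0 : 0 < y := hy
      have hw := nicholsonWeight_pos ν (y / (2 * x))
      rw [norm_div, norm_mul, Real.norm_of_nonneg hw.le, Real.norm_eq_abs, Real.norm_two]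
      have h1 : y / (2 * x) ≤ y := div_le_self hy0.le (by linarith)
      have h2 : nicholsonWeight ν (y / (2 * x)) ≤ (1 + 2 * y) ^ (2 * |ν|) := by
        refine (nicholsonWeight_le ν le_rfl (by positivity)).trans ?_
        gcongr
      have h3 : |F y| * nicholsonWeight ν (y / (2 * x)) ≤ |F y| * (1 + 2 * y) ^ (2 * |ν|) := by
        gcongr
      have h4 : 0 ≤ |F y| * nicholsonWeight ν (y / (2 * x)) := by positivity
      linarith
    · refine Eventually.of_forall fun y => ?_
      have h1 : Tendsto (fun x : ℝ => y / (2 * x)) atTop (nhds 0) :=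
        tendsto_const_nhds.div_atTop (tendsto_id.const_mul_atTop (by norm_num))
      have h2 := ((nicholsonWeight_continuous ν).tendsto 0).comp h1
      have h3 : nicholsonWeight ν 0 = 1 := by simp [nicholsonWeight]
      rw [h3] at h2
      simpa using (h2.const_mul (F y)).div_const 2
  rw [MeasureTheory.integral_div] at key
  refine key.congr' ?_
  filter_upwards [eventually_gt_atTop 0] with x hx
  exact (rescale F ν hx).symm

theorem of_exp_bound {F : ℝ → ℝ} (hc : ContinuousOn F (Set.Ioi 0)) {K : ℝ}
    (hK : ∀ y, 0 < y → |F y| ≤ K * exp (-(y / 2)) * (1 + y ^ 2)) : NicholsonAdmissible F := by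
  have hK0 : 0 ≤ K := by
    have h := (abs_nonneg _).trans (hK 1 one_pos)
    by_contra hn
    push Not at hn
    have := Real.exp_pos (-(1 / 2 : ℝ))
    nlinarith [mul_neg_of_neg_of_pos hn this]
  obtain ⟨C, hC, h⟩ := exists_rpow_le_mul_exp (a := 1 / 4) (by norm_num) 3
  refine ⟨hc, K * C, by positivity, fun y hy => (hK y hy).trans ?_⟩
  have h1 : y ^ (1 / 2 : ℝ) ≤ 1 + y := by
    rcases le_total y 1 with hy1 | hy1
    · exact (Real.rpow_le_one hy.le hy1 (by norm_num)).trans (by linarith)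
    · refine (Real.rpow_le_rpow_of_exponent_le hy1 (by norm_num : (1 / 2 : ℝ) ≤ 1)).trans ?_
      rw [Real.rpow_one]; linarith
  have h2 := h y hy.le
  have h3 : (1 + 2 * y) ^ (3 : ℝ) = (1 + 2 * y) ^ 3 := by norm_cast
  rw [h3] at h2
  have h4 : y ^ (1 / 2 : ℝ) * (1 + y ^ 2) ≤ C * exp (1 / 4 * y) := by
    refine le_trans ?_ h2
    calc y ^ (1 / 2 : ℝ) * (1 + y ^ 2) ≤ (1 + y) * (1 + y ^ 2) := by gcongr
      _ ≤ (1 + 2 * y) ^ 3 := by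
        have := pow_pos hy 2
        have := pow_pos hy 3
        nlinarith
  have h5 : exp (-(y / 2)) * exp (1 / 4 * y) = exp (-(y / 4)) := by
    rw [← Real.exp_add]; ring_nf
  have h6 : (1 + y ^ 2) = y ^ (-(1 / 2) : ℝ) * (y ^ (1 / 2 : ℝ) * (1 + y ^ 2)) := by
    rw [← mul_assoc, ← Real.rpow_add hy]; simp
  calc K * exp (-(y / 2)) * (1 + y ^ 2)
      = K * exp (-(y / 2)) * (y ^ (-(1 / 2) : ℝ) * (y ^ (1 / 2 : ℝ) * (1 + y ^ 2))) := by rw [← h6]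
    _ ≤ K * exp (-(y / 2)) * (y ^ (-(1 / 2) : ℝ) * (C * exp (1 / 4 * y))) := by gcongr
    _ = K * C * (y ^ (-(1 / 2) : ℝ) * exp (-(y / 4))) := by rw [← h5]; ring

end NicholsonAdmissible

theorem besselK0_continuousOn : ContinuousOn besselK0 (Set.Ioi 0) :=
  fun _ hy => (hasDerivAt_besselK0 hy).continuousAt.continuousWithinAt

theorem besselK0Theta_continuousOn : ContinuousOn besselK0Theta (Set.Ioi 0) :=
  fun _ hy => (hasDerivAt_besselK0Theta hy).continuousAt.continuousWithinAt

theorem nicholsonAdmissible_besselK0 : NicholsonAdmissible besselK0 := by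
  obtain ⟨K, hK, h⟩ := exists_besselK0_le
  refine ⟨besselK0_continuousOn, K, hK.le, fun y hy => ?_⟩
  rw [abs_of_pos (besselK0_pos hy)]
  refine (h y hy).trans ?_
  gcongr
  linarith

theorem nicholsonAdmissible_besselK0Theta : NicholsonAdmissible besselK0Theta :=
  .of_exp_bound (K := 2) besselK0Theta_continuousOn fun y hy => (besselK0Theta_le hy).trans (by
    have := mul_pos (Real.exp_pos (-(y / 2))) (pow_pos hy 2)
    nlinarith)

theorem exists_sq_mul_besselK0_le :
    ∃ K, ∀ y, 0 < y → y ^ 2 * besselK0 y ≤ K * exp (-(y / 2)) * (1 + y ^ 2) := by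
  obtain ⟨K, hK, h⟩ := exists_besselK0_le
  refine ⟨K, fun y hy => ?_⟩
  have h1 : y ^ (-(1 / 2) : ℝ) * y ^ 2 ≤ 1 + y ^ 2 := by
    rw [← Real.rpow_natCast y 2, ← Real.rpow_add hy]
    norm_num
    rcases le_total y 1 with hy1 | hy1
    · exact (Real.rpow_le_one hy.le hy1 (by norm_num)).trans (by nlinarith)
    · refine (Real.rpow_le_rpow_of_exponent_le hy1 (by norm_num : (3 / 2 : ℝ) ≤ 2)).trans ?_
      rw [Real.rpow_two]; linarith
  calc y ^ 2 * besselK0 y ≤ y ^ 2 * (K * (y ^ (-(1 / 2) : ℝ) * exp (-(y / 2)))) := by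
        gcongr; exact h y hy
    _ = K * exp (-(y / 2)) * (y ^ (-(1 / 2) : ℝ) * y ^ 2) := by ring
    _ ≤ _ := by gcongr

theorem nicholsonAdmissible_sq_mul_besselK0 : NicholsonAdmissible fun y => y ^ 2 * besselK0 y := by
  obtain ⟨K, h⟩ := exists_sq_mul_besselK0_le
  refine .of_exp_bound ((continuousOn_pow 2).mul besselK0_continuousOn) (K := K) fun y hy => ?_
  rw [abs_of_pos (mul_pos (by positivity) (besselK0_pos hy))]
  exact h y hy

theorem nicholsonAdmissible_theta_sq_mul_besselK0 :
    NicholsonAdmissible fun y => 2 * (y ^ 2 * besselK0 y) + y ^ 2 * besselK0Theta y := by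
  obtain ⟨K, h⟩ := exists_sq_mul_besselK0_le
  refine .of_exp_bound ((continuousOn_const.mul ((continuousOn_pow 2).mul
    besselK0_continuousOn)).add ((continuousOn_pow 2).mul besselK0Theta_continuousOn))
    (K := 2 * K + 2) fun y hy => ?_
  refine (abs_add_le _ _).trans ?_
  have h1 := h y hy
  have h2 := besselK0Theta_le hy
  rw [abs_of_pos (mul_pos two_pos (mul_pos (by positivity) (besselK0_pos hy))), abs_mul,
    abs_of_pos (by positivity)]
  have h3 : y ^ 2 * |besselK0Theta y| ≤ y ^ 2 * (2 * exp (-(y / 2))) := by gcongr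
  have := Real.exp_pos (-(y / 2))
  nlinarith

theorem setIntegral_Ioi_pos {g : ℝ → ℝ} (hg : MeasureTheory.IntegrableOn g (Set.Ioi 0))
    (hpos : ∀ z, 0 < z → 0 < g z) : 0 < ∫ z in Set.Ioi (0 : ℝ), g z := by
  rw [MeasureTheory.setIntegral_pos_iff_support_of_nonneg_ae]
  · have : Function.support g ∩ Set.Ioi 0 = Set.Ioi 0 := by
      ext r
      simp only [Set.mem_inter_iff, Function.mem_support, Set.mem_Ioi, and_iff_right_iff_imp]
      exact fun hr => (hpos r hr).ne'
    rw [this]; simp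
  · exact (MeasureTheory.ae_restrict_mem measurableSet_Ioi).mono fun r hr => (hpos r hr).le
  · exact hg

theorem hasDerivAt_besselK0' {y : ℝ} (hy : 0 < y) :
    HasDerivAt (fun y => y ^ 2 * besselK0 y)
      ((2 * (y ^ 2 * besselK0 y) + y ^ 2 * besselK0Theta y) / y) y := by
  refine ((hasDerivAt_pow 2 y).mul (hasDerivAt_besselK0 hy)).congr_deriv ?_
  field_simp
  ring

theorem hasDerivAt_sqrt_one_add_sq (z : ℝ) :
    HasDerivAt (fun z : ℝ => √(1 + z ^ 2)) (z / √(1 + z ^ 2)) z := by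
  refine (((hasDerivAt_pow 2 z).const_add 1).sqrt (by positivity)).congr_deriv ?_
  field_simp
  norm_num

theorem nicholsonIntegral_ode (ν : ℝ) {x : ℝ} (hx : 0 < x) :
    nicholsonIntegral (fun y => 2 * (y ^ 2 * besselK0 y) + y ^ 2 * besselK0Theta y) ν x =
      -(4 * (x ^ 2 - ν ^ 2) * nicholsonIntegral besselK0Theta ν x) -
        4 * x ^ 2 * nicholsonIntegral besselK0 ν x := by
  set P := fun z => -(4 * (x ^ 2 - ν ^ 2)) * (besselK0Theta (2 * x * z) * nicholsonWeight ν z) -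
    4 * x ^ 2 * (besselK0 (2 * x * z) * nicholsonWeight ν z) -
    (2 * ((2 * x * z) ^ 2 * besselK0 (2 * x * z)) + (2 * x * z) ^ 2 * besselK0Theta (2 * x * z)) *
      nicholsonWeight ν z with hP
  have i1 := nicholsonAdmissible_besselK0.integrableOn ν hx
  have i2 := nicholsonAdmissible_besselK0Theta.integrableOn ν hx
  have i3 := nicholsonAdmissible_theta_sq_mul_besselK0.integrableOn ν hx
  have key := integral_Ioi_deriv_eq_zero_of_tendsto
    (F := fun z => besselK0Theta (2 * x * z) * (2 * ν * sinh (2 * ν * arsinh z)) -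
      4 * x ^ 2 * (z * √(1 + z ^ 2) * (besselK0 (2 * x * z) * cosh (2 * ν * arsinh z))))
    (F' := P) ?_ (((i2.const_mul _).sub (i1.const_mul _)).sub i3) ?_ ?_
  · have e1 := MeasureTheory.integral_sub ((i2.const_mul (-(4 * (x ^ 2 - ν ^ 2)))).sub
      (i1.const_mul (4 * x ^ 2))) i3
    have e2 := MeasureTheory.integral_sub (i2.const_mul (-(4 * (x ^ 2 - ν ^ 2))))
      (i1.const_mul (4 * x ^ 2))
    simp only [Pi.sub_apply] at e1
    rw [e2, MeasureTheory.integral_const_mul, MeasureTheory.integral_const_mul] at e1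
    have e3 := e1.symm.trans key
    unfold nicholsonIntegral
    linarith
  · intro z hz
    have hy : 0 < 2 * x * z := by positivity
    have h0 : HasDerivAt (fun z : ℝ => 2 * x * z) (2 * x) z := by
      simpa using (hasDerivAt_id z).const_mul (2 * x)
    have hK := (hasDerivAt_besselK0 hy).comp z h0
    have hT := (hasDerivAt_besselK0Theta hy).comp z h0
    have ha := (Real.hasDerivAt_arsinh z).const_mul (2 * ν)
    have hc := ha.cosh
    have hs := ha.sinh
    have hw := hasDerivAt_sqrt_one_add_sq z
    have hsq : √(1 + z ^ 2) ^ 2 = 1 + z ^ 2 := Real.sq_sqrt (by positivity)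
    have hw0 : 0 < √(1 + z ^ 2) := by positivity
    refine ((hT.mul (hs.const_mul (2 * ν))).sub ((((hasDerivAt_id z).mul hw).mul
      (hK.mul hc)).const_mul (4 * x ^ 2))).congr_deriv ?_
    simp only [hP, nicholsonWeight, Function.comp, id, Pi.mul_apply]
    set w := √(1 + z ^ 2)
    have hz2 : z ^ 2 = w ^ 2 - 1 := by linarith
    field_simp
    linear_combination (-(4 * x ^ 2 * besselK0Theta (2 * x * z) * cosh (2 * ν * arsinh z)) -
      4 * x ^ 2 * besselK0 (2 * x * z) * cosh (2 * ν * arsinh z)) * hsq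
  · obtain ⟨K, hK, hb⟩ := exists_besselK0_le
    rw [tendsto_zero_iff_abs_tendsto_zero]
    set B := fun z : ℝ => 2 * |2 * ν * sinh (2 * ν * arsinh z)| +
      4 * x ^ 2 * (√(1 + z ^ 2) * (K * (2 * x) ^ (-(1 / 2) : ℝ)) * (z ^ (1 / 2 : ℝ) *
        cosh (2 * ν * arsinh z))) with hB
    have hBc : Continuous B := by
      have h1 : Continuous fun z : ℝ => 2 * ν * arsinh z :=
        continuous_const.mul Real.continuous_arsinh
      have h2 := Real.continuous_cosh.comp h1
      have h3 := Real.continuous_sinh.comp h1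
      have h4 : Continuous fun z : ℝ => z ^ (1 / 2 : ℝ) :=
        Real.continuous_rpow_const (by norm_num)
      have h5 : Continuous fun z : ℝ => √(1 + z ^ 2) := by fun_prop
      exact (continuous_const.mul (continuous_const.mul h3).abs).add
        (continuous_const.mul ((h5.mul continuous_const).mul (h4.mul h2)))
    have hB0 : Tendsto B (nhdsWithin 0 (Set.Ioi 0)) (nhds 0) := by
      have := hBc.tendsto 0
      have h0 : B 0 = 0 := by simp [hB]
      rw [h0] at this
      exact this.mono_left nhdsWithin_le_nhds
    refine squeeze_zero' (Eventually.of_forall fun _ => abs_nonneg _)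
      (eventually_nhdsWithin_of_forall fun z hz => ?_) hB0
    have hz0 : 0 < z := hz
    have hy : 0 < 2 * x * z := by positivity
    simp only [Function.comp, hB]
    refine (abs_sub _ _).trans (add_le_add ?_ ?_)
    · rw [abs_mul]
      refine mul_le_mul_of_nonneg_right ((besselK0Theta_le hy).trans ?_) (abs_nonneg _)
      have : exp (-(2 * x * z / 2)) ≤ 1 := Real.exp_le_one_iff.2 (by linarith)
      linarith
    · have hc := Real.cosh_pos (2 * ν * arsinh z)
      have hk := besselK0_pos hy
      rw [abs_of_pos (by positivity)]
      have h1 : z * besselK0 (2 * x * z) ≤ K * (2 * x) ^ (-(1 / 2) : ℝ) * z ^ (1 / 2 : ℝ) := by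
        calc z * besselK0 (2 * x * z)
            ≤ z * (K * ((2 * x * z) ^ (-(1 / 2) : ℝ) * 1)) := by
              refine mul_le_mul_of_nonneg_left ((hb _ hy).trans ?_) hz0.le
              gcongr
              exact Real.exp_le_one_iff.2 (by linarith)
          _ = K * (2 * x) ^ (-(1 / 2) : ℝ) * (z ^ (1 : ℝ) * z ^ (-(1 / 2) : ℝ)) := by
              rw [Real.mul_rpow (by positivity) hz0.le, Real.rpow_one]; ring
          _ = _ := by rw [← Real.rpow_add hz0]; norm_num
      calc 4 * x ^ 2 * (z * √(1 + z ^ 2) * (besselK0 (2 * x * z) * cosh (2 * ν * arsinh z)))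
          = 4 * x ^ 2 * (√(1 + z ^ 2) * (z * besselK0 (2 * x * z)) * cosh (2 * ν * arsinh z)) := by
            ring
        _ ≤ 4 * x ^ 2 * (√(1 + z ^ 2) * (K * (2 * x) ^ (-(1 / 2) : ℝ) * z ^ (1 / 2 : ℝ)) *
              cosh (2 * ν * arsinh z)) := by gcongr
        _ = _ := by ring
  · obtain ⟨K, hK, hb⟩ := exists_besselK0_le
    obtain ⟨C, hC, hCb⟩ := exists_rpow_le_mul_exp (half_pos hx) (|2 * ν| + 2)
    rw [tendsto_zero_iff_abs_tendsto_zero]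
    have hlim : Tendsto (fun z : ℝ => (2 * |2 * ν| + 4 * x ^ 2 * (K * (2 * x) ^ (-(1 / 2) : ℝ))) *
        (C * exp (-(x / 2 * z)))) atTop (nhds 0) := by
      have h1 : Tendsto (fun z : ℝ => x / 2 * z) atTop atTop :=
        tendsto_id.const_mul_atTop (by positivity)
      simpa using ((Real.tendsto_exp_neg_atTop_nhds_zero.comp h1).const_mul C).const_mul
        (2 * |2 * ν| + 4 * x ^ 2 * (K * (2 * x) ^ (-(1 / 2) : ℝ)))
    refine squeeze_zero' (Eventually.of_forall fun _ => abs_nonneg _)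
      ((eventually_ge_atTop 1).mono fun z hz => ?_) hlim
    have hz0 : 0 < z := by linarith
    have hy : 0 < 2 * x * z := by positivity
    have hc := Real.cosh_pos (2 * ν * arsinh z)
    have hk := besselK0_pos hy
    have hw : √(1 + z ^ 2) ≤ 1 + 2 * z := Real.sqrt_le_iff.2 ⟨by linarith, by nlinarith⟩
    have hexp : exp (-(2 * x * z / 2)) * (1 + 2 * z) ^ (|2 * ν| + 2) ≤ C * exp (-(x / 2 * z)) := by
      calc exp (-(2 * x * z / 2)) * (1 + 2 * z) ^ (|2 * ν| + 2)
          ≤ exp (-(2 * x * z / 2)) * (C * exp (x / 2 * z)) := by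
            gcongr
            exact hCb z hz0.le
        _ = C * (exp (-(2 * x * z / 2)) * exp (x / 2 * z)) := by ring
        _ = C * exp (-(x / 2 * z)) := by rw [← Real.exp_add]; ring_nf
    have hpow : (1 + 2 * z) ^ (|2 * ν| + 2) = (1 + 2 * z) ^ |2 * ν| * (1 + 2 * z) ^ 2 := by
      rw [Real.rpow_add (by positivity), Real.rpow_two]
    have h1 : (1 : ℝ) ≤ (1 + 2 * z) ^ 2 := by nlinarith
    have hp0 : 0 ≤ (1 + 2 * z) ^ |2 * ν| := by positivity
    refine (abs_sub _ _).trans ?_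
    rw [add_mul]
    refine add_le_add ?_ ?_
    · rw [abs_mul, abs_mul]
      calc |besselK0Theta (2 * x * z)| * (|2 * ν| * |sinh (2 * ν * arsinh z)|)
          ≤ (2 * exp (-(2 * x * z / 2))) * (|2 * ν| * (1 + 2 * z) ^ |2 * ν|) := by
            gcongr
            · exact besselK0Theta_le hy
            · exact abs_sinh_mul_arsinh_le _ hz0.le
        _ = 2 * |2 * ν| * (exp (-(2 * x * z / 2)) * (1 + 2 * z) ^ |2 * ν|) := by ring
        _ ≤ 2 * |2 * ν| * (exp (-(2 * x * z / 2)) * (1 + 2 * z) ^ (|2 * ν| + 2)) := by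
            rw [hpow]
            gcongr
            nlinarith
        _ ≤ _ := by gcongr
    · rw [abs_of_pos (by positivity)]
      have h2 : (2 * x * z) ^ (-(1 / 2) : ℝ) ≤ (2 * x) ^ (-(1 / 2) : ℝ) :=
        Real.rpow_le_rpow_of_nonpos (by positivity) (by nlinarith) (by norm_num)
      calc 4 * x ^ 2 * (z * √(1 + z ^ 2) * (besselK0 (2 * x * z) * cosh (2 * ν * arsinh z)))
          ≤ 4 * x ^ 2 * ((1 + 2 * z) * (1 + 2 * z) * ((K * ((2 * x) ^ (-(1 / 2) : ℝ) *
              exp (-(2 * x * z / 2)))) * (1 + 2 * z) ^ |2 * ν|)) := by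
            gcongr
            · linarith
            · exact (hb _ hy).trans (by gcongr)
            · exact cosh_mul_arsinh_le _ hz0.le
        _ = 4 * x ^ 2 * (K * (2 * x) ^ (-(1 / 2) : ℝ)) *
              (exp (-(2 * x * z / 2)) * (1 + 2 * z) ^ (|2 * ν| + 2)) := by rw [hpow]; ring
        _ ≤ _ := by gcongr

/-- Nicholson's integral for `J_ν² + Y_ν²`. -/
noncomputable def besselN (ν x : ℝ) : ℝ := 8 / π ^ 2 * nicholsonIntegral besselK0 ν x

/-- `ϑ N_ν`, where `ϑ = x d/dx`. -/
noncomputable def besselNTheta (ν x : ℝ) : ℝ := 8 / π ^ 2 * nicholsonIntegral besselK0Theta ν x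

/-- `ϑ² N_ν`, where `ϑ = x d/dx`. -/
noncomputable def besselNTheta2 (ν x : ℝ) : ℝ :=
  8 / π ^ 2 * nicholsonIntegral (fun y => y ^ 2 * besselK0 y) ν x

theorem hasDerivAt_besselN (ν : ℝ) {x : ℝ} (hx : 0 < x) :
    HasDerivAt (besselN ν) (besselNTheta ν x / x) x := by
  refine ((nicholsonAdmissible_besselK0.hasDerivAt nicholsonAdmissible_besselK0Theta
    (fun y hy => hasDerivAt_besselK0 hy) ν hx).const_mul (8 / π ^ 2)).congr_deriv ?_
  rw [besselNTheta]; ring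

theorem hasDerivAt_besselNTheta (ν : ℝ) {x : ℝ} (hx : 0 < x) :
    HasDerivAt (besselNTheta ν) (besselNTheta2 ν x / x) x := by
  refine ((nicholsonAdmissible_besselK0Theta.hasDerivAt nicholsonAdmissible_sq_mul_besselK0
    (fun y hy => (hasDerivAt_besselK0Theta hy).congr_deriv ?_) ν hx).const_mul
    (8 / π ^ 2)).congr_deriv ?_
  · field_simp
  · rw [besselNTheta2]; ring

theorem hasDerivAt_besselNTheta2 (ν : ℝ) {x : ℝ} (hx : 0 < x) :
    HasDerivAt (besselNTheta2 ν)
      ((-(4 * (x ^ 2 - ν ^ 2) * besselNTheta ν x) - 4 * x ^ 2 * besselN ν x) / x) x := by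
  refine ((nicholsonAdmissible_sq_mul_besselK0.hasDerivAt nicholsonAdmissible_theta_sq_mul_besselK0
    (fun y hy => hasDerivAt_besselK0' hy) ν hx).const_mul (8 / π ^ 2)).congr_deriv ?_
  rw [nicholsonIntegral_ode ν hx, besselNTheta, besselN]
  ring

theorem continuous_besselN_left {x : ℝ} (hx : 0 < x) : Continuous fun ν => besselN ν x :=
  continuous_const.mul (nicholsonAdmissible_besselK0.continuous hx)

theorem continuous_besselNTheta_left {x : ℝ} (hx : 0 < x) :
    Continuous fun ν => besselNTheta ν x :=
  continuous_const.mul (nicholsonAdmissible_besselK0Theta.continuous hx)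

theorem continuous_besselNTheta2_left {x : ℝ} (hx : 0 < x) :
    Continuous fun ν => besselNTheta2 ν x :=
  continuous_const.mul (nicholsonAdmissible_sq_mul_besselK0.continuous hx)

theorem besselN_neg (ν x : ℝ) : besselN (-ν) x = besselN ν x := by
  have h : nicholsonWeight (-ν) = nicholsonWeight ν := by
    ext z
    rw [nicholsonWeight, nicholsonWeight, ← Real.cosh_neg]
    ring_nf
  simp only [besselN, nicholsonIntegral, h]

theorem besselNTheta_neg_left (ν x : ℝ) : besselNTheta (-ν) x = besselNTheta ν x := by
  have h : nicholsonWeight (-ν) = nicholsonWeight ν := by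
    ext z
    rw [nicholsonWeight, nicholsonWeight, ← Real.cosh_neg]
    ring_nf
  simp only [besselNTheta, nicholsonIntegral, h]

theorem besselNTheta2_neg_left (ν x : ℝ) : besselNTheta2 (-ν) x = besselNTheta2 ν x := by
  have h : nicholsonWeight (-ν) = nicholsonWeight ν := by
    ext z
    rw [nicholsonWeight, nicholsonWeight, ← Real.cosh_neg]
    ring_nf
  simp only [besselNTheta2, nicholsonIntegral, h]

theorem besselN_pos (ν : ℝ) {x : ℝ} (hx : 0 < x) : 0 < besselN ν x :=
  mul_pos (by positivity) (setIntegral_Ioi_pos (nicholsonAdmissible_besselK0.integrableOn ν hx)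
    fun _ hz => mul_pos (besselK0_pos (by positivity)) (nicholsonWeight_pos _ _))

theorem besselNTheta_neg (ν : ℝ) {x : ℝ} (hx : 0 < x) : besselNTheta ν x < 0 := by
  have h := setIntegral_Ioi_pos (nicholsonAdmissible_besselK0Theta.integrableOn ν hx).neg
    fun z hz => neg_pos.2 (mul_neg_of_neg_of_pos (besselK0Theta_neg (y := 2 * x * z)
      (by positivity)) (nicholsonWeight_pos ν z))
  simp only [Pi.neg_apply] at h
  rw [MeasureTheory.integral_neg] at h
  exact mul_neg_of_pos_of_neg (by positivity) (neg_pos.1 h)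

theorem besselN_lt {ν μ : ℝ} (hν : 0 ≤ ν) (h : ν < μ) {x : ℝ} (hx : 0 < x) :
    besselN ν x < besselN μ x := by
  have h := setIntegral_Ioi_pos ((nicholsonAdmissible_besselK0.integrableOn μ hx).sub
    (nicholsonAdmissible_besselK0.integrableOn ν hx)) fun z hz => by
      have hw : nicholsonWeight ν z < nicholsonWeight μ z := by
        have ha : 0 < arsinh z := Real.arsinh_pos_iff.2 hz
        refine div_lt_div_of_pos_right (Real.cosh_lt_cosh.2 ?_) (by positivity)
        rw [abs_of_nonneg (by positivity), abs_of_pos (by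
          have := hν.trans_lt h
          positivity)]
        gcongr
      exact sub_pos.2 (mul_lt_mul_of_pos_left hw (besselK0_pos (by positivity)))
  simp only [Pi.sub_apply] at h
  rw [MeasureTheory.integral_sub (nicholsonAdmissible_besselK0.integrableOn μ hx)
    (nicholsonAdmissible_besselK0.integrableOn ν hx)] at h
  exact mul_lt_mul_of_pos_left (sub_pos.1 h) (by positivity)

theorem tendsto_mul_besselN_atTop (ν : ℝ) :
    Tendsto (fun x => x * besselN ν x) atTop (nhds (2 / π)) := by
  have h := (nicholsonAdmissible_besselK0.tendsto_atTop ν).const_mul (8 / π ^ 2)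
  rw [integral_besselK0] at h
  convert h using 1
  · ext x; rw [besselN]; ring
  · congr 1; field_simp; norm_num

theorem exists_tendsto_mul_besselNTheta_atTop (ν : ℝ) :
    ∃ L, Tendsto (fun x => x * besselNTheta ν x) atTop (nhds L) := by
  refine ⟨_, ((nicholsonAdmissible_besselK0Theta.tendsto_atTop ν).const_mul (8 / π ^ 2)).congr
    fun x => ?_⟩
  rw [besselNTheta]; ring

theorem exists_tendsto_mul_besselNTheta2_atTop (ν : ℝ) :
    ∃ L, Tendsto (fun x => x * besselNTheta2 ν x) atTop (nhds L) := by
  refine ⟨_, ((nicholsonAdmissible_sq_mul_besselK0.tendsto_atTop ν).const_mul (8 / π ^ 2)).congr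
    fun x => ?_⟩
  rw [besselNTheta2]; ring

theorem nicholsonWeight_le_mul_rpow {ν z : ℝ} (hν : 0 ≤ ν) (hz : 0 ≤ z) :
    nicholsonWeight ν z ≤ 4 * (1 + 2 * z) ^ (2 * ν - 1) := by
  have h1 := cosh_mul_arsinh_le (2 * ν) hz
  rw [abs_of_nonneg (by positivity)] at h1
  have h2 : (1 + 2 * z) / 4 ≤ √(1 + z ^ 2) := Real.le_sqrt_of_sq_le (by nlinarith)
  rw [nicholsonWeight, div_le_iff₀ (by positivity), Real.rpow_sub (by positivity), Real.rpow_one]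
  calc cosh (2 * ν * arsinh z) ≤ (1 + 2 * z) ^ (2 * ν) := h1
    _ = 4 * ((1 + 2 * z) ^ (2 * ν) / (1 + 2 * z)) * ((1 + 2 * z) / 4) := by field_simp
    _ ≤ _ := by gcongr

theorem tendsto_rpow_mul_nicholsonWeight {ν : ℝ} (hν : 0 < ν) :
    Tendsto (fun z => z ^ (1 - 2 * ν) * nicholsonWeight ν z) atTop
      (nhds (2 ^ (2 * ν) / 2)) := by
  have hinv : Tendsto (fun z : ℝ => z⁻¹) atTop (nhds 0) := tendsto_inv_atTop_zero
  have h1 : Tendsto (fun z : ℝ => √(1 + (z⁻¹) ^ 2)) atTop (nhds 1) := by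
    have h : Continuous fun t : ℝ => √(1 + t ^ 2) := by fun_prop
    have h' := (h.tendsto 0).comp hinv
    have h0 : √(1 + (0 : ℝ) ^ 2) = 1 := by simp
    rw [h0] at h'
    exact h'
  have h2 : Tendsto (fun z : ℝ => (1 + √(1 + (z⁻¹) ^ 2)) ^ (2 * ν)) atTop (nhds (2 ^ (2 * ν))) := by
    have := (h1.const_add 1).rpow_const (p := 2 * ν) (Or.inl (by norm_num))
    norm_num at this ⊢
    exact this
  have h3 : Tendsto (fun z : ℝ => (z + √(1 + z ^ 2)) ^ (-(2 * ν)) * z ^ (-(2 * ν))) atTop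
      (nhds 0) := by
    have h4 : Tendsto (fun z : ℝ => z ^ (-(2 * ν))) atTop (nhds 0) :=
      tendsto_rpow_neg_atTop (by positivity)
    refine squeeze_zero' ?_ ?_ h4
    · filter_upwards [eventually_ge_atTop 0] with z hz
      positivity
    · filter_upwards [eventually_ge_atTop 0] with z hz
      refine mul_le_of_le_one_left (by positivity) ?_
      exact Real.rpow_le_one_of_one_le_of_nonpos (by linarith [one_le_sqrt_one_add_sq z])
        (by linarith)
  have h5 : Tendsto (fun z : ℝ => ((1 + √(1 + (z⁻¹) ^ 2)) ^ (2 * ν) +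
      (z + √(1 + z ^ 2)) ^ (-(2 * ν)) * z ^ (-(2 * ν))) / 2 / √(1 + (z⁻¹) ^ 2)) atTop
      (nhds ((2 ^ (2 * ν) + 0) / 2 / 1)) := ((h2.add h3).div_const 2).div h1 (by norm_num)
  rw [add_zero, div_one] at h5
  refine h5.congr' ?_
  filter_upwards [eventually_gt_atTop 0] with z hz
  have hw : √(1 + z ^ 2) = z * √(1 + (z⁻¹) ^ 2) := by
    rw [← Real.sqrt_sq hz.le, ← Real.sqrt_mul (by positivity), Real.sqrt_sq hz.le]
    congr 1
    field_simp
    ring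
  have hE : exp (arsinh z) = z + √(1 + z ^ 2) := Real.exp_arsinh z
  have e1 : exp (2 * ν * arsinh z) = (z + √(1 + z ^ 2)) ^ (2 * ν) := by
    rw [← hE, ← Real.exp_mul, mul_comm]
  have e2 : exp (-(2 * ν * arsinh z)) = (z + √(1 + z ^ 2)) ^ (-(2 * ν)) := by
    rw [← hE, ← Real.exp_mul]; ring_nf
  have e3 : (z + √(1 + z ^ 2)) ^ (2 * ν) = z ^ (2 * ν) * (1 + √(1 + (z⁻¹) ^ 2)) ^ (2 * ν) := by
    rw [← Real.mul_rpow hz.le (by positivity), hw]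
    ring_nf
  rw [nicholsonWeight, Real.cosh_eq, e1, e2, e3]
  rw [show √(1 + z ^ 2) = z * √(1 + (z⁻¹) ^ 2) from hw, Real.rpow_sub hz, Real.rpow_one,
    Real.rpow_neg hz.le]
  have : 0 < z ^ (2 * ν) := by positivity
  field_simp

theorem tendsto_rpow_mul_besselN {ν : ℝ} (hν : 1 / 2 < ν) :
    Tendsto (fun x => x ^ (2 * ν) * besselN ν x) (nhdsWithin 0 (Set.Ioi 0))
      (nhds (4 ^ ν * Gamma ν ^ 2 / π ^ 2)) := by
  have hν0 : 0 < ν := by linarith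
  have key : Tendsto (fun x => ∫ y in Set.Ioi (0 : ℝ),
      x ^ (2 * ν - 1) * (besselK0 y * nicholsonWeight ν (y / (2 * x)) / 2))
      (nhdsWithin 0 (Set.Ioi 0))
      (nhds (∫ y in Set.Ioi (0 : ℝ), 1 / 2 * (y ^ (2 * ν - 1) * besselK0 y))) := by
    refine MeasureTheory.tendsto_integral_filter_of_dominated_convergence
      (fun y => 2 * (|besselK0 y| * (1 + 2 * y) ^ (2 * ν - 1))) ?_ ?_
      ((nicholsonAdmissible_besselK0.integrableOn_mul_rpow _).const_mul 2) ?_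
    · refine eventually_nhdsWithin_of_forall fun x hx => ?_
      refine ContinuousOn.aestronglyMeasurable ?_ measurableSet_Ioi
      refine continuousOn_const.mul (ContinuousOn.div_const (besselK0_continuousOn.mul ?_) _)
      exact ((nicholsonWeight_continuous ν).comp (by fun_prop)).continuousOn
    · have hmem : Set.Ioo (0 : ℝ) 1 ∈ nhdsWithin 0 (Set.Ioi 0) := Ioo_mem_nhdsGT one_pos
      filter_upwards [hmem] with x hx
      have hx0 : 0 < x := hx.1
      have hx1 : x < 1 := hx.2
      refine (MeasureTheory.ae_restrict_mem measurableSet_Ioi).mono fun y hy => ?_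
      have hy0 : 0 < y := hy
      have hw := nicholsonWeight_pos ν (y / (2 * x))
      have hk := besselK0_pos hy0
      rw [Real.norm_of_nonneg (by positivity), abs_of_pos hk]
      have h1 := nicholsonWeight_le_mul_rpow hν0.le (z := y / (2 * x)) (by positivity)
      have h2 : x ^ (2 * ν - 1) * (1 + 2 * (y / (2 * x))) ^ (2 * ν - 1) ≤
          (1 + 2 * y) ^ (2 * ν - 1) := by
        rw [← Real.mul_rpow hx0.le (by positivity)]
        refine Real.rpow_le_rpow (by positivity) ?_ (by linarith)
        have : x * (1 + 2 * (y / (2 * x))) = x + y := by field_simp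
        linarith
      calc x ^ (2 * ν - 1) * (besselK0 y * nicholsonWeight ν (y / (2 * x)) / 2)
          ≤ x ^ (2 * ν - 1) * (besselK0 y * (4 * (1 + 2 * (y / (2 * x))) ^ (2 * ν - 1)) / 2) := by
            gcongr
        _ = 2 * (besselK0 y * (x ^ (2 * ν - 1) * (1 + 2 * (y / (2 * x))) ^ (2 * ν - 1))) := by ring
        _ ≤ _ := by gcongr
    · refine (MeasureTheory.ae_restrict_mem measurableSet_Ioi).mono fun y hy => ?_
      have hy0 : 0 < y := hy
      have h1 : Tendsto (fun x : ℝ => y / (2 * x)) (nhdsWithin 0 (Set.Ioi 0)) atTop := by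
        have h := (tendsto_inv_nhdsGT_zero (𝕜 := ℝ)).const_mul_atTop (half_pos hy0)
        refine h.congr fun x => ?_
        rw [← div_eq_mul_inv, div_div]
      have h2 := ((tendsto_rpow_mul_nicholsonWeight hν0).comp h1).const_mul
        ((y / 2) ^ (2 * ν - 1) * besselK0 y / 2)
      have h3 : (y / 2) ^ (2 * ν - 1) * besselK0 y / 2 * (2 ^ (2 * ν) / 2) =
          1 / 2 * (y ^ (2 * ν - 1) * besselK0 y) := by
        rw [Real.div_rpow hy0.le (by norm_num), Real.rpow_sub two_pos, Real.rpow_one]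
        have : (0 : ℝ) < 2 ^ (2 * ν) := by positivity
        field_simp
      rw [h3] at h2
      refine h2.congr' (eventually_nhdsWithin_of_forall fun x hx => ?_)
      have hx0 : 0 < x := hx
      simp only [Function.comp]
      have h4 : (y / 2) ^ (2 * ν - 1) * (y / (2 * x)) ^ (1 - 2 * ν) = x ^ (2 * ν - 1) := by
        rw [show y / (2 * x) = y / 2 / x by field_simp, show 1 - 2 * ν = -(2 * ν - 1) by ring,
          Real.div_rpow (by positivity) hx0.le, Real.rpow_neg hx0.le, Real.rpow_neg (by positivity)]
        have : 0 < (y / 2) ^ (2 * ν - 1) := by positivity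
        field_simp
      rw [← h4]
      ring
  rw [MeasureTheory.integral_const_mul, integral_rpow_mul_besselK0 hν0] at key
  have key2 := key.const_mul (8 / π ^ 2)
  have hlim : 8 / π ^ 2 * (1 / 2 * (4 ^ (ν - 1) * Gamma ν ^ 2)) = 4 ^ ν * Gamma ν ^ 2 / π ^ 2 := by
    rw [Real.rpow_sub (by norm_num), Real.rpow_one]; ring
  rw [hlim] at key2
  refine key2.congr' (eventually_nhdsWithin_of_forall fun x hx => ?_)
  have hx0 : 0 < x := hx
  beta_reduce
  rw [MeasureTheory.integral_const_mul, ← NicholsonAdmissible.rescale besselK0 ν hx0, besselN,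
    show 2 * ν = (2 * ν - 1) + 1 by ring, Real.rpow_add hx0, Real.rpow_one]
  ring_nf

theorem tendsto_besselN_zero_nhdsGT :
    Tendsto (besselN 0) (nhdsWithin 0 (Set.Ioi 0)) atTop := by
  have hk := besselK0_pos one_pos
  have h1 : Tendsto (fun x : ℝ => (2 * x)⁻¹) (nhdsWithin 0 (Set.Ioi 0)) atTop := by
    have h := (tendsto_inv_nhdsGT_zero (𝕜 := ℝ)).const_mul_atTop (half_pos one_pos)
    refine h.congr fun x => ?_
    rw [mul_inv]; ring
  have harsinh : Tendsto arsinh atTop atTop := by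
    refine tendsto_atTop_mono' _ ?_ Real.tendsto_log_atTop
    filter_upwards [eventually_gt_atTop 0] with z hz
    rw [arsinh]
    exact Real.log_le_log hz (by linarith [Real.sqrt_nonneg (1 + z ^ 2)])
  have h2 := (harsinh.comp h1).const_mul_atTop (show 0 < 8 / π ^ 2 * besselK0 1 by positivity)
  refine tendsto_atTop_mono' _ (eventually_nhdsWithin_of_forall fun x hx => ?_) h2
  have hx0 : 0 < x := hx
  have hi := nicholsonAdmissible_besselK0.integrableOn 0 hx0
  rw [besselN, mul_assoc]
  refine mul_le_mul_of_nonneg_left ?_ (by positivity)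
  have h3 : ∫ z in Set.Ioc (0 : ℝ) (2 * x)⁻¹, besselK0 1 * (√(1 + z ^ 2))⁻¹ =
      besselK0 1 * arsinh (2 * x)⁻¹ := by
    rw [MeasureTheory.integral_const_mul, ← intervalIntegral.integral_of_le (by positivity),
      intervalIntegral.integral_eq_sub_of_hasDerivAt (f := arsinh)
        (fun z _ => Real.hasDerivAt_arsinh z), Real.arsinh_zero, sub_zero]
    refine Continuous.intervalIntegrable ?_ _ _
    exact Continuous.inv₀ (by fun_prop) fun z => by positivity
  have h4 : ∫ z in Set.Ioc (0 : ℝ) (2 * x)⁻¹, besselK0 1 * (√(1 + z ^ 2))⁻¹ ≤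
      ∫ z in Set.Ioc (0 : ℝ) (2 * x)⁻¹, besselK0 (2 * x * z) * nicholsonWeight 0 z := by
    refine MeasureTheory.setIntegral_mono_on ?_ (hi.mono_set Set.Ioc_subset_Ioi_self)
      measurableSet_Ioc fun z hz => ?_
    · refine (Continuous.integrableOn_Icc ?_).mono_set Set.Ioc_subset_Icc_self
      exact continuous_const.mul (Continuous.inv₀ (by fun_prop) fun z => by positivity)
    · have hz0 : 0 < z := hz.1
      have hle : 2 * x * z ≤ 1 := by
        have := mul_le_mul_of_nonneg_left hz.2 (show 0 ≤ 2 * x by positivity)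
        rwa [mul_inv_cancel₀ (by positivity)] at this
      have : nicholsonWeight 0 z = (√(1 + z ^ 2))⁻¹ := by simp [nicholsonWeight]
      rw [this]
      refine mul_le_mul_of_nonneg_right ?_ (by positivity)
      exact besselK0_strictAntiOn.antitoneOn (Set.mem_Ioi.2 (by positivity)) (Set.mem_Ioi.2 one_pos)
        hle
  rw [Function.comp, ← h3]
  refine h4.trans (MeasureTheory.setIntegral_mono_set hi ?_
    Set.Ioc_subset_Ioi_self.eventuallyLE)
  refine (MeasureTheory.ae_restrict_mem measurableSet_Ioi).mono fun z hz => ?_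
  have hz0 : 0 < z := hz
  exact (mul_pos (besselK0_pos (by positivity)) (nicholsonWeight_pos _ _)).le

theorem tendsto_besselN_nhdsGT {ν : ℝ} (hν : 0 ≤ ν) :
    Tendsto (besselN ν) (nhdsWithin 0 (Set.Ioi 0)) atTop := by
  rcases hν.eq_or_lt with rfl | h
  · exact tendsto_besselN_zero_nhdsGT
  · exact tendsto_atTop_mono' _ (eventually_nhdsWithin_of_forall fun x hx =>
      (besselN_lt le_rfl h hx).le) tendsto_besselN_zero_nhdsGT

theorem exp_neg_one_le_Gamma {s : ℝ} (hs : 0 < s) : exp (-1) ≤ Gamma s := by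
  have h1 : ∀ t : ℝ, 1 ≤ t → exp (-1) ≤ Gamma t := by
    intro t ht
    have ht0 : 0 < t := by linarith
    rw [Real.Gamma_eq_integral ht0, ← integral_exp_neg_Ioi]
    have hi := Real.GammaIntegral_convergent ht0
    have hsub : Set.Ioi (1 : ℝ) ⊆ Set.Ioi 0 := Set.Ioi_subset_Ioi zero_le_one
    refine (MeasureTheory.setIntegral_mono_on (integrableOn_exp_neg_Ioi 1) (hi.mono_set hsub)
      measurableSet_Ioi fun x hx => ?_).trans
      (MeasureTheory.setIntegral_mono_set hi ?_ hsub.eventuallyLE)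
    · have hx1 : 1 < x := hx
      exact le_mul_of_one_le_right (by positivity) (Real.one_le_rpow hx1.le (by linarith))
    · refine (MeasureTheory.ae_restrict_mem measurableSet_Ioi).mono fun x hx => ?_
      have hx0 : 0 < x := hx
      simp only [Pi.zero_apply]
      positivity
  rcases le_total 1 s with h | h
  · exact h1 s h
  · have h2 := h1 (s + 1) (by linarith)
    rw [Real.Gamma_add_one hs.ne'] at h2
    exact h2.trans (mul_le_of_le_one_left (Real.Gamma_pos_of_pos hs).le h)

theorem inv_Gamma_eq (s : ℝ) : (Gamma s)⁻¹ = s * (Gamma (s + 1))⁻¹ := by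
  rcases eq_or_ne s 0 with rfl | hs
  · simp
  · rw [Real.Gamma_add_one hs, mul_inv, mul_inv_cancel_left₀ hs]

/-- The coefficients of the power series of `J_ν`. -/
noncomputable def besselCoeff (ν : ℝ) (k : ℕ) : ℝ :=
  (-1 : ℝ) ^ k / ((k.factorial : ℝ) * Gamma (ν + k + 1))

/-- The entire part of `J_ν`. -/
noncomputable def besselSeries (ν w : ℝ) : ℝ := ∑' k : ℕ, besselCoeff ν k * w ^ k

theorem besselCoeff_eq_mul (ν : ℝ) (k : ℕ) :
    besselCoeff ν k = (ν + 1 + k) * besselCoeff (ν + 1) k := by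
  unfold besselCoeff
  rw [div_eq_mul_inv, mul_inv, inv_Gamma_eq, div_eq_mul_inv, mul_inv]
  ring_nf

theorem besselCoeff_succ (ν : ℝ) (k : ℕ) :
    (k + 1) * besselCoeff ν (k + 1) = -besselCoeff (ν + 1) k := by
  unfold besselCoeff
  rw [Nat.factorial_succ]
  push_cast
  rw [div_eq_mul_inv, mul_inv, mul_inv, div_eq_mul_inv, mul_inv, pow_succ,
    show ν + (k + 1 : ℝ) + 1 = ν + 1 + k + 1 by ring]
  have : (k + 1 : ℝ) ≠ 0 := by positivity
  field_simp

theorem abs_besselCoeff_le {ν : ℝ} {k : ℕ} (h : 0 < ν + k + 1) :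
    |besselCoeff ν k| ≤ exp 1 / k.factorial := by
  have h1 := exp_neg_one_le_Gamma h
  have h0 := Real.Gamma_pos_of_pos h
  rw [Real.exp_neg] at h1
  have h2 := inv_le_of_inv_le₀ (Real.exp_pos 1) h1
  unfold besselCoeff
  rw [abs_div, abs_pow, abs_neg, abs_one, one_pow, abs_of_pos (by positivity), one_div, mul_inv,
    div_eq_mul_inv, mul_comm (exp 1)]
  gcongr

theorem exists_abs_besselCoeff_le (ν : ℝ) :
    ∃ D, 0 ≤ D ∧ ∀ k : ℕ, |besselCoeff ν k| ≤ D / k.factorial := by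
  obtain ⟨n, hn⟩ := exists_nat_gt (-ν)
  refine ⟨exp 1 + ∑ k ∈ Finset.range n, |besselCoeff ν k| * k.factorial, by positivity,
    fun k => ?_⟩
  have hf : (0 : ℝ) < k.factorial := by positivity
  rw [le_div_iff₀ hf]
  rcases lt_or_ge k n with hk | hk
  · have h1 := Finset.single_le_sum (f := fun k : ℕ => |besselCoeff ν k| * (k.factorial : ℝ))
      (fun i _ => by positivity) (Finset.mem_range.2 hk)
    have := Real.exp_pos 1
    linarith
  · have hk' : (n : ℝ) ≤ k := by exact_mod_cast hk
    have h1 := abs_besselCoeff_le (ν := ν) (k := k) (by linarith)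
    rw [le_div_iff₀ hf] at h1
    have : 0 ≤ ∑ k ∈ Finset.range n, |besselCoeff ν k| * (k.factorial : ℝ) :=
      Finset.sum_nonneg fun i _ => by positivity
    linarith

theorem summable_besselCoeff (ν w : ℝ) : Summable fun k : ℕ => besselCoeff ν k * w ^ k := by
  obtain ⟨D, hD, h⟩ := exists_abs_besselCoeff_le ν
  refine Summable.of_norm_bounded ((Real.summable_pow_div_factorial |w|).mul_left D) fun k => ?_
  rw [Real.norm_eq_abs, abs_mul, abs_pow]
  calc |besselCoeff ν k| * |w| ^ k ≤ D / k.factorial * |w| ^ k := by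
        gcongr; exact h k
    _ = _ := by ring

theorem hasDerivAt_besselSeries (ν w : ℝ) :
    HasDerivAt (besselSeries ν) (-besselSeries (ν + 1) w) w := by
  obtain ⟨D, hD, h⟩ := exists_abs_besselCoeff_le ν
  set R := |w| + 1 with hR
  have hu : Summable fun k : ℕ => D / k.factorial * (k * R ^ (k - 1)) := by
    rw [← summable_nat_add_iff 1]
    refine ((Real.summable_pow_div_factorial R).mul_left D).congr fun k => ?_
    rw [Nat.factorial_succ, Nat.add_sub_cancel]
    push_cast
    have : (k + 1 : ℝ) ≠ 0 := by positivity
    field_simp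
  have hbound : ∀ (k : ℕ) (z : ℝ), z ∈ Metric.ball (0 : ℝ) R →
      ‖besselCoeff ν k * (k * z ^ (k - 1))‖ ≤ D / k.factorial * (k * R ^ (k - 1)) := by
    intro k z hz
    rw [mem_ball_zero_iff, Real.norm_eq_abs] at hz
    rw [norm_mul, norm_mul, norm_pow, Real.norm_natCast, Real.norm_eq_abs, Real.norm_eq_abs]
    gcongr
    exact h k
  have hw : w ∈ Metric.ball (0 : ℝ) R := by
    rw [mem_ball_zero_iff, Real.norm_eq_abs, hR]; linarith
  have key := hasDerivAt_tsum_of_isPreconnected (g := fun (k : ℕ) z => besselCoeff ν k * z ^ k)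
    (g' := fun (k : ℕ) z => besselCoeff ν k * (k * z ^ (k - 1))) hu Metric.isOpen_ball
    (convex_ball (0 : ℝ) R).isPreconnected (fun k z _ => (hasDerivAt_pow k z).const_mul _)
    hbound hw (summable_besselCoeff ν w) hw
  refine key.congr_deriv ?_
  have hs : Summable fun k : ℕ => besselCoeff ν k * (k * w ^ (k - 1)) :=
    Summable.of_norm_bounded hu fun k => hbound k w hw
  rw [hs.tsum_eq_zero_add, besselSeries, ← tsum_neg]
  simp only [Nat.cast_zero, zero_mul, mul_zero, zero_add, Nat.add_sub_cancel]
  refine tsum_congr fun k => ?_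
  rw [← neg_mul, ← besselCoeff_succ]
  push_cast
  ring

theorem besselSeries_eq (ν w : ℝ) :
    besselSeries ν w = (ν + 1) * besselSeries (ν + 1) w - w * besselSeries (ν + 1 + 1) w := by
  have h1 := summable_besselCoeff (ν + 1) w
  have h2 := summable_besselCoeff (ν + 1 + 1) w
  have h3 : HasSum (fun k : ℕ => k * besselCoeff (ν + 1) k * w ^ k)
      (-(w * besselSeries (ν + 1 + 1) w)) := by
    rw [← hasSum_nat_add_iff' 1]
    simp only [Finset.range_one, Finset.sum_singleton, Nat.cast_zero, zero_mul, sub_zero]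
    convert (h2.hasSum.mul_left w).neg using 2 with k
    · push_cast
      rw [besselCoeff_succ, pow_succ]
      ring
    · rfl
    · rfl
  have h4 := (h1.hasSum.mul_left (ν + 1)).add h3
  rw [← sub_eq_add_neg] at h4
  refine (h4.tsum_eq.symm.trans ?_).symm
  rw [besselSeries]
  refine tsum_congr fun k => ?_
  rw [besselCoeff_eq_mul ν k]
  ring

theorem besselSeries_zero (ν : ℝ) : besselSeries ν 0 = (Gamma (ν + 1))⁻¹ := by
  rw [besselSeries, tsum_eq_single 0 fun k hk => by simp [hk]]
  simp [besselCoeff]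

theorem continuous_besselSeries (ν : ℝ) : Continuous (besselSeries ν) :=
  continuous_iff_continuousAt.2 fun w => (hasDerivAt_besselSeries ν w).continuousAt

theorem continuousOn_besselSeries_left (w : ℝ) :
    ContinuousOn (fun ν => besselSeries ν w) (Set.Ioi (-1)) := by
  refine continuousOn_tsum (u := fun k : ℕ => exp 1 * (|w| ^ k / k.factorial)) (fun k => ?_)
    ((Real.summable_pow_div_factorial |w|).mul_left _) fun k ν hν => ?_
  · unfold besselCoeff
    intro ν hν
    have hν' : -1 < ν := hν
    have hp : 0 < ν + k + 1 := by
      have : (0 : ℝ) ≤ k := by positivity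
      linarith
    have hG : ContinuousAt Gamma (ν + k + 1) := by
      refine (Real.differentiableAt_Gamma fun m => ?_).continuousAt
      have : (0 : ℝ) ≤ m := by positivity
      linarith
    have hG2 : ContinuousAt (fun ν : ℝ => Gamma (ν + k + 1)) ν :=
      ContinuousAt.comp (f := fun ν : ℝ => ν + k + 1) hG (by fun_prop)
    have h0 := Real.Gamma_pos_of_pos hp
    exact ((continuousAt_const.div (continuousAt_const.mul hG2)
      (mul_pos (by positivity) h0).ne').mul
      continuousAt_const).continuousWithinAt
  · have hν' : -1 < ν := hν
    have hp : 0 < ν + k + 1 := by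
      have : (0 : ℝ) ≤ k := by positivity
      linarith
    rw [Real.norm_eq_abs, abs_mul, abs_pow]
    calc |besselCoeff ν k| * |w| ^ k ≤ exp 1 / k.factorial * |w| ^ k := by
          gcongr; exact abs_besselCoeff_le hp
      _ = _ := by ring

theorem besselJ_eq (ν : ℝ) {x : ℝ} (hx : 0 < x) :
    besselJ ν x = (x / 2) ^ ν * besselSeries ν ((x / 2) ^ 2) := by
  rw [besselJ, besselSeries, ← tsum_mul_left]
  refine tsum_congr fun k => ?_
  rw [Real.rpow_add (by positivity), Real.rpow_mul (by positivity), Real.rpow_two,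
    Real.rpow_natCast, besselCoeff]
  ring

/-- `ϑ J_ν`, where `ϑ = x d/dx`. -/
noncomputable def besselJTheta (ν x : ℝ) : ℝ := ν * besselJ ν x - x * besselJ (ν + 1) x

theorem besselJ_add_two (ν : ℝ) {x : ℝ} (hx : 0 < x) :
    x * besselJ (ν + 1 + 1) x = 2 * (ν + 1) * besselJ (ν + 1) x - x * besselJ ν x := by
  rw [besselJ_eq _ hx, besselJ_eq _ hx, besselJ_eq _ hx, besselSeries_eq ν,
    Real.rpow_add (by positivity), Real.rpow_add (by positivity), Real.rpow_one]
  ring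

theorem hasDerivAt_besselJ (ν : ℝ) {x : ℝ} (hx : 0 < x) :
    HasDerivAt (besselJ ν) (besselJTheta ν x / x) x := by
  have h1 : HasDerivAt (fun x : ℝ => x / 2) (1 / 2) x := (hasDerivAt_id x).div_const 2
  have h2 := h1.rpow_const (p := ν) (Or.inl (by positivity))
  have h3 := (hasDerivAt_besselSeries ν ((x / 2) ^ 2)).comp x (h1.pow 2)
  refine ((h2.mul h3).congr_of_eventuallyEq ?_).congr_deriv ?_
  · filter_upwards [Ioi_mem_nhds hx] with t ht
    rw [besselJ_eq ν ht]
    rfl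
  · rw [besselJTheta, besselJ_eq _ hx, besselJ_eq _ hx, Real.rpow_add (by positivity),
      Real.rpow_sub (by positivity), Real.rpow_one]
    simp only [Function.comp, Pi.pow_apply]
    field_simp
    ring

theorem hasDerivAt_besselJTheta (ν : ℝ) {x : ℝ} (hx : 0 < x) :
    HasDerivAt (besselJTheta ν) (-(x ^ 2 - ν ^ 2) * besselJ ν x / x) x := by
  refine (((hasDerivAt_besselJ ν hx).const_mul ν).sub
    ((hasDerivAt_id x).mul (hasDerivAt_besselJ (ν + 1) hx))).congr_deriv ?_
  have h := besselJ_add_two ν hx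
  simp only [besselJTheta, id]
  field_simp
  linear_combination x * h

theorem continuousOn_besselJ_left {x : ℝ} (hx : 0 < x) :
    ContinuousOn (fun ν => besselJ ν x) (Set.Ioi (-1)) := by
  refine ContinuousOn.congr (f := fun ν => (x / 2) ^ ν * besselSeries ν ((x / 2) ^ 2)) ?_
    fun ν _ => besselJ_eq ν hx
  refine ContinuousOn.mul ?_ (continuousOn_besselSeries_left _)
  exact (continuous_const.rpow continuous_id fun _ => Or.inl (by positivity)).continuousOn

theorem continuousOn_besselJTheta_left {x : ℝ} (hx : 0 < x) :
    ContinuousOn (fun ν => besselJTheta ν x) (Set.Ioi (-1)) := by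
  have h := continuousOn_besselJ_left hx
  refine (continuousOn_id.mul h).sub (continuousOn_const.mul ?_)
  refine h.comp (by fun_prop) fun ν hν => ?_
  have : -1 < ν := hν
  exact Set.mem_Ioi.2 (by linarith)

/-- `u` solves the Bessel equation of order `ν` on `(0, ∞)`, and `ut = x u'`. -/
structure IsBesselSol (ν : ℝ) (u ut : ℝ → ℝ) : Prop where
  hasDerivAt : ∀ x, 0 < x → HasDerivAt u (ut x / x) x
  hasDerivAt_theta : ∀ x, 0 < x → HasDerivAt ut (-(x ^ 2 - ν ^ 2) * u x / x) x

theorem isBesselSol_besselJ (ν : ℝ) : IsBesselSol ν (besselJ ν) (besselJTheta ν) :=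
  ⟨fun _ hx => hasDerivAt_besselJ ν hx, fun _ hx => hasDerivAt_besselJTheta ν hx⟩

theorem isBesselSol_besselJ_neg (ν : ℝ) : IsBesselSol ν (besselJ (-ν)) (besselJTheta (-ν)) := by
  refine ⟨fun _ hx => hasDerivAt_besselJ (-ν) hx, fun x hx => ?_⟩
  rw [← neg_sq ν]
  exact hasDerivAt_besselJTheta (-ν) hx

theorem eq_of_hasDerivAt_zero_of_pos {f : ℝ → ℝ} (h : ∀ x, 0 < x → HasDerivAt f 0 x)
    {x y : ℝ} (hx : 0 < x) (hy : 0 < y) : f x = f y :=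
  (convex_Ioi (0 : ℝ)).is_const_of_fderivWithin_eq_zero (𝕜 := ℝ)
    (fun z hz => (h z hz).differentiableAt.differentiableWithinAt)
    (fun z hz => by
      rw [fderivWithin_of_isOpen isOpen_Ioi hz]
      ext
      simp [(h z hz).deriv]) hx hy

theorem eq_lim_of_hasDerivAt_zero_of_pos {f : ℝ → ℝ} (h : ∀ x, 0 < x → HasDerivAt f 0 x)
    {l : Filter ℝ} [l.NeBot] (hl : ∀ᶠ x in l, 0 < x) {c : ℝ} (hc : Tendsto f l (nhds c))
    {x : ℝ} (hx : 0 < x) : f x = c := by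
  refine tendsto_nhds_unique (tendsto_const_nhds (x := f x) (f := l)) (hc.congr' ?_)
  filter_upwards [hl] with y hy
  exact eq_of_hasDerivAt_zero_of_pos h hy hx

namespace IsBesselSol

variable {ν : ℝ} {u ut v vt : ℝ → ℝ}

theorem hasDerivAt_wronskian (hu : IsBesselSol ν u ut) (hv : IsBesselSol ν v vt) {x : ℝ}
    (hx : 0 < x) : HasDerivAt (fun x => u x * vt x - v x * ut x) 0 x := by
  refine (((hu.hasDerivAt x hx).mul (hv.hasDerivAt_theta x hx)).sub
    ((hv.hasDerivAt x hx).mul (hu.hasDerivAt_theta x hx))).congr_deriv ?_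
  field_simp
  ring

end IsBesselSol

theorem besselJ_mul_eq {ν μ x : ℝ} (hx : 0 < x) :
    besselJ ν x * besselJ μ x =
      (x / 2) ^ (ν + μ) * (besselSeries ν ((x / 2) ^ 2) * besselSeries μ ((x / 2) ^ 2)) := by
  rw [besselJ_eq _ hx, besselJ_eq _ hx, Real.rpow_add (by positivity)]
  ring

theorem tendsto_besselSeries_nhdsGT (ν : ℝ) :
    Tendsto (fun x => besselSeries ν ((x / 2) ^ 2)) (nhdsWithin 0 (Set.Ioi 0))
      (nhds (Gamma (ν + 1))⁻¹) := by
  have h : Continuous fun x : ℝ => besselSeries ν ((x / 2) ^ 2) :=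
    (continuous_besselSeries ν).comp (by fun_prop)
  have h0 := h.tendsto 0
  simp only [zero_div, ne_eq, OfNat.ofNat_ne_zero, not_false_eq_true, zero_pow,
    besselSeries_zero] at h0
  exact h0.mono_left nhdsWithin_le_nhds

theorem wronskian_besselJ {ν : ℝ} (hν : ∀ n : ℤ, ν ≠ n) {x : ℝ} (hx : 0 < x) :
    besselJ ν x * besselJTheta (-ν) x - besselJ (-ν) x * besselJTheta ν x =
      -2 * sin (ν * π) / π := by
  have hν0 : ν ≠ 0 := by simpa using hν 0
  have hlim : Tendsto (fun x => besselJ ν x * besselJTheta (-ν) x -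
      besselJ (-ν) x * besselJTheta ν x) (nhdsWithin 0 (Set.Ioi 0))
      (nhds (-2 * ν * ((Gamma (ν + 1))⁻¹ * (Gamma (-ν + 1))⁻¹) -
        0 * ((Gamma (ν + 1))⁻¹ * (Gamma (-ν + 1 + 1))⁻¹) +
        0 * ((Gamma (-ν + 1))⁻¹ * (Gamma (ν + 1 + 1))⁻¹))) := by
    have h0 : Tendsto (fun x : ℝ => x * (x / 2)) (nhdsWithin 0 (Set.Ioi 0)) (nhds 0) := by
      have h : Continuous fun x : ℝ => x * (x / 2) := by fun_prop
      have := h.tendsto 0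
      simp only [zero_div, mul_zero] at this
      exact this.mono_left nhdsWithin_le_nhds
    have g := tendsto_besselSeries_nhdsGT
    have h1 := ((((g ν).mul (g (-ν))).const_mul (-2 * ν)).sub
      (h0.mul ((g ν).mul (g (-ν + 1))))).add (h0.mul ((g (-ν)).mul (g (ν + 1))))
    refine h1.congr' (eventually_nhdsWithin_of_forall fun t ht => ?_)
    have ht0 : 0 < t := ht
    have e1 := besselJ_mul_eq (ν := ν) (μ := -ν) ht0
    have e2 := besselJ_mul_eq (ν := ν) (μ := -ν + 1) ht0
    have e3 := besselJ_mul_eq (ν := -ν) (μ := ν + 1) ht0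
    rw [add_neg_cancel, Real.rpow_zero] at e1
    rw [add_neg_cancel_left, Real.rpow_one] at e2
    rw [neg_add_cancel_left, Real.rpow_one] at e3
    simp only [besselJTheta]
    linear_combination 2 * ν * e1 + t * e2 - t * e3
  rw [eq_lim_of_hasDerivAt_zero_of_pos (l := nhdsWithin 0 (Set.Ioi 0))
    (fun x hx => (isBesselSol_besselJ ν).hasDerivAt_wronskian (isBesselSol_besselJ_neg ν) hx)
    (eventually_nhdsWithin_of_forall fun _ h => h) hlim hx]
  have h2 := Real.Gamma_mul_Gamma_one_sub ν
  have h3 := Real.Gamma_add_one hν0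
  have h4 : Gamma ν ≠ 0 := Real.Gamma_ne_zero fun m h => hν (-m) (by push_cast; exact h)
  rw [h3, show -ν + 1 = 1 - ν by ring, zero_mul, zero_mul, sub_zero, add_zero, ← mul_inv,
    mul_assoc ν, h2, mul_comm π ν]
  have hs : sin (ν * π) ≠ 0 := by
    intro h
    obtain ⟨n, hn⟩ := Real.sin_eq_zero_iff.1 h
    exact hν n (mul_right_cancel₀ Real.pi_ne_zero hn).symm
  field_simp

/-- The coefficient of `u v` in `besselForm`. -/
noncomputable def besselFormCoeff (ν x : ℝ) : ℝ :=
  besselNTheta2 ν x / 2 + (x ^ 2 - ν ^ 2) * besselN ν x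

/-- A symmetric bilinear form in the Cauchy data `(u, ϑ u)`, `(v, ϑ v)` which is constant along
solutions of the Bessel equation of order `ν`. -/
noncomputable def besselForm (ν x u ut v vt : ℝ) : ℝ :=
  besselFormCoeff ν x * (u * v) - besselNTheta ν x / 2 * (u * vt + ut * v) +
    besselN ν x * (ut * vt)

theorem hasDerivAt_besselFormCoeff (ν : ℝ) {x : ℝ} (hx : 0 < x) :
    HasDerivAt (besselFormCoeff ν) (-((x ^ 2 - ν ^ 2) * besselNTheta ν x) / x) x := by
  have hq : HasDerivAt (fun x : ℝ => x ^ 2 - ν ^ 2) (2 * x) x := by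
    simpa using (hasDerivAt_pow 2 x).sub_const (ν ^ 2)
  refine (((hasDerivAt_besselNTheta2 ν hx).div_const 2).add
    (hq.mul (hasDerivAt_besselN ν hx))).congr_deriv ?_
  field_simp
  ring

theorem IsBesselSol.hasDerivAt_besselForm {ν : ℝ} {u ut v vt : ℝ → ℝ} (hu : IsBesselSol ν u ut)
    (hv : IsBesselSol ν v vt) {x : ℝ} (hx : 0 < x) :
    HasDerivAt (fun x => besselForm ν x (u x) (ut x) (v x) (vt x)) 0 x := by
  have hu1 := hu.hasDerivAt x hx
  have hu2 := hu.hasDerivAt_theta x hx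
  have hv1 := hv.hasDerivAt x hx
  have hv2 := hv.hasDerivAt_theta x hx
  refine ((((hasDerivAt_besselFormCoeff ν hx).mul (hu1.mul hv1)).sub
    (((hasDerivAt_besselNTheta ν hx).div_const 2).mul ((hu1.mul hv2).add (hu2.mul hv1)))).add
    ((hasDerivAt_besselN ν hx).mul (hu2.mul hv2))).congr_deriv ?_
  simp only [besselFormCoeff, Pi.mul_apply, Pi.add_apply]
  field_simp
  ring

theorem IsBesselSol.besselForm_eq {ν : ℝ} {u ut v vt : ℝ → ℝ} (hu : IsBesselSol ν u ut)
    (hv : IsBesselSol ν v vt) {x y : ℝ} (hx : 0 < x) (hy : 0 < y) :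
    besselForm ν x (u x) (ut x) (v x) (vt x) = besselForm ν y (u y) (ut y) (v y) (vt y) :=
  eq_of_hasDerivAt_zero_of_pos (f := fun x => besselForm ν x (u x) (ut x) (v x) (vt x))
    (fun _ hx => hu.hasDerivAt_besselForm hv hx) hx hy

theorem tendsto_zero_of_tendsto_mul_atTop {f : ℝ → ℝ} {L : ℝ}
    (h : Tendsto (fun x => x * f x) atTop (nhds L)) : Tendsto f atTop (nhds 0) := by
  have h1 := h.mul tendsto_inv_atTop_zero
  rw [mul_zero] at h1
  refine h1.congr' ?_
  filter_upwards [eventually_gt_atTop 0] with x hx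
  field_simp

theorem tendsto_besselNTheta_atTop (ν : ℝ) : Tendsto (besselNTheta ν) atTop (nhds 0) :=
  tendsto_zero_of_tendsto_mul_atTop (exists_tendsto_mul_besselNTheta_atTop ν).choose_spec

theorem tendsto_besselFormCoeff_div_atTop (ν : ℝ) :
    Tendsto (fun x => besselFormCoeff ν x / x) atTop (nhds (2 / π)) := by
  obtain ⟨L, hL⟩ := exists_tendsto_mul_besselNTheta2_atTop ν
  have h0 := tendsto_mul_besselN_atTop ν
  have h := h0.add (((hL.div_const 2).sub (h0.const_mul (ν ^ 2))).mul
    (tendsto_inv_atTop_zero.pow 2))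
  simp only [ne_eq, OfNat.ofNat_ne_zero, not_false_eq_true, zero_pow, mul_zero, add_zero] at h
  refine h.congr' ?_
  filter_upwards [eventually_gt_atTop 0] with x hx
  rw [besselFormCoeff]
  field_simp
  ring

theorem besselN_mul_besselFormCoeff_sub (ν : ℝ) {x : ℝ} (hx : 0 < x) :
    besselN ν x * besselFormCoeff ν x - besselNTheta ν x ^ 2 / 4 = (2 / π) ^ 2 := by
  refine eq_lim_of_hasDerivAt_zero_of_pos (l := atTop)
    (f := fun x => besselN ν x * besselFormCoeff ν x - besselNTheta ν x ^ 2 / 4)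
    (fun x hx => ?_) (eventually_gt_atTop 0) ?_ hx
  · refine (((hasDerivAt_besselN ν hx).mul (hasDerivAt_besselFormCoeff ν hx)).sub
      (((hasDerivAt_besselNTheta ν hx).pow 2).div_const 4)).congr_deriv ?_
    simp only [besselFormCoeff]
    field_simp
    ring
  · have h := ((tendsto_mul_besselN_atTop ν).mul (tendsto_besselFormCoeff_div_atTop ν)).sub
      (((tendsto_besselNTheta_atTop ν).pow 2).div_const 4)
    rw [show 2 / π * (2 / π) - 0 ^ 2 / 4 = (2 / π) ^ 2 by ring] at h
    refine h.congr' ?_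
    filter_upwards [eventually_gt_atTop 0] with x hx
    field_simp

theorem besselForm_mul_sub_sq (ν u ut v vt : ℝ) {x : ℝ} (hx : 0 < x) :
    besselForm ν x u ut u ut * besselForm ν x v vt v vt - besselForm ν x u ut v vt ^ 2 =
      (2 / π) ^ 2 * (u * vt - v * ut) ^ 2 := by
  rw [← besselN_mul_besselFormCoeff_sub ν hx]
  simp only [besselForm]
  ring

theorem besselN_mul_wronskian_sq (ν x u ut v vt : ℝ) :
    besselN ν x * (u * vt - v * ut) ^ 2 = besselForm ν x u ut u ut * v ^ 2 -
      2 * besselForm ν x u ut v vt * (u * v) + besselForm ν x v vt v vt * u ^ 2 := by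
  simp only [besselForm]
  ring

theorem abs_quadratic_le (α β γ a b : ℝ) :
    |α * a ^ 2 + β * (a * b) + γ * b ^ 2| ≤ (|α| + |β| + |γ|) * (a ^ 2 + b ^ 2) := by
  have h1 : |a * b| ≤ a ^ 2 + b ^ 2 := by
    rw [abs_le]; constructor <;> nlinarith [sq_nonneg (a + b), sq_nonneg (a - b)]
  calc |α * a ^ 2 + β * (a * b) + γ * b ^ 2|
      ≤ |α * a ^ 2| + |β * (a * b)| + |γ * b ^ 2| := abs_add_three _ _ _
    _ = |α| * a ^ 2 + |β| * |a * b| + |γ| * b ^ 2 := by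
        rw [abs_mul α, abs_mul β, abs_mul γ, abs_of_nonneg (sq_nonneg a),
          abs_of_nonneg (sq_nonneg b)]
    _ ≤ |α| * (a ^ 2 + b ^ 2) + |β| * (a ^ 2 + b ^ 2) + |γ| * (a ^ 2 + b ^ 2) := by
        gcongr
        · nlinarith
        · nlinarith
    _ = _ := by ring

theorem tendsto_abs_add_three {f g h : ℝ → ℝ} {l : Filter ℝ} (hf : Tendsto f l (nhds 0))
    (hg : Tendsto g l (nhds 0)) (hh : Tendsto h l (nhds 0)) :
    Tendsto (fun x => |f x| + |g x| + |h x|) l (nhds 0) := by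
  simpa using (hf.abs.add hg.abs).add hh.abs

theorem tendsto_of_tendsto_quadratic {α β γ a b : ℝ → ℝ} {k c : ℝ} (hk : 0 < k)
    (hα : Tendsto α atTop (nhds k)) (hβ : Tendsto β atTop (nhds 0))
    (hγ : Tendsto γ atTop (nhds k))
    (h : ∀ x, 0 < x → x * (α x * a x ^ 2 + β x * (a x * b x) + γ x * b x ^ 2) = c) :
    Tendsto (fun x => x * (a x ^ 2 + b x ^ 2)) atTop (nhds (c / k)) := by
  have hα' : Tendsto (fun x => α x - k) atTop (nhds 0) := by simpa using hα.sub_const k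
  have hγ' : Tendsto (fun x => γ x - k) atTop (nhds 0) := by simpa using hγ.sub_const k
  have hδ := tendsto_abs_add_three hα' hβ hγ'
  set δ := fun x => |α x - k| + |β x| + |γ x - k|
  have hlo : Tendsto (fun x => c / (k + δ x)) atTop (nhds (c / k)) := by
    have := (tendsto_const_nhds (x := c)).div (hδ.const_add k) (by simpa using hk.ne')
    simpa [Pi.div_def] using this
  have hhi : Tendsto (fun x => c / (k - δ x)) atTop (nhds (c / k)) := by
    have := (tendsto_const_nhds (x := c)).div (hδ.const_sub k) (by simpa using hk.ne')
    simpa [Pi.div_def] using this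
  have hb : ∀ x, 0 < x → |c - k * (x * (a x ^ 2 + b x ^ 2))| ≤
      δ x * (x * (a x ^ 2 + b x ^ 2)) := by
    intro x hx
    have := abs_quadratic_le (α x - k) (β x) (γ x - k) (a x) (b x)
    calc |c - k * (x * (a x ^ 2 + b x ^ 2))|
        = x * |(α x - k) * a x ^ 2 + β x * (a x * b x) + (γ x - k) * b x ^ 2| := by
          rw [show ∀ z, x * |z| = |x * z| from fun z => by rw [abs_mul, abs_of_pos hx], ← h x hx]
          congr 1
          ring
      _ ≤ x * (δ x * (a x ^ 2 + b x ^ 2)) := by gcongr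
      _ = _ := by ring
  have hev : ∀ᶠ x in atTop, 0 < x ∧ δ x < k :=
    (eventually_gt_atTop 0).and (hδ.eventually_lt_const hk)
  refine tendsto_of_tendsto_of_tendsto_of_le_of_le' hlo hhi ?_ ?_
  · filter_upwards [hev] with x ⟨hx, hk'⟩
    have h1 := abs_le.1 (hb x hx)
    have hδ0 : 0 ≤ δ x := by positivity
    rw [div_le_iff₀ (by linarith)]
    linarith
  · filter_upwards [hev] with x ⟨hx, hk'⟩
    have h1 := abs_le.1 (hb x hx)
    rw [le_div_iff₀ (by linarith)]
    linarith

namespace IsBesselSol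

variable {ν : ℝ} {u ut v vt : ℝ → ℝ}

theorem add (hu : IsBesselSol ν u ut) (hv : IsBesselSol ν v vt) :
    IsBesselSol ν (fun x => u x + v x) (fun x => ut x + vt x) := by
  refine ⟨fun x hx => ?_, fun x hx => ?_⟩
  · exact ((hu.hasDerivAt x hx).add (hv.hasDerivAt x hx)).congr_deriv (by ring)
  · exact ((hu.hasDerivAt_theta x hx).add (hv.hasDerivAt_theta x hx)).congr_deriv (by ring)

theorem tendsto_mul_sq_add_sq_atTop (hu : IsBesselSol ν u ut) {y : ℝ} (hy : 0 < y) :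
    Tendsto (fun x => x * (u x ^ 2 + (ut x / x) ^ 2)) atTop
      (nhds (besselForm ν y (u y) (ut y) (u y) (ut y) / (2 / π))) := by
  refine tendsto_of_tendsto_quadratic (by positivity) (tendsto_besselFormCoeff_div_atTop ν)
    (by simpa using (tendsto_besselNTheta_atTop ν).neg) (tendsto_mul_besselN_atTop ν)
    fun x hx => ?_
  rw [hu.besselForm_eq hu hy hx, besselForm]
  field_simp
  ring

theorem raise (hu : IsBesselSol ν u ut) :
    IsBesselSol (ν + 1) (fun x => (ν * u x - ut x) / x)
      (fun x => x * u x - (ν + 1) * ((ν * u x - ut x) / x)) := by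
  have h : ∀ x, 0 < x → HasDerivAt (fun x => (ν * u x - ut x) / x)
      ((x * u x - (ν + 1) * ((ν * u x - ut x) / x)) / x) x := by
    intro x hx
    refine ((((hu.hasDerivAt x hx).const_mul ν).sub (hu.hasDerivAt_theta x hx)).div
      (hasDerivAt_id x) hx.ne').congr_deriv ?_
    simp only [id, Pi.sub_apply]
    field_simp
    ring
  refine ⟨h, fun x hx => ?_⟩
  refine (((hasDerivAt_id x).mul (hu.hasDerivAt x hx)).sub
    ((h x hx).const_mul (ν + 1))).congr_deriv ?_
  simp only [id]
  field_simp
  ring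

theorem besselForm_raise_self (hu : IsBesselSol ν u ut) {x y : ℝ} (hx : 0 < x) (hy : 0 < y) :
    besselForm (ν + 1) x ((ν * u x - ut x) / x) (x * u x - (ν + 1) * ((ν * u x - ut x) / x))
      ((ν * u x - ut x) / x) (x * u x - (ν + 1) * ((ν * u x - ut x) / x)) =
    besselForm ν y (u y) (ut y) (u y) (ut y) := by
  have h1 := hu.tendsto_mul_sq_add_sq_atTop hy
  have h2 := hu.raise.tendsto_mul_sq_add_sq_atTop hx
  have ht : Tendsto (fun x : ℝ => x⁻¹) atTop (nhds 0) := tendsto_inv_atTop_zero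
  have hα : Tendsto (fun x : ℝ => (ν * x⁻¹) ^ 2 * (1 + ((ν + 1) * x⁻¹) ^ 2) -
      2 * ν * (ν + 1) * x⁻¹ ^ 2) atTop (nhds 0) := by
    simpa using (((ht.const_mul ν).pow 2).mul (((ht.const_mul (ν + 1)).pow 2).const_add 1)).sub
      ((ht.pow 2).const_mul (2 * ν * (ν + 1)))
  have hβ : Tendsto (fun x : ℝ => -2 * ν * x⁻¹ * (1 + ((ν + 1) * x⁻¹) ^ 2) +
      2 * (ν + 1) * x⁻¹) atTop (nhds 0) := by
    simpa using ((ht.const_mul (-2 * ν)).mul (((ht.const_mul (ν + 1)).pow 2).const_add 1)).add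
      (ht.const_mul (2 * (ν + 1)))
  have hγ : Tendsto (fun x : ℝ => ((ν + 1) * x⁻¹) ^ 2) atTop (nhds 0) := by
    simpa using (ht.const_mul (ν + 1)).pow 2
  have h3 := (tendsto_abs_add_three hα hβ hγ).mul h1
  rw [zero_mul] at h3
  have h4 : Tendsto (fun x => x * (((ν * u x - ut x) / x) ^ 2 +
      ((x * u x - (ν + 1) * ((ν * u x - ut x) / x)) / x) ^ 2) - x * (u x ^ 2 + (ut x / x) ^ 2))
      atTop (nhds 0) := by
    refine squeeze_zero_norm' ?_ h3
    filter_upwards [eventually_gt_atTop 0] with x hx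
    have h := abs_quadratic_le ((ν * x⁻¹) ^ 2 * (1 + ((ν + 1) * x⁻¹) ^ 2) -
      2 * ν * (ν + 1) * x⁻¹ ^ 2) (-2 * ν * x⁻¹ * (1 + ((ν + 1) * x⁻¹) ^ 2) +
      2 * (ν + 1) * x⁻¹) (((ν + 1) * x⁻¹) ^ 2) (u x) (ut x / x)
    rw [Real.norm_eq_abs]
    refine le_of_eq_of_le ?_ ((mul_le_mul_of_nonneg_left h hx.le).trans_eq (by ring))
    rw [show ∀ z, x * |z| = |x * z| from fun z => by rw [abs_mul, abs_of_pos hx]]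
    congr 1
    field_simp
    ring
  have h5 := tendsto_nhds_unique h4 (h2.sub h1)
  have hπ : (2 / π) ≠ 0 := by positivity
  exact (div_left_inj' hπ).1 (sub_eq_zero.1 h5.symm)

theorem besselForm_raise (hu : IsBesselSol ν u ut) (hv : IsBesselSol ν v vt) {x y : ℝ}
    (hx : 0 < x) (hy : 0 < y) :
    besselForm (ν + 1) x ((ν * u x - ut x) / x) (x * u x - (ν + 1) * ((ν * u x - ut x) / x))
      ((ν * v x - vt x) / x) (x * v x - (ν + 1) * ((ν * v x - vt x) / x)) =
    besselForm ν y (u y) (ut y) (v y) (vt y) := by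
  have h1 := hu.besselForm_raise_self hx hy
  have h2 := hv.besselForm_raise_self hx hy
  have h3 := (hu.add hv).besselForm_raise_self hx hy
  simp only [besselForm] at h1 h2 h3 ⊢
  linear_combination (h3 - h1 - h2) / 2

end IsBesselSol

theorem besselJ_raise (ν : ℝ) {x : ℝ} (hx : 0 < x) :
    (ν * besselJ ν x - besselJTheta ν x) / x = besselJ (ν + 1) x := by
  rw [besselJTheta]
  field_simp
  ring

theorem besselJTheta_raise (ν : ℝ) {x : ℝ} (hx : 0 < x) :
    x * besselJ ν x - (ν + 1) * besselJ (ν + 1) x = besselJTheta (ν + 1) x := by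
  rw [besselJTheta]
  linear_combination besselJ_add_two ν hx

theorem besselJ_neg_raise (ν : ℝ) {x : ℝ} (hx : 0 < x) :
    (ν * besselJ (-ν) x - besselJTheta (-ν) x) / x = -besselJ (-(ν + 1)) x := by
  have h := besselJ_add_two (-(ν + 1)) hx
  rw [show -(ν + 1) + 1 = -ν by ring] at h
  rw [besselJTheta]
  field_simp
  linear_combination h

theorem besselJTheta_neg_raise (ν x : ℝ) :
    x * besselJ (-ν) x - (ν + 1) * -besselJ (-(ν + 1)) x = -besselJTheta (-(ν + 1)) x := by
  rw [besselJTheta, show -(ν + 1) + 1 = -ν by ring]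
  ring

theorem besselForm_neg_left (ν x u ut v vt : ℝ) :
    besselForm (-ν) x u ut v vt = besselForm ν x u ut v vt := by
  simp only [besselForm, besselFormCoeff, besselN_neg, besselNTheta_neg_left,
    besselNTheta2_neg_left, neg_sq]

theorem besselForm_besselJ_add_one (ν : ℝ) {x y : ℝ} (hx : 0 < x) (hy : 0 < y) :
    besselForm (ν + 1) x (besselJ (ν + 1) x) (besselJTheta (ν + 1) x) (besselJ (ν + 1) x)
      (besselJTheta (ν + 1) x) =
    besselForm ν y (besselJ ν y) (besselJTheta ν y) (besselJ ν y) (besselJTheta ν y) := by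
  have h := (isBesselSol_besselJ ν).besselForm_raise_self hx hy
  rwa [besselJ_raise ν hx, besselJTheta_raise ν hx] at h

theorem besselForm_besselJ_neg_add_one (ν : ℝ) {x y : ℝ} (hx : 0 < x) (hy : 0 < y) :
    besselForm (ν + 1) x (besselJ (ν + 1) x) (besselJTheta (ν + 1) x) (besselJ (-(ν + 1)) x)
      (besselJTheta (-(ν + 1)) x) =
    -besselForm ν y (besselJ ν y) (besselJTheta ν y) (besselJ (-ν) y) (besselJTheta (-ν) y) := by
  have h := (isBesselSol_besselJ ν).besselForm_raise (isBesselSol_besselJ_neg ν) hx hy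
  rw [besselJ_raise ν hx, besselJTheta_raise ν hx, besselJ_neg_raise ν hx,
    besselJTheta_neg_raise] at h
  rw [← h]
  simp only [besselForm]
  ring

theorem tendsto_rpow_nhdsGT_zero {a : ℝ} (ha : 0 < a) :
    Tendsto (fun x : ℝ => x ^ a) (nhdsWithin 0 (Set.Ioi 0)) (nhds 0) := by
  have h := (Real.continuousAt_rpow_const 0 a (Or.inr ha.le)).tendsto
  rw [Real.zero_rpow ha.ne'] at h
  exact h.mono_left nhdsWithin_le_nhds

theorem besselForm_besselJ_of_half_lt {ν : ℝ} (hν : ∀ n : ℤ, ν ≠ n) (h : 1 / 2 < ν) {x : ℝ}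
    (hx : 0 < x) : besselForm ν x (besselJ ν x) (besselJTheta ν x) (besselJ ν x)
      (besselJTheta ν x) = (2 / π) ^ 2 := by
  set e := besselForm ν x (besselJ ν x) (besselJTheta ν x) (besselJ ν x) (besselJTheta ν x)
    with he
  set m := besselForm ν x (besselJ ν x) (besselJTheta ν x) (besselJ (-ν) x)
    (besselJTheta (-ν) x) with hm
  set e' := besselForm ν x (besselJ (-ν) x) (besselJTheta (-ν) x) (besselJ (-ν) x)
    (besselJTheta (-ν) x) with he'
  have g := tendsto_besselSeries_nhdsGT
  have hr := tendsto_rpow_nhdsGT_zero (a := 2 * ν) (by linarith)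
  have h1 := (tendsto_rpow_mul_besselN h).mul_const ((-2 * sin (ν * π) / π) ^ 2)
  have h2 := ((((g (-ν)).pow 2).const_mul (e * 4 ^ ν)).sub
    ((hr.mul ((g ν).mul (g (-ν)))).const_mul (2 * m))).add
    ((hr.mul (hr.mul ((g ν).pow 2))).const_mul (e' * (4 ^ ν)⁻¹))
  have h3 := tendsto_nhds_unique (h1.congr' (eventually_nhdsWithin_of_forall fun t ht => ?_)) h2
  · rw [zero_mul, zero_mul, mul_zero, mul_zero, sub_zero, add_zero] at h3
    have h4 : (4 : ℝ) ^ ν ≠ 0 := by positivity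
    have h5 := Real.Gamma_mul_Gamma_one_sub ν
    have hs : sin (ν * π) ≠ 0 := by
      intro h
      obtain ⟨n, hn⟩ := Real.sin_eq_zero_iff.1 h
      exact hν n (mul_right_cancel₀ Real.pi_ne_zero hn).symm
    have h6 : Gamma (1 - ν) ≠ 0 := Real.Gamma_ne_zero fun n hn => hν (n + 1) (by
      push_cast; linarith)
    rw [show -ν + 1 = 1 - ν by ring] at h3
    rw [mul_comm π ν] at h5
    have h7 : Gamma ν = π / (sin (ν * π) * Gamma (1 - ν)) := by
      field_simp at h5 ⊢
      linarith
    rw [h7] at h3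
    generalize sin (ν * π) = S at h3 hs
    field_simp at h3 ⊢
    linarith
  · have ht0 : 0 < t := ht
    have hJ := isBesselSol_besselJ ν
    have hJ' := isBesselSol_besselJ_neg ν
    have k := besselN_mul_wronskian_sq ν t (besselJ ν t) (besselJTheta ν t) (besselJ (-ν) t)
      (besselJTheta (-ν) t)
    rw [wronskian_besselJ hν ht0, hJ.besselForm_eq hJ ht0 hx, hJ.besselForm_eq hJ' ht0 hx,
      hJ'.besselForm_eq hJ' ht0 hx, ← he, ← hm, ← he', sq (besselJ (-ν) t), sq (besselJ ν t),
      besselJ_mul_eq ht0, besselJ_mul_eq ht0, besselJ_mul_eq ht0, add_neg_cancel,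
      Real.rpow_zero, ← two_mul, ← two_mul, mul_neg, Real.rpow_neg (by positivity),
      Real.div_rpow ht0.le (by norm_num), Real.rpow_mul (x := 2) (by norm_num),
      Real.rpow_two, show (2 : ℝ) ^ 2 = 4 by norm_num] at k
    rw [mul_assoc, k]
    have : t ^ (2 * ν) ≠ 0 := by positivity
    field_simp

theorem besselForm_besselJ_of_ne_int {ν : ℝ} (hν : ∀ n : ℤ, ν ≠ n) {x : ℝ}
    (hx : 0 < x) : besselForm ν x (besselJ ν x) (besselJTheta ν x) (besselJ ν x)
      (besselJTheta ν x) = (2 / π) ^ 2 := by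
  have h : ∀ n : ℕ, besselForm (ν + n) x (besselJ (ν + n) x) (besselJTheta (ν + n) x)
      (besselJ (ν + n) x) (besselJTheta (ν + n) x) =
      besselForm ν x (besselJ ν x) (besselJTheta ν x) (besselJ ν x) (besselJTheta ν x) := by
    intro n
    induction n with
    | zero => simp
    | succ n ih =>
      rw [← ih, ← besselForm_besselJ_add_one (ν + n) hx hx]
      push_cast
      rw [add_assoc]
  obtain ⟨n, hn⟩ := exists_nat_gt (1 / 2 - ν)
  rw [← h n]
  refine besselForm_besselJ_of_half_lt (fun k hk => hν (k - n) ?_) (by linarith) hx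
  push_cast
  linarith

instance neBot_nhdsWithin_ne_int (ν : ℝ) :
    (nhdsWithin ν {μ : ℝ | ∀ n : ℤ, μ ≠ (n : ℝ)}).NeBot := by
  have h : {μ : ℝ | ∀ n : ℤ, μ ≠ (n : ℝ)} = (Set.range ((↑) : ℤ → ℝ))ᶜ := by
    ext μ
    simp [eq_comm]
  rw [h]
  exact mem_closure_iff_nhdsWithin_neBot.1 ((Set.countable_range _).dense_compl ℝ ν)

theorem continuous_besselFormCoeff_left {x : ℝ} (hx : 0 < x) :
    Continuous fun ν => besselFormCoeff ν x :=
  ((continuous_besselNTheta2_left hx).div_const 2).add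
    ((continuous_const.sub (continuous_pow 2)).mul (continuous_besselN_left hx))

theorem continuousOn_besselForm {s : Set ℝ} {x : ℝ} (hx : 0 < x) {u ut v vt : ℝ → ℝ}
    (hu : ContinuousOn u s) (hut : ContinuousOn ut s) (hv : ContinuousOn v s)
    (hvt : ContinuousOn vt s) :
    ContinuousOn (fun ν => besselForm ν x (u ν) (ut ν) (v ν) (vt ν)) s :=
  (((continuous_besselFormCoeff_left hx).continuousOn.mul (hu.mul hv)).sub
    (((continuous_besselNTheta_left hx).continuousOn.div_const 2).mul
      ((hu.mul hvt).add (hut.mul hv)))).add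
    ((continuous_besselN_left hx).continuousOn.mul (hut.mul hvt))

theorem besselForm_besselJ {ν : ℝ} (hν : -1 < ν) {x : ℝ} (hx : 0 < x) :
    besselForm ν x (besselJ ν x) (besselJTheta ν x) (besselJ ν x) (besselJTheta ν x) =
      (2 / π) ^ 2 := by
  have hJ := continuousOn_besselJ_left hx
  have hJ' := continuousOn_besselJTheta_left hx
  have h := ((continuousOn_besselForm hx hJ hJ' hJ hJ').continuousAt (Ioi_mem_nhds hν)).tendsto
  refine tendsto_nhds_unique (h.mono_left (nhdsWithin_le_nhds
    (s := {μ : ℝ | ∀ n : ℤ, μ ≠ (n : ℝ)}))) (tendsto_const_nhds.congr' ?_)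
  exact eventually_nhdsWithin_of_forall fun μ hμ => (besselForm_besselJ_of_ne_int hμ hx).symm

theorem besselForm_besselJ_neg_sq {ν : ℝ} (hν : ∀ n : ℤ, ν ≠ n) {x : ℝ} (hx : 0 < x) :
    besselForm ν x (besselJ ν x) (besselJTheta ν x) (besselJ (-ν) x) (besselJTheta (-ν) x) ^ 2 =
      ((2 / π) ^ 2 * cos (ν * π)) ^ 2 := by
  have h1 := besselForm_mul_sub_sq ν (besselJ ν x) (besselJTheta ν x) (besselJ (-ν) x)
    (besselJTheta (-ν) x) hx
  have hν' : ∀ n : ℤ, -ν ≠ n := fun n hn => hν (-n) (by push_cast; linarith)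
  have h2 := besselForm_besselJ_of_ne_int hν' hx
  rw [besselForm_neg_left] at h2
  rw [wronskian_besselJ hν hx, besselForm_besselJ_of_ne_int hν hx, h2] at h1
  have h3 := Real.sin_sq_add_cos_sq (ν * π)
  linear_combination -h1 - (2 / π) ^ 4 * h3

theorem ne_int_of_abs_le_half {ν : ℝ} (h : |ν| ≤ 1 / 2) (h0 : ν ≠ 0) (n : ℤ) : ν ≠ n := by
  rintro rfl
  rw [← Int.cast_abs] at h
  have h1 : |n| < 1 := by
    have : ((|n| : ℤ) : ℝ) < (1 : ℤ) := by push_cast at h ⊢; linarith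
    exact_mod_cast this
  exact h0 (by rw [Int.abs_lt_one_iff.1 h1]; simp)

theorem besselForm_besselJ_neg_of_abs_le {ν : ℝ} (hν : |ν| ≤ 1 / 2) {x : ℝ} (hx : 0 < x) :
    besselForm ν x (besselJ ν x) (besselJTheta ν x) (besselJ (-ν) x) (besselJTheta (-ν) x) =
      (2 / π) ^ 2 * cos (ν * π) := by
  have h0 := besselForm_besselJ (ν := 0) (by norm_num) hx
  have hsq : ∀ μ : ℝ, |μ| ≤ 1 / 2 → besselForm μ x (besselJ μ x) (besselJTheta μ x)
      (besselJ (-μ) x) (besselJTheta (-μ) x) ^ 2 = ((2 / π) ^ 2 * cos (μ * π)) ^ 2 := by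
    intro μ hμ
    rcases eq_or_ne μ 0 with rfl | hμ0
    · rw [neg_zero, h0]; simp
    · exact besselForm_besselJ_neg_sq (ne_int_of_abs_le_half hμ hμ0) hx
  rcases hν.eq_or_lt with h | h
  · have hc : cos (ν * π) = 0 := by
      rw [← Real.cos_abs, abs_mul, h, abs_of_pos Real.pi_pos, one_div_mul_eq_div,
        Real.cos_pi_div_two]
    have := hsq ν hν
    rw [hc] at this ⊢
    simpa using this
  · have hS : ∀ μ ∈ Set.Ioo (-(1 / 2) : ℝ) (1 / 2), |μ| < 1 / 2 := fun μ hμ => abs_lt.2 hμ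
    have hsub : Set.Ioo (-(1 / 2) : ℝ) (1 / 2) ⊆ Set.Ioi (-1) := fun μ hμ => by
      have := hμ.1
      exact Set.mem_Ioi.2 (by linarith)
    have hmaps : Set.MapsTo (fun μ : ℝ => -μ) (Set.Ioo (-(1 / 2) : ℝ) (1 / 2)) (Set.Ioi (-1)) :=
      fun μ hμ => by
        have := hμ.2
        exact Set.mem_Ioi.2 (by linarith)
    have hJ := (continuousOn_besselJ_left hx)
    have hJ' := (continuousOn_besselJTheta_left hx)
    have hcont := continuousOn_besselForm hx (hJ.mono hsub) (hJ'.mono hsub)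
      (hJ.comp continuous_neg.continuousOn hmaps) (hJ'.comp continuous_neg.continuousOn hmaps)
    have hpos : ∀ μ ∈ Set.Ioo (-(1 / 2) : ℝ) (1 / 2), 0 < (2 / π) ^ 2 * cos (μ * π) := by
      intro μ hμ
      refine mul_pos (by positivity) (Real.cos_pos_of_mem_Ioo ⟨?_, ?_⟩)
      · have := hμ.1
        nlinarith [Real.pi_pos]
      · have := hμ.2
        nlinarith [Real.pi_pos]
    have hmem := abs_lt.1 h
    rcases isPreconnected_Ioo.eq_or_eq_neg_of_sq_eq hcont
      (g := fun μ => (2 / π) ^ 2 * cos (μ * π)) (by fun_prop)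
      (fun μ hμ => hsq μ (hS μ hμ).le) (fun {μ} hμ => (hpos μ hμ).ne') with hE | hE
    · exact hE hmem
    · exfalso
      have h1 := hE (show (0 : ℝ) ∈ Set.Ioo (-(1 / 2) : ℝ) (1 / 2) by constructor <;> norm_num)
      simp only [Function.comp, neg_zero, Pi.neg_apply, zero_mul, Real.cos_zero, mul_one] at h1
      rw [h0] at h1
      have : (0 : ℝ) < (2 / π) ^ 2 := by positivity
      linarith

theorem besselForm_besselJ_neg (ν : ℝ) {x : ℝ} (hx : 0 < x) :
    besselForm ν x (besselJ ν x) (besselJTheta ν x) (besselJ (-ν) x) (besselJTheta (-ν) x) =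
      (2 / π) ^ 2 * cos (ν * π) := by
  set f : ℝ → ℝ := fun ν => besselForm ν x (besselJ ν x) (besselJTheta ν x) (besselJ (-ν) x)
    (besselJTheta (-ν) x) - (2 / π) ^ 2 * cos (ν * π) with hf
  have hstep : ∀ μ, f (μ + 1) = -f μ := by
    intro μ
    simp only [hf]
    rw [besselForm_besselJ_neg_add_one μ hx hx, add_mul, one_mul, Real.cos_add_pi]
    ring
  have h_int : ∀ (n : ℤ) (μ : ℝ), f μ = 0 → f (μ + n) = 0 := by
    intro n μ h
    induction n with
    | zero => simpa using h
    | succ n ih =>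
      push_cast at ih ⊢
      rw [← add_assoc, hstep, ih, neg_zero]
    | pred n ih =>
      have h1 := hstep (μ + ((-(n : ℤ) - 1 : ℤ) : ℝ))
      push_cast at ih h1 ⊢
      rw [show μ + (-(n : ℝ) - 1) + 1 = μ + -n by ring, ih] at h1
      linarith
  have h1 : f (ν - round ν) = 0 :=
    sub_eq_zero.2 (besselForm_besselJ_neg_of_abs_le (abs_sub_round ν) hx)
  have h2 := h_int (round ν) _ h1
  rw [sub_add_cancel] at h2
  exact sub_eq_zero.1 h2

theorem sin_mul_pi_ne_zero {ν : ℝ} (hν : ∀ n : ℤ, ν ≠ n) : sin (ν * π) ≠ 0 := by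
  intro h
  obtain ⟨n, hn⟩ := Real.sin_eq_zero_iff.1 h
  exact hν n (mul_right_cancel₀ Real.pi_ne_zero hn).symm

/-- The companion of `J_ν` in Nicholson's formula, equal to `Y_ν` for `ν > -1`. -/
noncomputable def nicholsonY (ν x : ℝ) : ℝ :=
  π / 2 * (besselNTheta ν x / 2 * besselJ ν x - besselN ν x * besselJTheta ν x)

/-- `ϑ` applied to `nicholsonY ν`. -/
noncomputable def nicholsonYTheta (ν x : ℝ) : ℝ :=
  π / 2 * (besselFormCoeff ν x * besselJ ν x - besselNTheta ν x / 2 * besselJTheta ν x)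

theorem besselForm_besselJ_left (ν x v vt : ℝ) :
    besselForm ν x (besselJ ν x) (besselJTheta ν x) v vt =
      2 / π * (v * nicholsonYTheta ν x - vt * nicholsonY ν x) := by
  simp only [besselForm, nicholsonY, nicholsonYTheta]
  field_simp
  ring

theorem isBesselSol_nicholsonY (ν : ℝ) : IsBesselSol ν (nicholsonY ν) (nicholsonYTheta ν) := by
  refine ⟨fun x hx => ?_, fun x hx => ?_⟩
  · refine (((((hasDerivAt_besselNTheta ν hx).div_const 2).mul (hasDerivAt_besselJ ν hx)).sub
      ((hasDerivAt_besselN ν hx).mul (hasDerivAt_besselJTheta ν hx))).const_mul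
      (π / 2)).congr_deriv ?_
    rw [nicholsonYTheta, besselFormCoeff]
    field_simp
    ring
  · refine ((((hasDerivAt_besselFormCoeff ν hx).mul (hasDerivAt_besselJ ν hx)).sub
      (((hasDerivAt_besselNTheta ν hx).div_const 2).mul
      (hasDerivAt_besselJTheta ν hx))).const_mul (π / 2)).congr_deriv ?_
    rw [nicholsonY, besselFormCoeff]
    field_simp
    ring

theorem besselJ_mul_nicholsonYTheta_sub {ν : ℝ} (hν : -1 < ν) {x : ℝ} (hx : 0 < x) :
    besselJ ν x * nicholsonYTheta ν x - nicholsonY ν x * besselJTheta ν x = 2 / π := by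
  have h := besselForm_besselJ hν hx
  rw [besselForm_besselJ_left] at h
  have hπ : (2 / π) ≠ 0 := by positivity
  refine mul_left_cancel₀ hπ ?_
  linear_combination h

theorem besselJ_sq_add_nicholsonY_sq {ν : ℝ} (hν : -1 < ν) {x : ℝ} (hx : 0 < x) :
    besselJ ν x ^ 2 + nicholsonY ν x ^ 2 = besselN ν x := by
  have hW := besselJ_mul_nicholsonYTheta_sub hν hx
  have h1 := besselForm_besselJ_left ν x (nicholsonY ν x) (nicholsonYTheta ν x)
  have h2 := besselForm_mul_sub_sq ν (besselJ ν x) (besselJTheta ν x) (nicholsonY ν x)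
    (nicholsonYTheta ν x) hx
  have h3 := besselN_mul_wronskian_sq ν x (besselJ ν x) (besselJTheta ν x) (nicholsonY ν x)
    (nicholsonYTheta ν x)
  rw [mul_comm (nicholsonYTheta ν x), sub_self, mul_zero] at h1
  have hπ : (2 / π) ^ 2 ≠ 0 := by positivity
  rw [hW, h1, besselForm_besselJ hν hx] at h2 h3
  have h4 : besselForm ν x (nicholsonY ν x) (nicholsonYTheta ν x) (nicholsonY ν x)
      (nicholsonYTheta ν x) = (2 / π) ^ 2 := mul_left_cancel₀ hπ (by linear_combination h2)
  rw [h4] at h3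
  exact mul_left_cancel₀ hπ (by linear_combination -h3)

theorem eq_nicholsonY {ν x : ℝ} (hν : -1 < ν) (hx : 0 < x) {v vt : ℝ}
    (h1 : besselForm ν x (besselJ ν x) (besselJTheta ν x) v vt = 0)
    (h2 : besselJ ν x * vt - v * besselJTheta ν x = 2 / π) :
    v = nicholsonY ν x ∧ vt = nicholsonYTheta ν x := by
  have hW := besselJ_mul_nicholsonYTheta_sub hν hx
  have hπ : (2 / π) ≠ 0 := by positivity
  rw [besselForm_besselJ_left] at h1
  have h3 := (mul_eq_zero.1 h1).resolve_left hπ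
  constructor
  · refine mul_left_cancel₀ hπ ?_
    linear_combination nicholsonY ν x * h2 - v * hW + besselJ ν x * h3
  · refine mul_left_cancel₀ hπ ?_
    linear_combination nicholsonYTheta ν x * h2 - vt * hW + besselJTheta ν x * h3

theorem nicholsonY_raise {ν x : ℝ} (hν : -1 < ν) (hx : 0 < x) :
    (ν * nicholsonY ν x - nicholsonYTheta ν x) / x = nicholsonY (ν + 1) x ∧
      x * nicholsonY ν x - (ν + 1) * nicholsonY (ν + 1) x = nicholsonYTheta (ν + 1) x := by
  have h := (isBesselSol_besselJ ν).besselForm_raise (isBesselSol_nicholsonY ν) hx hx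
  rw [besselJ_raise ν hx, besselJTheta_raise ν hx, besselForm_besselJ_left ν,
    mul_comm (nicholsonYTheta ν x), sub_self, mul_zero] at h
  have hW := besselJ_mul_nicholsonYTheta_sub hν hx
  have h2 : besselJ (ν + 1) x * (x * nicholsonY ν x - (ν + 1) *
      ((ν * nicholsonY ν x - nicholsonYTheta ν x) / x)) -
      ((ν * nicholsonY ν x - nicholsonYTheta ν x) / x) * besselJTheta (ν + 1) x = 2 / π := by
    rw [← hW, ← besselJTheta_raise ν hx, ← besselJ_raise ν hx]
    field_simp
    ring
  obtain ⟨h3, h4⟩ := eq_nicholsonY (by linarith) hx h h2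
  exact ⟨h3, by rw [← h3, h4]⟩

theorem nicholsonY_eq_of_ne_int {ν : ℝ} (hν : -1 < ν) (hn : ∀ n : ℤ, ν ≠ n) {x : ℝ}
    (hx : 0 < x) :
    (besselJ ν x * cos (ν * π) - besselJ (-ν) x) / sin (ν * π) = nicholsonY ν x := by
  have hs := sin_mul_pi_ne_zero hn
  have hA := besselForm_besselJ_neg ν hx
  rw [besselForm_besselJ_left] at hA
  have hB := besselJ_mul_nicholsonYTheta_sub hν hx
  have hC := wronskian_besselJ hn hx
  have hπ : (2 / π) ≠ 0 := by positivity
  rw [div_eq_iff hs]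
  have hA' : besselJ (-ν) x * nicholsonYTheta ν x - besselJTheta (-ν) x * nicholsonY ν x =
      2 / π * cos (ν * π) := mul_left_cancel₀ hπ (by linear_combination hA)
  refine mul_left_cancel₀ hπ ?_
  linear_combination -besselJ ν x * hA' + besselJ (-ν) x * hB - nicholsonY ν x * hC

theorem continuousOn_nicholsonY_left {x : ℝ} (hx : 0 < x) :
    ContinuousOn (fun ν => nicholsonY ν x) (Set.Ioi (-1)) :=
  continuousOn_const.mul
    ((((continuous_besselNTheta_left hx).div_const 2).continuousOn.mul
      (continuousOn_besselJ_left hx)).sub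
    ((continuous_besselN_left hx).continuousOn.mul (continuousOn_besselJTheta_left hx)))

theorem besselY_eq_nicholsonY {ν : ℝ} (hν : -1 < ν) {x : ℝ} (hx : 0 < x) :
    besselY ν x = nicholsonY ν x := by
  have h := ((continuousOn_nicholsonY_left hx).continuousAt (Ioi_mem_nhds hν)).tendsto
  refine Tendsto.limUnder_eq ((h.mono_left (nhdsWithin_le_nhds
    (s := {μ : ℝ | ∀ n : ℤ, μ ≠ n}))).congr' ?_)
  filter_upwards [eventually_nhdsWithin_of_forall fun μ hμ => hμ,
    nhdsWithin_le_nhds (Ioi_mem_nhds hν)] with μ hμ hμ'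
  exact (nicholsonY_eq_of_ne_int hμ' hμ hx).symm

theorem deriv_besselY {ν : ℝ} (hν : -1 < ν) {x : ℝ} (hx : 0 < x) :
    deriv (besselY ν) x = nicholsonYTheta ν x / x := by
  refine HasDerivAt.deriv (((isBesselSol_nicholsonY ν).hasDerivAt x hx).congr_of_eventuallyEq ?_)
  filter_upwards [Ioi_mem_nhds hx] with t ht
  exact besselY_eq_nicholsonY hν ht

theorem deriv_besselY_eq_zero_iff {ν : ℝ} (hν : -1 < ν) {x : ℝ} (hx : 0 < x) :
    deriv (besselY ν) x = 0 ↔ nicholsonYTheta ν x = 0 := by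
  rw [deriv_besselY hν hx, div_eq_zero_iff, or_iff_left hx.ne']

theorem strictMonoOn_of_hasDerivAt_pos {D : Set ℝ} (hD : Convex ℝ D) {f f' : ℝ → ℝ}
    (hf : ∀ x ∈ D, HasDerivAt f (f' x) x) (hpos : ∀ x ∈ interior D, 0 < f' x) :
    StrictMonoOn f D :=
  strictMonoOn_of_deriv_pos hD (fun x hx => (hf x hx).continuousAt.continuousWithinAt)
    fun x hx => by rw [(hf x (interior_subset hx)).deriv]; exact hpos x hx

theorem strictAntiOn_of_hasDerivAt_neg {D : Set ℝ} (hD : Convex ℝ D) {f f' : ℝ → ℝ}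
    (hf : ∀ x ∈ D, HasDerivAt f (f' x) x) (hneg : ∀ x ∈ interior D, f' x < 0) :
    StrictAntiOn f D :=
  strictAntiOn_of_deriv_neg hD (fun x hx => (hf x hx).continuousAt.continuousWithinAt)
    fun x hx => by rw [(hf x (interior_subset hx)).deriv]; exact hneg x hx

/-- A continuous function without zeros on a preconnected set has constant sign there. -/
theorem pos_of_ne_zero_of_pos {S : Set ℝ} (hS : IsPreconnected S) {f : ℝ → ℝ}
    (hf : ContinuousOn f S) (h0 : ∀ x ∈ S, f x ≠ 0) {y : ℝ} (hy : y ∈ S) (hpos : 0 < f y) :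
    ∀ x ∈ S, 0 < f x := by
  intro x hx
  by_contra hneg
  obtain ⟨z, hz, hz0⟩ := hS.intermediate_value hx hy hf ⟨not_lt.1 hneg, hpos.le⟩
  exact h0 z hz hz0

theorem neg_of_ne_zero_of_neg {S : Set ℝ} (hS : IsPreconnected S) {f : ℝ → ℝ}
    (hf : ContinuousOn f S) (h0 : ∀ x ∈ S, f x ≠ 0) {y : ℝ} (hy : y ∈ S) (hneg : f y < 0) :
    ∀ x ∈ S, f x < 0 := by
  intro x hx
  have := pos_of_ne_zero_of_pos hS hf.neg (fun x hx => neg_ne_zero.2 (h0 x hx)) hy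
    (neg_pos.2 hneg) x hx
  exact neg_pos.1 this

/-- A continuous function on `(0, ∞)` which has no zeros near `0` has a first zero. -/
theorem exists_first_zero {f : ℝ → ℝ} (hf : ContinuousOn f (Set.Ioi 0)) {δ z : ℝ} (hδ : 0 < δ)
    (h0 : ∀ x ∈ Set.Ioo 0 δ, f x ≠ 0) (hz0 : 0 < z) (hz : f z = 0) :
    ∃ a, 0 < a ∧ a ≤ z ∧ f a = 0 ∧ ∀ x ∈ Set.Ioo 0 a, f x ≠ 0 := by
  have hsub : Set.Icc (δ / 2) z ⊆ Set.Ioi 0 := fun x hx => lt_of_lt_of_le (by positivity) hx.1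
  have hδz : δ ≤ z := by
    by_contra h
    exact h0 z ⟨hz0, not_le.1 h⟩ hz
  have hK : IsCompact (Set.Icc (δ / 2) z ∩ f ⁻¹' {0}) :=
    isCompact_Icc.of_isClosed_subset ((hf.mono hsub).preimage_isClosed_of_isClosed isClosed_Icc
      isClosed_singleton) Set.inter_subset_left
  obtain ⟨a, ⟨ha, ha0⟩, hmin⟩ := hK.exists_isLeast ⟨z, ⟨by linarith, le_rfl⟩, hz⟩
  refine ⟨a, hsub ha, ha.2, ha0, fun x hx hx0 => ?_⟩
  rcases lt_or_ge x δ with h | h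
  · exact h0 x ⟨hx.1, h⟩ hx0
  · exact absurd (hmin ⟨⟨by linarith, hx.2.le.trans ha.2⟩, hx0⟩) (not_le.2 hx.2)

theorem IsBesselSol.continuousOn {ν : ℝ} {u ut : ℝ → ℝ} (h : IsBesselSol ν u ut) :
    ContinuousOn u (Set.Ioi 0) :=
  fun x hx => (h.hasDerivAt x hx).continuousAt.continuousWithinAt

theorem IsBesselSol.continuousOn_theta {ν : ℝ} {u ut : ℝ → ℝ} (h : IsBesselSol ν u ut) :
    ContinuousOn ut (Set.Ioi 0) :=
  fun x hx => (h.hasDerivAt_theta x hx).continuousAt.continuousWithinAt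

theorem besselNTheta_eq {ν : ℝ} (hν : -1 < ν) {x : ℝ} (hx : 0 < x) :
    besselNTheta ν x =
      2 * (besselJ ν x * besselJTheta ν x + nicholsonY ν x * nicholsonYTheta ν x) := by
  have h1 := (((hasDerivAt_besselJ ν hx).pow 2).add
    (((isBesselSol_nicholsonY ν).hasDerivAt x hx).pow 2)).congr_of_eventuallyEq
    (f₁ := besselN ν) (by
      filter_upwards [Ioi_mem_nhds hx] with t ht
      exact (besselJ_sq_add_nicholsonY_sq hν ht).symm)
  have h2 := h1.unique (hasDerivAt_besselN ν hx)
  field_simp at h2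
  norm_num at h2
  linarith

theorem eventually_besselJ_pos {ν : ℝ} (hν : 0 ≤ ν) :
    ∀ᶠ x in nhdsWithin 0 (Set.Ioi 0), 0 < besselJ ν x := by
  have h := tendsto_besselSeries_nhdsGT ν
  have h0 : 0 < (Gamma (ν + 1))⁻¹ := inv_pos.2 (Real.Gamma_pos_of_pos (by linarith))
  filter_upwards [h.eventually_const_lt h0, self_mem_nhdsWithin] with x hx hx0
  have hx0' : 0 < x := hx0
  rw [besselJ_eq ν hx0']
  positivity

theorem exists_eventually_besselJ_sq_le {ν : ℝ} (hν : 0 ≤ ν) :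
    ∃ C, ∀ᶠ x in nhdsWithin 0 (Set.Ioi 0), besselJ ν x ^ 2 ≤ C := by
  have h := (tendsto_besselSeries_nhdsGT ν).pow 2
  refine ⟨(Gamma (ν + 1))⁻¹ ^ 2 + 1, ?_⟩
  filter_upwards [h.eventually_lt_const (lt_add_one _), self_mem_nhdsWithin,
    nhdsWithin_le_nhds (Iio_mem_nhds (show (0 : ℝ) < 2 by norm_num))] with x hx hx0 hx2
  have hx0' : 0 < x := hx0
  have hx2' : x < 2 := hx2
  rw [besselJ_eq ν hx0', mul_pow]
  have h1 : (x / 2) ^ ν ≤ 1 := Real.rpow_le_one (by positivity) (by linarith) hν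
  have h2 : ((x / 2) ^ ν) ^ 2 ≤ 1 := pow_le_one₀ (by positivity) h1
  have h3 := sq_nonneg (besselSeries ν ((x / 2) ^ 2))
  nlinarith

theorem tendsto_nicholsonY_sq {ν : ℝ} (hν : 0 ≤ ν) :
    Tendsto (fun x => nicholsonY ν x ^ 2) (nhdsWithin 0 (Set.Ioi 0)) atTop := by
  obtain ⟨C, hC⟩ := exists_eventually_besselJ_sq_le hν
  refine tendsto_atTop_mono' _ ?_ (tendsto_atTop_add_const_right _ (-C) (tendsto_besselN_nhdsGT hν))
  filter_upwards [hC, self_mem_nhdsWithin] with x hx hx0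
  have := besselJ_sq_add_nicholsonY_sq (ν := ν) (by linarith) (Set.mem_Ioi.1 hx0)
  linarith

theorem tendsto_besselJ_div_nicholsonY {ν : ℝ} (hν : 0 ≤ ν) :
    Tendsto (fun x => besselJ ν x / nicholsonY ν x) (nhdsWithin 0 (Set.Ioi 0)) (nhds 0) := by
  obtain ⟨C, hC⟩ := exists_eventually_besselJ_sq_le hν
  have h1 : Tendsto (fun x => C / nicholsonY ν x ^ 2) (nhdsWithin 0 (Set.Ioi 0)) (nhds 0) :=
    (tendsto_nicholsonY_sq hν).const_div_atTop C
  have h2 : Tendsto (fun x => (besselJ ν x / nicholsonY ν x) ^ 2) (nhdsWithin 0 (Set.Ioi 0))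
      (nhds 0) := by
    refine squeeze_zero' (Eventually.of_forall fun x => sq_nonneg _) ?_ h1
    filter_upwards [hC] with x hx
    rw [div_pow]
    gcongr
  have h3 := h2.sqrt
  simp only [Real.sqrt_sq_eq_abs, Real.sqrt_zero] at h3
  exact (tendsto_zero_iff_abs_tendsto_zero _).2 h3

theorem hasDerivAt_besselJ_div_nicholsonY {ν : ℝ} (hν : -1 < ν) {x : ℝ} (hx : 0 < x)
    (hY : nicholsonY ν x ≠ 0) :
    HasDerivAt (fun x => besselJ ν x / nicholsonY ν x)
      (-(2 / π) / (x * nicholsonY ν x ^ 2)) x := by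
  refine ((hasDerivAt_besselJ ν hx).div ((isBesselSol_nicholsonY ν).hasDerivAt x hx)
    hY).congr_deriv ?_
  rw [← besselJ_mul_nicholsonYTheta_sub hν hx]
  field_simp
  ring

theorem besselJ_div_nicholsonY_neg {ν : ℝ} (hν : 0 ≤ ν) {b : ℝ}
    (hY : ∀ x ∈ Set.Ioc 0 b, nicholsonY ν x ≠ 0) {x : ℝ} (hx : x ∈ Set.Ioc 0 b) :
    besselJ ν x / nicholsonY ν x < 0 := by
  have hanti : StrictAntiOn (fun x => besselJ ν x / nicholsonY ν x) (Set.Ioc 0 b) :=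
    strictAntiOn_of_hasDerivAt_neg (convex_Ioc 0 b)
      (fun x hx => hasDerivAt_besselJ_div_nicholsonY (by linarith) hx.1 (hY x hx))
      fun x hx => by
        have h1 := interior_subset hx
        have := h1.1
        have := hY x h1
        exact div_neg_of_neg_of_pos (neg_neg_of_pos (by positivity)) (by positivity)
  have hx2 : x / 2 ∈ Set.Ioc 0 b := ⟨by linarith [hx.1], by linarith [hx.1, hx.2]⟩
  refine (hanti hx2 hx (by linarith [hx.1])).trans_le ?_
  refine ge_of_tendsto (tendsto_besselJ_div_nicholsonY hν) ?_
  filter_upwards [Ioo_mem_nhdsGT hx2.1] with t ht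
  exact (hanti ⟨ht.1, ht.2.le.trans hx2.2⟩ hx2 ht.2).le

theorem exists_nicholsonY_neg {ν : ℝ} (hν : 0 ≤ ν) :
    ∃ δ, 0 < δ ∧ ∀ x ∈ Set.Ioo 0 δ, nicholsonY ν x < 0 := by
  have h : ∀ᶠ x in nhdsWithin 0 (Set.Ioi 0), 0 < besselJ ν x ∧ 0 < nicholsonY ν x ^ 2 :=
    (eventually_besselJ_pos hν).and ((tendsto_nicholsonY_sq hν).eventually_gt_atTop 0)
  obtain ⟨δ, hδ, hsub⟩ := mem_nhdsGT_iff_exists_Ioo_subset.1 h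
  refine ⟨δ, hδ, fun x hx => ?_⟩
  have h1 := besselJ_div_nicholsonY_neg hν (b := x) (fun t ht =>
    (pow_ne_zero_iff two_ne_zero).1 (hsub ⟨ht.1, ht.2.trans_lt hx.2⟩).2.ne') ⟨hx.1, le_rfl⟩
  exact (div_neg_iff.1 h1).resolve_right (fun h => absurd h.1 (hsub hx).1.not_gt) |>.2

/-- `Y_ν` is unbounded below near `0`. -/
theorem exists_nicholsonY_lt {ν : ℝ} (hν : 0 ≤ ν) (C : ℝ) {δ : ℝ} (hδ : 0 < δ) :
    ∃ x ∈ Set.Ioo 0 δ, nicholsonY ν x < C := by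
  obtain ⟨δ', hδ', h⟩ := exists_nicholsonY_neg hν
  obtain ⟨x, hx1, hx2, hx3⟩ := (((tendsto_nicholsonY_sq hν).eventually_gt_atTop (C ^ 2)).and
    ((show ∀ᶠ x in nhdsWithin 0 (Set.Ioi 0), x ∈ Set.Ioo 0 δ' from Ioo_mem_nhdsGT hδ').and
    (Ioo_mem_nhdsGT hδ))).exists
  refine ⟨x, hx3, ?_⟩
  have h1 := h x hx2
  have h2 := sq_lt_sq.1 hx1
  rw [abs_of_neg h1] at h2
  linarith [neg_abs_le C]

/-- `ϑ Y_ν` cannot be negative on a whole interval `(0, δ)`. -/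
theorem not_forall_nicholsonYTheta_neg {ν : ℝ} (hν : 0 ≤ ν) {δ : ℝ} (hδ : 0 < δ) :
    ¬ ∀ x ∈ Set.Ioo 0 δ, nicholsonYTheta ν x < 0 := by
  intro h
  have hanti : StrictAntiOn (nicholsonY ν) (Set.Ioo 0 δ) :=
    strictAntiOn_of_hasDerivAt_neg (convex_Ioo 0 δ)
      (fun x hx => (isBesselSol_nicholsonY ν).hasDerivAt x hx.1)
      fun x hx => div_neg_of_neg_of_pos (h x (interior_subset hx)) (interior_subset hx).1
  have h2 : δ / 2 ∈ Set.Ioo 0 δ := ⟨by positivity, by linarith⟩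
  obtain ⟨x, hx, hlt⟩ := exists_nicholsonY_lt hν (nicholsonY ν (δ / 2)) h2.1
  exact absurd (hanti ⟨hx.1, hx.2.trans h2.2⟩ h2 hx.2) hlt.le.not_gt

/-- `a` is the first positive zero of `ϑ Y_ν`. -/
structure IsFirstYThetaZero (ν a : ℝ) : Prop where
  pos : 0 < a
  zero : nicholsonYTheta ν a = 0
  ne_zero : ∀ x ∈ Set.Ioo 0 a, nicholsonYTheta ν x ≠ 0

theorem exists_isFirstYThetaZero {ν : ℝ} (hν : 0 < ν) {z : ℝ} (hz0 : 0 < z)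
    (hz : nicholsonYTheta ν z = 0) : ∃ a, a ≤ z ∧ IsFirstYThetaZero ν a := by
  obtain ⟨δ, hδ, h⟩ := exists_nicholsonY_neg hν.le
  have hm : 0 < min δ ν := lt_min hδ hν
  have hanti : StrictAntiOn (nicholsonYTheta ν) (Set.Ioo 0 (min δ ν)) :=
    strictAntiOn_of_hasDerivAt_neg (convex_Ioo _ _)
      (fun x hx => (isBesselSol_nicholsonY ν).hasDerivAt_theta x hx.1)
      fun x hx => by
        have h1 := interior_subset hx
        have h2 := h x ⟨h1.1, h1.2.trans_le (min_le_left _ _)⟩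
        have h3 : x < ν := h1.2.trans_le (min_le_right _ _)
        have h4 := h1.1
        exact div_neg_of_neg_of_pos (by nlinarith [mul_pos (sub_pos.2 h3) (add_pos h4 hν)]) h4
  obtain ⟨x₀, hx₀, hx₀'⟩ : ∃ x ∈ Set.Ioo 0 (min δ ν), 0 ≤ nicholsonYTheta ν x := by
    have := not_forall_nicholsonYTheta_neg hν.le hm
    push Not at this
    exact this
  have hne : ∀ x ∈ Set.Ioo 0 x₀, nicholsonYTheta ν x ≠ 0 := fun x hx =>
    (hx₀'.trans_lt (hanti ⟨hx.1, hx.2.trans hx₀.2⟩ hx₀ hx.2)).ne'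
  obtain ⟨a, h1, h2, h3, h4⟩ := exists_first_zero (isBesselSol_nicholsonY ν).continuousOn_theta
    hx₀.1 hne hz0 hz
  exact ⟨a, h2, h1, h3, h4⟩

namespace IsFirstYThetaZero

variable {ν a : ℝ}

theorem nicholsonYTheta_pos (ha : IsFirstYThetaZero ν a) (hν : 0 ≤ ν) :
    ∀ x ∈ Set.Ioo 0 a, 0 < nicholsonYTheta ν x := by
  intro x hx
  by_contra hneg
  refine not_forall_nicholsonYTheta_neg hν ha.pos (neg_of_ne_zero_of_neg isPreconnected_Ioo
    ((isBesselSol_nicholsonY ν).continuousOn_theta.mono fun t ht => ht.1) ha.ne_zero hx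
    (lt_of_le_of_ne (not_lt.1 hneg) (ha.ne_zero x hx)))

theorem strictMonoOn (ha : IsFirstYThetaZero ν a) (hν : 0 ≤ ν) :
    StrictMonoOn (nicholsonY ν) (Set.Ioc 0 a) :=
  strictMonoOn_of_hasDerivAt_pos (convex_Ioc _ _)
    (fun x hx => (isBesselSol_nicholsonY ν).hasDerivAt x hx.1)
    fun x hx => by
      rw [interior_Ioc] at hx
      exact div_pos (ha.nicholsonYTheta_pos hν x hx) hx.1

theorem nicholsonY_pos (ha : IsFirstYThetaZero ν a) (hν : 0 ≤ ν) : 0 < nicholsonY ν a := by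
  have hW := besselJ_mul_nicholsonYTheta_sub (ν := ν) (by linarith) ha.pos
  have hN := besselNTheta_eq (ν := ν) (by linarith) ha.pos
  have hneg := besselNTheta_neg ν ha.pos
  rw [ha.zero, mul_zero] at hW hN
  have hπ : 0 < 2 / π := by positivity
  by_contra hle
  have hY : nicholsonY ν a < 0 := lt_of_le_of_ne (not_lt.1 hle) fun h => by
    rw [h] at hW
    linarith
  have hY' : ∀ x ∈ Set.Ioc 0 a, nicholsonY ν x ≠ 0 := fun x hx =>
    (((ha.strictMonoOn hν).monotoneOn hx ⟨ha.pos, le_rfl⟩ hx.2).trans_lt hY).ne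
  have hJ := besselJ_div_nicholsonY_neg hν hY' ⟨ha.pos, le_rfl⟩
  have hJ0 : 0 < besselJ ν a := by
    rcases div_neg_iff.1 hJ with h | h
    · exact h.1
    · linarith
  nlinarith

theorem exists_nicholsonY_zero (ha : IsFirstYThetaZero ν a) (hν : 0 ≤ ν) :
    ∃ b ∈ Set.Ioo 0 a, nicholsonY ν b = 0 ∧ (∀ x ∈ Set.Ioo 0 b, nicholsonY ν x < 0) ∧
      ∀ x ∈ Set.Ioc b a, 0 < nicholsonY ν x := by
  obtain ⟨c, hc, hc0⟩ := exists_nicholsonY_lt hν 0 ha.pos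
  obtain ⟨b, hb, hb0⟩ := intermediate_value_Ioo hc.2.le
    ((isBesselSol_nicholsonY ν).continuousOn.mono fun t ht => hc.1.trans_le ht.1)
    ⟨hc0, ha.nicholsonY_pos hν⟩
  have hb' : b ∈ Set.Ioo 0 a := ⟨hc.1.trans hb.1, hb.2⟩
  have hm := ha.strictMonoOn hν
  refine ⟨b, hb', hb0, fun x hx => ?_, fun x hx => ?_⟩
  · rw [← hb0]
    exact hm ⟨hx.1, (hx.2.trans hb'.2).le⟩ ⟨hb'.1, hb'.2.le⟩ hx.2
  · rw [← hb0]
    exact hm ⟨hb'.1, hb'.2.le⟩ ⟨hb'.1.trans hx.1, hx.2⟩ hx.1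

theorem le (ha : IsFirstYThetaZero ν a) (hν : 0 ≤ ν) : ν ≤ a := by
  by_contra hlt
  rw [not_le] at hlt
  obtain ⟨b, hb, -, -, hpos⟩ := ha.exists_nicholsonY_zero hν
  have hmono : StrictMonoOn (nicholsonYTheta ν) (Set.Icc b a) :=
    strictMonoOn_of_hasDerivAt_pos (convex_Icc _ _)
      (fun x hx => (isBesselSol_nicholsonY ν).hasDerivAt_theta x (hb.1.trans_le hx.1))
      fun x hx => by
        rw [interior_Icc] at hx
        have h1 := hpos x ⟨hx.1, hx.2.le⟩
        have h2 : 0 < x := hb.1.trans hx.1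
        have h3 : x < ν := hx.2.trans hlt
        have h4 := mul_pos (mul_pos (sub_pos.2 h3) (add_pos h2 (h2.trans h3))) h1
        exact div_pos (by linarith) h2
  have h1 := hmono ⟨le_rfl, hb.2.le⟩ ⟨hb.2.le, le_rfl⟩ hb.2
  rw [ha.zero] at h1
  exact absurd (ha.nicholsonYTheta_pos hν b hb) h1.le.not_gt

end IsFirstYThetaZero

theorem hasDerivAt_arctan_besselJ_div {ν : ℝ} (hν : -1 < ν) {x : ℝ} (hx : 0 < x)
    (hY : nicholsonY ν x ≠ 0) :
    HasDerivAt (fun x => arctan (besselJ ν x / nicholsonY ν x))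
      (-(2 / π) / (x * besselN ν x)) x := by
  refine (hasDerivAt_besselJ_div_nicholsonY hν hx hY).arctan.congr_deriv ?_
  have h := besselJ_sq_add_nicholsonY_sq hν hx
  have hp : besselJ ν x ^ 2 + nicholsonY ν x ^ 2 ≠ 0 := h ▸ (besselN_pos ν hx).ne'
  have hp' : nicholsonY ν x ^ 2 + besselJ ν x ^ 2 ≠ 0 := by rwa [add_comm]
  rw [← h]
  field_simp
  ring

/-- The first zero of `Y_ν` is strictly increasing in `ν`. -/
theorem lt_of_nicholsonY_zero {ν μ b c : ℝ} (hν : 0 ≤ ν) (hνμ : ν < μ) (hc : 0 < c)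
    (hνb : ∀ x ∈ Set.Ioo 0 b, nicholsonY ν x < 0)
    (hμc : ∀ x ∈ Set.Ioo 0 c, nicholsonY μ x < 0) (hc0 : nicholsonY μ c = 0) : b < c := by
  by_contra hcb
  rw [not_lt] at hcb
  have hμ : 0 ≤ μ := hν.trans hνμ.le
  set A : ℝ → ℝ → ℝ := fun ν x => arctan (besselJ ν x / nicholsonY ν x) with hA
  have hlim : ∀ κ, 0 ≤ κ → Tendsto (A κ) (nhdsWithin 0 (Set.Ioi 0)) (nhds 0) := fun κ hκ => by
    have := (Real.continuous_arctan.tendsto 0).comp (tendsto_besselJ_div_nicholsonY hκ)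
    rwa [Real.arctan_zero] at this
  have hνc : ∀ x ∈ Set.Ioo 0 c, nicholsonY ν x < 0 := fun x hx => hνb x ⟨hx.1, hx.2.trans_le hcb⟩
  have hanti : StrictAntiOn (fun x => A ν x - A μ x) (Set.Ioo 0 c) :=
    strictAntiOn_of_hasDerivAt_neg (convex_Ioo _ _)
      (fun x hx => (hasDerivAt_arctan_besselJ_div (by linarith) hx.1 (hνc x hx).ne).sub
        (hasDerivAt_arctan_besselJ_div (by linarith) hx.1 (hμc x hx).ne))
      fun x hx => by
        have hx0 := (interior_subset hx).1
        have h1 := besselN_lt hν hνμ hx0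
        have h2 := besselN_pos ν hx0
        have hπ : 0 < 2 / π := by positivity
        rw [neg_div, neg_div, sub_neg_eq_add, neg_add_lt_iff_lt_add, add_zero]
        exact div_lt_div_of_pos_left hπ (by positivity) (by gcongr)
  have hlim0 : Tendsto (fun x => A ν x - A μ x) (nhdsWithin 0 (Set.Ioi 0)) (nhds 0) := by
    simpa using (hlim ν hν).sub (hlim μ hμ)
  have hc2 : c / 2 ∈ Set.Ioo 0 c := ⟨by positivity, by linarith⟩
  have hc4 : c / 4 ∈ Set.Ioo 0 c := ⟨by positivity, by linarith⟩
  have hD : A ν (c / 2) - A μ (c / 2) < 0 := by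
    refine (hanti hc4 hc2 (by linarith)).trans_le (ge_of_tendsto hlim0 ?_)
    filter_upwards [Ioo_mem_nhdsGT hc4.1] with t ht
    exact (hanti ⟨ht.1, ht.2.trans hc4.2⟩ hc4 ht.2).le
  have hJ : ∀ x ∈ Set.Ioo 0 c, 0 < besselJ μ x := fun x hx => by
    have h1 := besselJ_div_nicholsonY_neg hμ
      (fun t ht => (hμc t ⟨ht.1, ht.2.trans_lt hx.2⟩).ne) ⟨hx.1, le_rfl⟩
    rcases div_neg_iff.1 h1 with h | h
    · exact h.1
    · exact absurd h.2 (hμc x hx).not_gt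
  have hmem : Set.Ioo (c / 2) c ∈ nhdsWithin c (Set.Iio c) := Ioo_mem_nhdsLT hc2.2
  have hJc := (hasDerivAt_besselJ μ hc).continuousAt.tendsto
  have hYc := ((isBesselSol_nicholsonY μ).hasDerivAt c hc).continuousAt.tendsto
  have hJc0 : 0 < besselJ μ c := by
    have h1 : 0 ≤ besselJ μ c := by
      refine ge_of_tendsto (hJc.mono_left (nhdsWithin_le_nhds (s := Set.Iio c))) ?_
      filter_upwards [hmem] with t ht
      exact (hJ t ⟨hc2.1.trans ht.1, ht.2⟩).le
    refine lt_of_le_of_ne h1 fun h => ?_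
    have h2 := besselJ_sq_add_nicholsonY_sq (ν := μ) (by linarith) hc
    rw [← h, hc0] at h2
    have := besselN_pos μ hc
    norm_num at h2
    linarith
  rw [hc0] at hYc
  have hYc' : Tendsto (nicholsonY μ) (nhdsWithin c (Set.Iio c)) (nhdsWithin 0 (Set.Iio 0)) := by
    refine tendsto_nhdsWithin_iff.2 ⟨hYc.mono_left nhdsWithin_le_nhds, ?_⟩
    filter_upwards [hmem] with t ht
    exact hμc t ⟨hc2.1.trans ht.1, ht.2⟩
  have hAc : Tendsto (A μ) (nhdsWithin c (Set.Iio c)) (nhds (-(π / 2))) := by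
    refine (Real.tendsto_arctan_atBot.mono_right nhdsWithin_le_nhds).comp ?_
    exact (hJc.mono_left nhdsWithin_le_nhds).pos_mul_atBot hJc0 (tendsto_inv_nhdsLT_zero.comp hYc')
  have hfin : -(π / 2) ≤ A ν (c / 2) - A μ (c / 2) + -(π / 2) := by
    refine ge_of_tendsto (hAc.const_add _) ?_
    filter_upwards [hmem] with t ht
    have h1 := hanti hc2 ⟨hc2.1.trans ht.1, ht.2⟩ ht.1
    have h2 := Real.neg_pi_div_two_lt_arctan (besselJ ν t / nicholsonY ν t)
    simp only [hA] at h1 ⊢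
    linarith
  linarith

theorem IsFirstYThetaZero.lt_of_lt {ν μ a A : ℝ} (ha : IsFirstYThetaZero ν a)
    (hA : IsFirstYThetaZero μ A) (hν : 0 ≤ ν) (hνμ : ν < μ) : a < A := by
  by_contra hle
  rw [not_lt] at hle
  have hμ : 0 ≤ μ := hν.trans hνμ.le
  obtain ⟨b, hb, hb0, hbneg, hbpos⟩ := ha.exists_nicholsonY_zero hν
  obtain ⟨c, hc, hc0, hcneg, hcpos⟩ := hA.exists_nicholsonY_zero hμ
  have hbc := lt_of_nicholsonY_zero hν hνμ hc.1 hbneg hcneg hc0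
  have hmono : StrictMonoOn (fun x => nicholsonY ν x * nicholsonYTheta μ x -
      nicholsonYTheta ν x * nicholsonY μ x) (Set.Icc c A) := by
    refine strictMonoOn_of_hasDerivAt_pos (convex_Icc _ _)
      (f' := fun x => (μ ^ 2 - ν ^ 2) * (nicholsonY ν x * nicholsonY μ x) / x) (fun x hx => ?_)
      fun x hx => ?_
    · have hx0 : 0 < x := hc.1.trans_le hx.1
      have hY := isBesselSol_nicholsonY ν
      have hU := isBesselSol_nicholsonY μ
      refine (((hY.hasDerivAt x hx0).mul (hU.hasDerivAt_theta x hx0)).sub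
        ((hY.hasDerivAt_theta x hx0).mul (hU.hasDerivAt x hx0))).congr_deriv ?_
      field_simp
      ring
    · rw [interior_Icc] at hx
      have hx0 : 0 < x := hc.1.trans hx.1
      have h1 := hbpos x ⟨hbc.trans hx.1, hx.2.le.trans hle⟩
      have h2 := hcpos x ⟨hx.1, hx.2.le⟩
      have h3 : 0 < μ ^ 2 - ν ^ 2 := by nlinarith
      positivity
  have h := hmono ⟨le_rfl, hc.2.le⟩ ⟨hc.2.le, le_rfl⟩ hc.2
  have h1 := hbpos c ⟨hbc, hc.2.le.trans hle⟩
  have h2 := hA.nicholsonYTheta_pos hμ c hc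
  have h3 := hA.nicholsonY_pos hμ
  have h4 : 0 ≤ nicholsonYTheta ν A := by
    rcases hle.eq_or_lt with h | h
    · rw [h, ha.zero]
    · exact (ha.nicholsonYTheta_pos hν A ⟨hA.pos, h⟩).le
  simp only [hA.zero, hc0, mul_zero, sub_zero, zero_sub] at h
  have := mul_pos h1 h2
  have := mul_nonneg h4 h3.le
  linarith

/-- A Picone-type comparison: between two zeros of `ϑ U` the function `ϑ u` vanishes, if `u` has
smaller order. -/
theorem IsBesselSol.exists_theta_zero {ν μ : ℝ} {u v U V : ℝ → ℝ} (hu : IsBesselSol ν u v)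
    (hU : IsBesselSol μ U V) (hu0 : ∀ x, 0 < x → v x = 0 → u x ≠ 0)
    (hU0 : ∀ x, 0 < x → V x = 0 → U x ≠ 0) (hν : 0 ≤ ν) (hνμ : ν < μ) {a b : ℝ}
    (hμa : μ ≤ a) (hab : a < b) (ha : V a = 0) (hb : V b = 0) : ∃ d ∈ Set.Ico a b, v d = 0 := by
  by_contra hne
  push Not at hne
  have hμ : 0 < μ := hν.trans_lt hνμ
  have ha0 : 0 < a := hμ.trans_le hμa
  have hb0 : 0 < b := ha0.trans hab
  set k : ℝ → ℝ := fun x => V x * U x - u x * V x ^ 2 / v x with hk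
  have hder : ∀ x ∈ Set.Ico a b, HasDerivAt k
      (-((x ^ 2 - μ ^ 2) * (U x - u x * V x / v x) ^ 2 +
        (μ ^ 2 - ν ^ 2) * (u x * V x / v x) ^ 2) / x) x := by
    intro x hx
    have hx0 : 0 < x := ha0.trans_le hx.1
    have hv := hne x hx
    refine (((hU.hasDerivAt_theta x hx0).mul (hU.hasDerivAt x hx0)).sub
      (((hu.hasDerivAt x hx0).mul ((hU.hasDerivAt_theta x hx0).pow 2)).div
        (hu.hasDerivAt_theta x hx0) hv)).congr_deriv ?_
    simp only [Pi.mul_apply, Pi.pow_apply]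
    field_simp
    push_cast
    ring
  have hle : ∀ x ∈ Set.Ico a b, 0 ≤ (x ^ 2 - μ ^ 2) * (U x - u x * V x / v x) ^ 2 ∧
      0 ≤ (μ ^ 2 - ν ^ 2) * (u x * V x / v x) ^ 2 := by
    intro x hx
    have h1 : 0 ≤ x ^ 2 - μ ^ 2 := by nlinarith [hx.1]
    have h2 : 0 ≤ μ ^ 2 - ν ^ 2 := by nlinarith
    exact ⟨by positivity, by positivity⟩
  have hanti : AntitoneOn k (Set.Ico a b) :=
    antitoneOn_of_deriv_nonpos (convex_Ico _ _)
      (fun x hx => (hder x hx).continuousAt.continuousWithinAt)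
      (fun x hx => (hder x (interior_subset hx)).differentiableAt.differentiableWithinAt)
      fun x hx => by
        have hx' := interior_subset hx
        rw [(hder x hx').deriv]
        have h := hle x hx'
        exact div_nonpos_of_nonpos_of_nonneg (by linarith) (ha0.le.trans hx'.1)
  have hVb := hU.hasDerivAt_theta b hb0
  have hVb0 : Tendsto V (nhdsWithin b (Set.Iio b)) (nhds 0) := by
    have := hVb.continuousAt.tendsto
    rw [hb] at this
    exact this.mono_left nhdsWithin_le_nhds
  have hub : Tendsto u (nhdsWithin b (Set.Iio b)) (nhds (u b)) :=
    (hu.hasDerivAt b hb0).continuousAt.tendsto.mono_left nhdsWithin_le_nhds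
  have hvb : Tendsto v (nhdsWithin b (Set.Iio b)) (nhds (v b)) :=
    (hu.hasDerivAt_theta b hb0).continuousAt.tendsto.mono_left nhdsWithin_le_nhds
  have hUb : Tendsto U (nhdsWithin b (Set.Iio b)) (nhds (U b)) :=
    (hU.hasDerivAt b hb0).continuousAt.tendsto.mono_left nhdsWithin_le_nhds
  have hVv : Tendsto (fun x => V x ^ 2 / v x) (nhdsWithin b (Set.Iio b)) (nhds 0) := by
    rcases eq_or_ne (v b) 0 with h0 | h0
    · have hq : 0 < b ^ 2 - ν ^ 2 := by nlinarith
      have hd : -(b ^ 2 - ν ^ 2) * u b / b ≠ 0 :=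
        div_ne_zero (mul_ne_zero (neg_ne_zero.2 hq.ne') (hu0 b hb0 h0)) hb0.ne'
      have hsub : nhdsWithin b (Set.Iio b) ≤ nhdsWithin b {b}ᶜ :=
        nhdsWithin_mono _ fun x hx => (Set.mem_Iio.1 hx).ne
      have h1 := (hasDerivAt_iff_tendsto_slope.1 hVb).mono_left hsub
      have h2 := (hasDerivAt_iff_tendsto_slope.1 (hu.hasDerivAt_theta b hb0)).mono_left hsub
      have h3 : Tendsto (fun x => x - b) (nhdsWithin b (Set.Iio b)) (nhds 0) := by
        have : Continuous fun x : ℝ => x - b := by fun_prop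
        have := this.tendsto b
        rw [sub_self] at this
        exact this.mono_left nhdsWithin_le_nhds
      have h4 := ((h1.pow 2).div h2 hd).mul h3
      rw [mul_zero] at h4
      refine h4.congr' ?_
      filter_upwards [Ioo_mem_nhdsLT hab] with x hx
      have hx1 : x - b ≠ 0 := sub_ne_zero.2 hx.2.ne
      have hx2 := hne x ⟨hx.1.le, hx.2⟩
      simp only [Pi.div_apply, slope_def_field, hb, h0, sub_zero]
      field_simp
    · simpa using! (hVb0.pow 2).div hvb h0
  have hkb : Tendsto k (nhdsWithin b (Set.Iio b)) (nhds 0) := by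
    have h := (hVb0.mul hUb).sub (hub.mul hVv)
    rw [zero_mul, mul_zero, sub_zero] at h
    refine h.congr fun x => ?_
    simp only [hk]
    ring
  have hka : k a = 0 := by simp [hk, ha]
  have hk0 : ∀ x ∈ Set.Ico a b, k x = 0 := by
    intro x hx
    refine le_antisymm (hka ▸ hanti ⟨le_rfl, hab⟩ hx hx.1) (le_of_tendsto hkb ?_)
    filter_upwards [Ioo_mem_nhdsLT hx.2] with t ht
    exact hanti hx ⟨hx.1.trans ht.1.le, ht.2⟩ ht.1.le
  have hUzero : ∀ x ∈ Set.Ioo a b, U x = 0 := by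
    intro x hx
    have hx' : x ∈ Set.Ico a b := ⟨hx.1.le, hx.2⟩
    have hx0 : 0 < x := ha0.trans hx.1
    have h1 := (hder x hx').unique ((hasDerivAt_const x (0 : ℝ)).congr_of_eventuallyEq (by
      filter_upwards [Ioo_mem_nhds hx.1 hx.2] with t ht
      exact hk0 t ⟨ht.1.le, ht.2⟩))
    have h2 := hle x hx'
    rw [div_eq_zero_iff, or_iff_left hx0.ne', neg_eq_zero] at h1
    have h3 : (x ^ 2 - μ ^ 2) * (U x - u x * V x / v x) ^ 2 = 0 := by linarith
    have h4 : (μ ^ 2 - ν ^ 2) * (u x * V x / v x) ^ 2 = 0 := by linarith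
    have h5 : x ^ 2 - μ ^ 2 ≠ 0 := by nlinarith [hx.1]
    have h6 : μ ^ 2 - ν ^ 2 ≠ 0 := by nlinarith
    have h7 := (pow_eq_zero_iff two_ne_zero).1 ((mul_eq_zero.1 h3).resolve_left h5)
    have h8 := (pow_eq_zero_iff two_ne_zero).1 ((mul_eq_zero.1 h4).resolve_left h6)
    rwa [h8, sub_zero] at h7
  have hm : (a + b) / 2 ∈ Set.Ioo a b := ⟨by linarith, by linarith⟩
  have hm0 : 0 < (a + b) / 2 := by positivity
  have h1 := (hU.hasDerivAt _ hm0).unique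
    ((hasDerivAt_const ((a + b) / 2) (0 : ℝ)).congr_of_eventuallyEq (by
      filter_upwards [Ioo_mem_nhds hm.1 hm.2] with t ht
      exact hUzero t ht))
  rw [div_eq_zero_iff, or_iff_left hm0.ne'] at h1
  exact hU0 _ hm0 h1 (hUzero _ hm)

theorem nicholsonY_ne_zero_of_theta_eq_zero {ν : ℝ} (hν : -1 < ν) {x : ℝ} (hx : 0 < x)
    (h : nicholsonYTheta ν x = 0) : nicholsonY ν x ≠ 0 := by
  intro h0
  have hW := besselJ_mul_nicholsonYTheta_sub hν hx
  rw [h, h0, mul_zero, zero_mul, sub_zero] at hW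
  have : 0 < 2 / π := by positivity
  linarith

theorem isPosZeroSeq_nicholsonYTheta {ν : ℝ} (hν : -1 < ν) {z : ℕ → ℝ}
    (h : IsPosZeroSeq (deriv (besselY ν)) z) : IsPosZeroSeq (nicholsonYTheta ν) z where
  pos := h.pos
  mono := h.mono
  isZero s hs := (deriv_besselY_eq_zero_iff hν (h.pos s hs)).1 (h.isZero s hs)
  complete x hx h0 := h.complete x hx ((deriv_besselY_eq_zero_iff hν hx).2 h0)

namespace IsPosZeroSeq

variable {f : ℝ → ℝ} {z : ℕ → ℝ}

theorem le_of_le (h : IsPosZeroSeq f z) {s t : ℕ} (hs : 1 ≤ s) (hst : s ≤ t) : z s ≤ z t := by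
  rcases hst.eq_or_lt with rfl | hlt
  · exact le_rfl
  · exact (h.mono s t hs hlt).le

theorem succ_le (h : IsPosZeroSeq f z) {s : ℕ} (hs : 1 ≤ s) {x : ℝ} (hx : z s < x)
    (h0 : f x = 0) : z (s + 1) ≤ x := by
  obtain ⟨t, ht, rfl⟩ := h.complete x ((h.pos s hs).trans hx) h0
  refine h.le_of_le (by omega) (Nat.succ_le_of_lt ?_)
  by_contra hle
  exact absurd (h.le_of_le ht (not_lt.1 hle)) hx.not_ge

theorem one_le (h : IsPosZeroSeq f z) {x : ℝ} (hx : 0 < x) (h0 : f x = 0) : z 1 ≤ x := by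
  obtain ⟨t, ht, rfl⟩ := h.complete x hx h0
  exact h.le_of_le le_rfl ht

theorem ne_zero_of_mem_Ioo (h : IsPosZeroSeq f z) {s : ℕ} (hs : 1 ≤ s) {x : ℝ}
    (hx : x ∈ Set.Ioo (z s) (z (s + 1))) : f x ≠ 0 := fun h0 =>
  absurd (h.succ_le hs hx.1 h0) hx.2.not_ge

theorem isFirstYThetaZero {ν : ℝ} (h : IsPosZeroSeq (nicholsonYTheta ν) z) :
    IsFirstYThetaZero ν (z 1) :=
  ⟨h.pos 1 le_rfl, h.isZero 1 le_rfl, fun _ hx h0 => absurd (h.one_le hx.1 h0) hx.2.not_ge⟩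

/-- The zeros of a function are dominated by any increasing sequence of zeros of that function. -/
theorem le_of_zeros (h : IsPosZeroSeq f z) {c : ℕ → ℝ} (hc0 : 0 < c 1)
    (hcz : ∀ s, 1 ≤ s → f (c s) = 0) (hc : ∀ s, 1 ≤ s → c s < c (s + 1)) :
    ∀ s, 1 ≤ s → z s ≤ c s := by
  intro s hs
  induction s, hs using Nat.le_induction with
  | base => exact h.one_le hc0 (hcz 1 le_rfl)
  | succ s hs ih => exact h.succ_le hs (ih.trans_lt (hc s hs)) (hcz (s + 1) (by omega))

/-- The zeros of `ϑ Y_ν` precede any increasing sequence of zeros of `ϑ Y_μ` if `ν < μ`. -/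
theorem lt_of_nicholsonYTheta_zeros {ν μ : ℝ} (hν : 0 ≤ ν) (hνμ : ν < μ)
    (h : IsPosZeroSeq (nicholsonYTheta ν) z) {c : ℕ → ℝ} (hc0 : 0 < c 1)
    (hcz : ∀ s, 1 ≤ s → nicholsonYTheta μ (c s) = 0) (hc : ∀ s, 1 ≤ s → c s < c (s + 1)) :
    ∀ s, 1 ≤ s → z s < c s := by
  obtain ⟨A, hAc, hA⟩ := exists_isFirstYThetaZero (hν.trans_lt hνμ) hc0 (hcz 1 le_rfl)
  have hμA := hA.le (hν.trans hνμ.le)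
  have key : ∀ s, 1 ≤ s → z s < c s ∧ μ ≤ c s := by
    intro s hs
    induction s, hs using Nat.le_induction with
    | base => exact ⟨(h.isFirstYThetaZero.lt_of_lt hA hν hνμ).trans_le hAc, hμA.trans hAc⟩
    | succ s hs ih =>
      obtain ⟨d, hd, hd0⟩ := (isBesselSol_nicholsonY ν).exists_theta_zero
        (isBesselSol_nicholsonY μ)
        (fun x hx => nicholsonY_ne_zero_of_theta_eq_zero (by linarith) hx)
        (fun x hx => nicholsonY_ne_zero_of_theta_eq_zero (by linarith) hx) hν hνμ ih.2
        (hc s hs) (hcz s hs) (hcz (s + 1) (by omega))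
      exact ⟨(h.succ_le hs (ih.1.trans_le hd.1) hd0).trans_lt hd.2, ih.2.trans (hc s hs).le⟩
  exact fun s hs => (key s hs).1

end IsPosZeroSeq

theorem nicholsonYTheta_add_one_of_theta_eq_zero {ν : ℝ} (hν : -1 < ν) {x : ℝ} (hx : 0 < x)
    (h : nicholsonYTheta ν x = 0) :
    x * nicholsonYTheta (ν + 1) x = nicholsonY ν x * (x ^ 2 - ν * (ν + 1)) := by
  obtain ⟨h1, h2⟩ := nicholsonY_raise hν hx
  rw [h, sub_zero] at h1
  rw [← h2, ← h1]
  field_simp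

theorem IsFirstYThetaZero.lt_sq {ν a : ℝ} (ha : IsFirstYThetaZero ν a) (hν : 0 ≤ ν) :
    ν * (ν + 1) < a ^ 2 := by
  have hY := ha.nicholsonY_pos hν
  have h1 := nicholsonYTheta_add_one_of_theta_eq_zero (by linarith) ha.pos ha.zero
  have hpos : 0 < nicholsonYTheta (ν + 1) a := by
    by_contra hle
    rw [not_lt] at hle
    have hcont := (isBesselSol_nicholsonY (ν + 1)).continuousOn_theta
    obtain ⟨x, hx, hx0⟩ : ∃ x ∈ Set.Ioo 0 a, 0 ≤ nicholsonYTheta (ν + 1) x := by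
      have := not_forall_nicholsonYTheta_neg (ν := ν + 1) (by linarith) ha.pos
      push Not at this
      exact this
    obtain ⟨z, hz, hz0⟩ := intermediate_value_Icc' hx.2.le
      (hcont.mono fun t ht => hx.1.trans_le ht.1) ⟨hle, hx0⟩
    obtain ⟨A, hAz, hA⟩ := exists_isFirstYThetaZero (by linarith) (hx.1.trans_le hz.1) hz0
    exact absurd (ha.lt_of_lt hA hν (by linarith)) (hAz.trans hz.2).not_gt
  have h2 : 0 < nicholsonY ν a * (a ^ 2 - ν * (ν + 1)) := h1 ▸ mul_pos ha.pos hpos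
  have := pos_of_mul_pos_right h2 hY.le
  linarith

theorem IsPosZeroSeq.exists_nicholsonYTheta_add_one_zero {ν : ℝ} (hν : 0 ≤ ν) {z : ℕ → ℝ}
    (h : IsPosZeroSeq (nicholsonYTheta ν) z) {s : ℕ} (hs : 1 ≤ s) :
    ∃ c ∈ Set.Ioo (z s) (z (s + 1)), nicholsonYTheta (ν + 1) c = 0 := by
  have hsol := isBesselSol_nicholsonY ν
  have hz0 := h.pos s hs
  have hz1 := h.pos (s + 1) (by omega)
  have hlt := h.mono s (s + 1) hs (by omega)
  have hsq : ∀ x, z s ≤ x → 0 < x ^ 2 - ν * (ν + 1) := fun x hx => by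
    have h1 := h.isFirstYThetaZero.lt_sq hν
    have h2 := h.le_of_le le_rfl hs
    have h3 := h.pos 1 le_rfl
    nlinarith
  have hprod : nicholsonY ν (z s) * nicholsonY ν (z (s + 1)) < 0 := by
    have hne0 := nicholsonY_ne_zero_of_theta_eq_zero (by linarith) hz0 (h.isZero s hs)
    have hne1 := nicholsonY_ne_zero_of_theta_eq_zero (by linarith) hz1
      (h.isZero (s + 1) (by omega))
    obtain ⟨x, hx, hx0⟩ : ∃ x ∈ Set.Ioo (z s) (z (s + 1)), nicholsonY ν x = 0 := by
      obtain ⟨x, hx, hx0⟩ := exists_hasDerivAt_eq_zero hlt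
        (hsol.continuousOn_theta.mono fun t ht => hz0.trans_le ht.1)
        ((h.isZero s hs).trans (h.isZero (s + 1) (by omega)).symm)
        fun t ht => hsol.hasDerivAt_theta t (hz0.trans ht.1)
      refine ⟨x, hx, ?_⟩
      have h1 := hsq x hx.1.le
      have h2 : x ^ 2 - ν ^ 2 ≠ 0 := by nlinarith
      rw [div_eq_zero_iff, or_iff_left (hz0.trans hx.1).ne', mul_eq_zero, neg_eq_zero] at hx0
      exact hx0.resolve_left h2
    have hy0 : ∀ t ∈ Set.Ioo (z s) (z (s + 1)), 0 < t := fun t ht => hz0.trans ht.1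
    have hcontY : ContinuousOn (nicholsonY ν) (Set.Icc (z s) (z (s + 1))) :=
      hsol.continuousOn.mono fun t ht => hz0.trans_le ht.1
    have hderiv : ∀ t ∈ Set.Icc (z s) (z (s + 1)),
        HasDerivAt (nicholsonY ν) (nicholsonYTheta ν t / t) t := fun t ht =>
      hsol.hasDerivAt t (hz0.trans_le ht.1)
    have hl : z s ∈ Set.Icc (z s) (z (s + 1)) := ⟨le_rfl, hlt.le⟩
    have hr : z (s + 1) ∈ Set.Icc (z s) (z (s + 1)) := ⟨hlt.le, le_rfl⟩
    have hcontV : ContinuousOn (nicholsonYTheta ν) (Set.Ioo (z s) (z (s + 1))) :=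
      hsol.continuousOn_theta.mono hy0
    rcases (h.ne_zero_of_mem_Ioo hs hx).lt_or_gt with hsgn | hsgn
    · have hanti : StrictAntiOn (nicholsonY ν) (Set.Icc (z s) (z (s + 1))) :=
        strictAntiOn_of_hasDerivAt_neg (convex_Icc _ _) hderiv fun t ht => by
          rw [interior_Icc] at ht
          exact div_neg_of_neg_of_pos (neg_of_ne_zero_of_neg isPreconnected_Ioo hcontV
            (fun _ => h.ne_zero_of_mem_Ioo hs) hx hsgn t ht) (hy0 t ht)
      have h1 := hanti hl ⟨hx.1.le, hx.2.le⟩ hx.1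
      have h2 := hanti ⟨hx.1.le, hx.2.le⟩ hr hx.2
      rw [hx0] at h1 h2
      exact mul_neg_of_pos_of_neg h1 h2
    · have hmono : StrictMonoOn (nicholsonY ν) (Set.Icc (z s) (z (s + 1))) :=
        strictMonoOn_of_hasDerivAt_pos (convex_Icc _ _) hderiv fun t ht => by
          rw [interior_Icc] at ht
          exact div_pos (pos_of_ne_zero_of_pos isPreconnected_Ioo hcontV
            (fun _ => h.ne_zero_of_mem_Ioo hs) hx hsgn t ht) (hy0 t ht)
      have h1 := hmono hl ⟨hx.1.le, hx.2.le⟩ hx.1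
      have h2 := hmono ⟨hx.1.le, hx.2.le⟩ hr hx.2
      rw [hx0] at h1 h2
      exact mul_neg_of_neg_of_pos h1 h2
  have e0 := nicholsonYTheta_add_one_of_theta_eq_zero (by linarith) hz0 (h.isZero s hs)
  have e1 := nicholsonYTheta_add_one_of_theta_eq_zero (by linarith) hz1
    (h.isZero (s + 1) (by omega))
  have q0 := hsq (z s) le_rfl
  have q1 := hsq (z (s + 1)) hlt.le
  have hcont : ContinuousOn (nicholsonYTheta (ν + 1)) (Set.Icc (z s) (z (s + 1))) :=
    (isBesselSol_nicholsonY (ν + 1)).continuousOn_theta.mono fun t ht => hz0.trans_le ht.1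
  rcases mul_neg_iff.1 hprod with ⟨h1, h2⟩ | ⟨h1, h2⟩
  · have k0 : 0 < nicholsonYTheta (ν + 1) (z s) :=
      pos_of_mul_pos_right (e0 ▸ mul_pos h1 q0) hz0.le
    have k1 : nicholsonYTheta (ν + 1) (z (s + 1)) < 0 :=
      neg_of_mul_neg_right (e1 ▸ mul_neg_of_neg_of_pos h2 q1) hz1.le
    exact intermediate_value_Ioo' hlt.le hcont ⟨k1, k0⟩
  · have k0 : nicholsonYTheta (ν + 1) (z s) < 0 :=
      neg_of_mul_neg_right (e0 ▸ mul_neg_of_neg_of_pos h1 q0) hz0.le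
    have k1 : 0 < nicholsonYTheta (ν + 1) (z (s + 1)) :=
      pos_of_mul_pos_right (e1 ▸ mul_pos h2 q1) hz1.le
    exact intermediate_value_Ioo hlt.le hcont ⟨k0, k1⟩

/-- Interlacing of the positive zeros of `Y'_ν` and `Y'_{ν+ε}` for `0 < ε ≤ 1`:
`y'_{ν,s} < y'_{ν+ε,s} < y'_{ν,s+1}` for all `s ≥ 1`. -/
theorem besselYDeriv_zeros_interlace_eps (ν ε : ℝ) (hν : 0 ≤ ν)
    (hε : 0 < ε) (hε1 : ε ≤ 1)
    (y' yε' : ℕ → ℝ)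
    (hy' : IsPosZeroSeq (deriv (besselY ν)) y')
    (hyε' : IsPosZeroSeq (deriv (besselY (ν + ε))) yε') :
    ∀ s : ℕ, 1 ≤ s → y' s < yε' s ∧ yε' s < y' (s + 1) := by
  have hz := isPosZeroSeq_nicholsonYTheta (by linarith) hy'
  have hzε := isPosZeroSeq_nicholsonYTheta (by linarith) hyε'
  have hc : ∀ s : ℕ, ∃ c, 1 ≤ s → c ∈ Set.Ioo (y' s) (y' (s + 1)) ∧
      nicholsonYTheta (ν + 1) c = 0 := fun s => by
    by_cases hs : 1 ≤ s
    · obtain ⟨c, h1, h2⟩ := hz.exists_nicholsonYTheta_add_one_zero hν hs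
      exact ⟨c, fun _ => ⟨h1, h2⟩⟩
    · exact ⟨0, fun h => absurd h hs⟩
  choose c hc using hc
  have hc0 : 0 < c 1 := (hz.pos 1 le_rfl).trans (hc 1 le_rfl).1.1
  have hcz : ∀ s, 1 ≤ s → nicholsonYTheta (ν + 1) (c s) = 0 := fun s hs => (hc s hs).2
  have hcm : ∀ s, 1 ≤ s → c s < c (s + 1) := fun s hs =>
    (hc s hs).1.2.trans (hc (s + 1) (by omega)).1.1
  intro s hs
  refine ⟨hz.lt_of_nicholsonYTheta_zeros hν (by linarith) (hzε.pos 1 le_rfl) hzε.isZero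
    (fun s hs => hzε.mono s (s + 1) hs (by omega)) s hs, lt_of_le_of_lt ?_ (hc s hs).1.2⟩
  rcases hε1.eq_or_lt with rfl | hlt
  · exact hzε.le_of_zeros hc0 hcz hcm s hs
  · exact (hzε.lt_of_nicholsonYTheta_zeros (by linarith) (by linarith) hc0 hcz hcm s hs).le
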